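/- arXiv:math/0306393 — 2 statements merged into one kernel-verified Lean document; each statement's English description precedes it below -/
import Mathlib

section
/- If the affine cubic surface C = {X_1 X_2 X_3 - X_1^2 - X_2^2 - X_3^2 + p_1 X_1 + p_2 X_2 + p_3 X_3 + p_0 + 4 = 0} in C^3 is smooth, then its singular (de Rham / topological) cohomology with complex coefficients satisfies H^0(C) = C, H^1(C) = 0, H^2(C) = C^5, and H^i(C) = 0 for i > 2. -/
open MvPolynomial CategoryTheory

/-- The singular chain complex of a topological space with `ℂ` coefficients:
apply the free `ℂ`-module functor to the singular simplicial set and take the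
alternating face map complex. -/
noncomputable def singularChainComplex (X : TopCat.{0}) : ChainComplex (ModuleCat ℂ) ℕ :=
  (AlgebraicTopology.alternatingFaceMapComplex (ModuleCat ℂ)).obj
    (((SimplicialObject.whiskering _ _).obj (ModuleCat.free ℂ)).obj (TopCat.toSSet.obj X))

/-- Singular homology with `ℂ` coefficients. -/
noncomputable def SingularHomologyC (X : TopCat.{0}) (n : ℕ) : ModuleCat ℂ :=
  (singularChainComplex X).homology n

/-- Singular cohomology with `ℂ` coefficients: since `ℂ` is a field, by the universal
coefficient theorem `H^n(X, ℂ)` is the linear dual of `H_n(X, ℂ)`. -/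
noncomputable def SingularCohomologyC (X : TopCat.{0}) (n : ℕ) : Type :=
  Module.Dual ℂ (SingularHomologyC X n)

noncomputable instance (X : TopCat.{0}) (n : ℕ) :
    AddCommGroup (SingularCohomologyC X n) := by
  unfold SingularCohomologyC; infer_instance

noncomputable instance (X : TopCat.{0}) (n : ℕ) :
    Module ℂ (SingularCohomologyC X n) := by
  unfold SingularCohomologyC; infer_instance

open MvPolynomial CategoryTheory
/-! ### Elementwise description of homology -/

namespace CubicHom

section elementwise
variable (K : ChainComplex (ModuleCat.{0} ℂ) ℕ) (n : ℕ)

lemma iCycles_inj : Function.Injective (K.iCycles n) :=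
  (ModuleCat.mono_iff_injective _).1 inferInstance

lemma homologyπ_surj : Function.Surjective (K.homologyπ n) :=
  (ModuleCat.epi_iff_surjective _).1 inferInstance

lemma d_iCycles_apply (j : ℕ) (z : K.cycles n) : K.d n j (K.iCycles n z) = 0 := by
  rw [← ModuleCat.comp_apply, K.iCycles_d]; rfl

lemma exists_cycle (x : K.X n) (hx : ∀ j, K.d n j x = 0) :
    ∃ z : K.cycles n, K.iCycles n z = x := by
  let k : ModuleCat.of ℂ ℂ ⟶ K.X n := ModuleCat.ofHom (LinearMap.toSpanSingleton ℂ (K.X n) x)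
  have hk : k ≫ K.d n ((ComplexShape.down ℕ).next n) = 0 := by
    ext
    simpa [k] using hx _
  refine ⟨K.liftCycles k _ rfl hk (1 : ℂ), ?_⟩
  rw [← ModuleCat.comp_apply, K.liftCycles_i]
  simp [k]

lemma homologyπ_eq_zero_iff (z : K.cycles n) :
    K.homologyπ n z = 0 ↔ ∃ y : K.X (n + 1), K.d (n + 1) n y = K.iCycles n z := by
  have hex : (ShortComplex.mk (K.toCycles (n+1) n) (K.homologyπ n) (by simp)).Exact := by
    exact ShortComplex.exact_of_g_is_cokernel _ (K.homologyIsCokernel (n+1) n (by simp))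
  rw [ShortComplex.moduleCat_exact_iff] at hex
  constructor
  · intro h
    obtain ⟨y, hy⟩ := hex z h
    refine ⟨y, ?_⟩
    rw [← hy]
    dsimp
    rw [← ModuleCat.comp_apply, K.toCycles_i]
  · rintro ⟨y, hy⟩
    have : z = K.toCycles (n+1) n y := by
      apply iCycles_inj K n
      rw [← hy, ← ModuleCat.comp_apply, K.toCycles_i]
    rw [this, ← ModuleCat.comp_apply, K.toCycles_comp_homologyπ]; rfl

variable {K} {L : ChainComplex (ModuleCat.{0} ℂ) ℕ} (f : K ⟶ L)

lemma f_d_apply (i j : ℕ) (x : K.X i) : f.f j (K.d i j x) = L.d i j (f.f i x) := by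
  rw [← ModuleCat.comp_apply, ← ModuleCat.comp_apply, f.comm]

lemma iCycles_cyclesMap (z : K.cycles n) :
    L.iCycles n (HomologicalComplex.cyclesMap f n z) = f.f n (K.iCycles n z) := by
  rw [← ModuleCat.comp_apply, ← ModuleCat.comp_apply, HomologicalComplex.cyclesMap_i]

lemma homologyMap_π (z : K.cycles n) :
    HomologicalComplex.homologyMap f n (K.homologyπ n z)
      = L.homologyπ n (HomologicalComplex.cyclesMap f n z) := by
  rw [← ModuleCat.comp_apply, ← ModuleCat.comp_apply, HomologicalComplex.homologyπ_naturality]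

end elementwise

end CubicHom

open MvPolynomial CategoryTheory
/-! ### The algebra of the Mayer-Vietoris sequence -/

namespace CubicHom

/-- Homology map as a linear map. -/
noncomputable abbrev hmap {K L : ChainComplex (ModuleCat.{0} ℂ) ℕ} (f : K ⟶ L) (n : ℕ) :
    K.homology n →ₗ[ℂ] L.homology n := (HomologicalComplex.homologyMap f n).hom

/-- Four chain complexes as in a Mayer-Vietoris situation. -/
structure MVData {D A B W : ChainComplex (ModuleCat.{0} ℂ) ℕ}
    (i : D ⟶ A) (j : D ⟶ B) (k : A ⟶ W) (l : B ⟶ W) : Prop where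
  comm : ∀ n (x : D.X n), k.f n (i.f n x) = l.f n (j.f n x)
  inj : ∀ n, Function.Injective (i.f n)
  inter : ∀ n (u : A.X n) (v : B.X n), k.f n u = l.f n v → ∃ z : D.X n, i.f n z = u ∧ j.f n z = v
  small : ∀ n (c : W.X n), (∀ m, ∃ (u : A.X m) (v : B.X m), W.d n m c = k.f m u - l.f m v) →
    ∃ (t : W.X (n + 1)) (u : A.X n) (v : B.X n), c - W.d (n + 1) n t = k.f n u - l.f n v

lemma sub_eq_sub_swap' {M : Type*} [AddCommGroup M] {a b c d : M} (h : a - b = c - d) :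
    a - c = b - d := by
  rw [sub_eq_sub_iff_add_eq_add] at h ⊢
  rw [h]; abel

namespace MVData

variable {D A B W : ChainComplex (ModuleCat.{0} ℂ) ℕ}
    {i : D ⟶ A} {j : D ⟶ B} {k : A ⟶ W} {l : B ⟶ W}

/-- first map of the Mayer-Vietoris sequence -/
noncomputable abbrev mapa (i : D ⟶ A) (j : D ⟶ B) (n : ℕ) :
    D.homology n →ₗ[ℂ] A.homology n × B.homology n :=
  (hmap i n).prod (hmap j n)

/-- second map of the Mayer-Vietoris sequence -/
noncomputable abbrev mapb (k : A ⟶ W) (l : B ⟶ W) (n : ℕ) :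
    A.homology n × B.homology n →ₗ[ℂ] W.homology n :=
  (hmap k n).coprod (-(hmap l n))

lemma exact_mid (h : MVData i j k l) (n : ℕ) : Function.Exact (mapa i j n) (mapb k l n) := by
  rintro ⟨x, y⟩
  obtain ⟨u, rfl⟩ := homologyπ_surj A n x
  obtain ⟨v, rfl⟩ := homologyπ_surj B n y
  constructor
  · intro hb
    have hb' : W.homologyπ n (HomologicalComplex.cyclesMap k n u -
        HomologicalComplex.cyclesMap l n v) = 0 := by
      rw [map_sub, ← homologyMap_π, ← homologyMap_π]
      simpa [sub_eq_add_neg] using hb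
    rw [homologyπ_eq_zero_iff] at hb'
    obtain ⟨w, hw⟩ := hb'
    rw [map_sub, iCycles_cyclesMap, iCycles_cyclesMap] at hw
    obtain ⟨t, u', v', ht⟩ := h.small (n + 1) w (by
      intro m
      by_cases hm : m = n
      · subst hm
        exact ⟨_, _, hw⟩
      · refine ⟨0, 0, ?_⟩
        rw [W.shape _ _ (by simpa using fun h => hm h)]
        simp)
    have h2 : W.d (n + 1) n w = k.f n (A.d (n+1) n u') - l.f n (B.d (n+1) n v') := by
      rw [f_d_apply, f_d_apply, ← map_sub, ← ht, map_sub, ← ModuleCat.comp_apply, W.d_comp_d]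
      simp
    obtain ⟨z, hz1, hz2⟩ := h.inter n (A.iCycles n u - A.d (n+1) n u')
      (B.iCycles n v - B.d (n+1) n v') (by
        rw [map_sub, map_sub]
        rw [hw] at h2
        exact sub_eq_sub_swap' h2)
    obtain ⟨ζ, hζ⟩ := exists_cycle D n z (by
      intro m
      apply h.inj m
      rw [f_d_apply, hz1, map_sub, d_iCycles_apply, ← ModuleCat.comp_apply, A.d_comp_d]
      simp)
    refine ⟨D.homologyπ n ζ, ?_⟩
    ext
    · change HomologicalComplex.homologyMap i n (D.homologyπ n ζ) = A.homologyπ n u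
      rw [homologyMap_π, ← sub_eq_zero, ← map_sub, homologyπ_eq_zero_iff]
      refine ⟨-u', ?_⟩
      rw [map_sub, iCycles_cyclesMap, hζ, hz1, map_neg]
      abel
    · change HomologicalComplex.homologyMap j n (D.homologyπ n ζ) = B.homologyπ n v
      rw [homologyMap_π, ← sub_eq_zero, ← map_sub, homologyπ_eq_zero_iff]
      refine ⟨-v', ?_⟩
      rw [map_sub, iCycles_cyclesMap, hζ, hz2, map_neg]
      abel
  · rintro ⟨z, hz⟩
    obtain ⟨ζ, rfl⟩ := homologyπ_surj D n z
    rw [← hz]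
    change HomologicalComplex.homologyMap k n (HomologicalComplex.homologyMap i n _) +
      - HomologicalComplex.homologyMap l n (HomologicalComplex.homologyMap j n _) = 0
    rw [homologyMap_π, homologyMap_π, homologyMap_π, homologyMap_π, ← sub_eq_add_neg, ← map_sub]
    have h0 : HomologicalComplex.cyclesMap k n (HomologicalComplex.cyclesMap i n ζ) -
        HomologicalComplex.cyclesMap l n (HomologicalComplex.cyclesMap j n ζ) = 0 := by
      apply iCycles_inj
      rw [map_sub, iCycles_cyclesMap, iCycles_cyclesMap, iCycles_cyclesMap, iCycles_cyclesMap,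
        h.comm]
      simp
    rw [h0, map_zero]

lemma surj_zero (h : MVData i j k l) : Function.Surjective (mapb k l 0) := by
  intro w
  obtain ⟨c, rfl⟩ := homologyπ_surj W 0 w
  obtain ⟨t, u, v, ht⟩ := h.small 0 (W.iCycles 0 c) (by
    intro m
    exact ⟨0, 0, by rw [d_iCycles_apply]; simp⟩)
  obtain ⟨u', hu'⟩ := exists_cycle A 0 u (by
    intro m; rw [A.shape _ _ (by simp)]; rfl)
  obtain ⟨v', hv'⟩ := exists_cycle B 0 v (by
    intro m; rw [B.shape _ _ (by simp)]; rfl)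
  refine ⟨(A.homologyπ 0 u', B.homologyπ 0 v'), ?_⟩
  change HomologicalComplex.homologyMap k 0 (A.homologyπ 0 u') +
      - HomologicalComplex.homologyMap l 0 (B.homologyπ 0 v') = _
  rw [homologyMap_π, homologyMap_π, ← sub_eq_add_neg, ← map_sub, ← sub_eq_zero, ← map_sub,
    homologyπ_eq_zero_iff]
  refine ⟨-t, ?_⟩
  rw [map_sub, map_sub, iCycles_cyclesMap, iCycles_cyclesMap, hu', hv', ← ht, map_neg]
  abel

/-- triples used for the connecting map -/
noncomputable def triples (i : D ⟶ A) (j : D ⟶ B) (n : ℕ) :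
    Submodule ℂ (D.cycles n × A.X (n + 1) × B.X (n + 1)) where
  carrier := {p | A.d (n+1) n p.2.1 = i.f n (D.iCycles n p.1) ∧
    B.d (n+1) n p.2.2 = j.f n (D.iCycles n p.1)}
  add_mem' := by
    rintro p q ⟨h1, h2⟩ ⟨h3, h4⟩
    constructor <;> simp [*]
  zero_mem' := by constructor <;> simp
  smul_mem' := by
    rintro c p ⟨h1, h2⟩
    constructor <;> simp [*]

lemma triple_cycle (h : MVData i j k l) (n : ℕ) (p : triples i j n) (m : ℕ) :
    W.d (n+1) m (k.f (n+1) p.1.2.1 - l.f (n+1) p.1.2.2) = 0 := by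
  by_cases hm : m = n
  · subst hm
    rw [map_sub, ← f_d_apply, ← f_d_apply, p.2.1, p.2.2, h.comm, sub_self]
  · rw [W.shape _ _ (by simpa using fun h => hm h)]
    rfl

/-- the class in the homology of the total space of a triple -/
lemma exists_triple_map (h : MVData i j k l) (n : ℕ) :
    ∃ q : triples i j n →ₗ[ℂ] W.cycles (n + 1),
      ∀ p, W.iCycles (n+1) (q p) = k.f (n+1) p.1.2.1 - l.f (n+1) p.1.2.2 := by
  choose q hq using fun p => exists_cycle W (n+1) _ (triple_cycle h n p)
  refine ⟨⟨⟨q, ?_⟩, ?_⟩, hq⟩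
  · intro x y
    apply iCycles_inj
    rw [hq, map_add, hq, hq]
    simp
    abel
  · intro c x
    apply iCycles_inj
    rw [hq]
    simp [hq, smul_sub]

lemma exists_delta (h : MVData i j k l) (n : ℕ) :
    ∃ δ : W.homology (n + 1) →ₗ[ℂ] D.homology n,
      Function.Exact (mapb k l (n+1)) δ ∧ Function.Exact δ (mapa i j n) := by
  obtain ⟨q0, hq0⟩ := exists_triple_map h n
  let q : triples i j n →ₗ[ℂ] W.homology (n+1) := (W.homologyπ (n+1)).hom ∘ₗ q0
  let r : triples i j n →ₗ[ℂ] D.homology n :=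
    (D.homologyπ n).hom ∘ₗ (LinearMap.fst ℂ _ _) ∘ₗ (triples i j n).subtype
  have hq : ∀ p, q p = W.homologyπ (n+1) (q0 p) := fun p => rfl
  have hr : ∀ p, r p = D.homologyπ n p.1.1 := fun p => rfl
  have qsurj : Function.Surjective q := by
    intro w
    obtain ⟨c, rfl⟩ := homologyπ_surj W (n+1) w
    obtain ⟨t, u, v, ht⟩ := h.small (n+1) (W.iCycles (n+1) c) (by
      intro m
      exact ⟨0, 0, by rw [d_iCycles_apply]; simp⟩)
    have hd : ∀ m, W.d (n+1) m (k.f (n+1) u - l.f (n+1) v) = 0 := by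
      intro m
      rw [← ht, map_sub, d_iCycles_apply, ← ModuleCat.comp_apply, W.d_comp_d]
      simp
    obtain ⟨z, hz1, hz2⟩ := h.inter n (A.d (n+1) n u) (B.d (n+1) n v) (by
      have := hd n
      rw [map_sub, ← f_d_apply, ← f_d_apply] at this
      exact sub_eq_zero.1 this)
    obtain ⟨ζ, hζ⟩ := exists_cycle D n z (by
      intro m
      apply h.inj m
      rw [f_d_apply, hz1, ← ModuleCat.comp_apply, A.d_comp_d]
      simp)
    refine ⟨⟨(ζ, u, v), ?_, ?_⟩, ?_⟩
    · simp [hζ, hz1]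
    · simp [hζ, hz2]
    · rw [hq, ← sub_eq_zero, ← map_sub, homologyπ_eq_zero_iff]
      refine ⟨-t, ?_⟩
      rw [map_sub, hq0]
      dsimp only
      rw [← ht, map_neg]
      abel
  have hker : LinearMap.ker q ≤ LinearMap.ker r := by
    intro p hp
    rw [LinearMap.mem_ker, hq, homologyπ_eq_zero_iff] at hp
    obtain ⟨w, hw⟩ := hp
    rw [hq0] at hw
    rw [LinearMap.mem_ker, hr, homologyπ_eq_zero_iff]
    obtain ⟨t, u', v', ht⟩ := h.small (n + 2) w (by
      intro m
      by_cases hm : m = n + 1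
      · subst hm
        exact ⟨_, _, hw⟩
      · refine ⟨0, 0, ?_⟩
        rw [W.shape _ _ (by simp; omega)]
        simp)
    have h2 : W.d (n + 2) (n+1) w =
        k.f (n+1) (A.d (n+2) (n+1) u') - l.f (n+1) (B.d (n+2) (n+1) v') := by
      rw [f_d_apply, f_d_apply, ← map_sub, ← ht, map_sub, ← ModuleCat.comp_apply, W.d_comp_d]
      simp
    obtain ⟨z, hz1, hz2⟩ := h.inter (n+1) (p.1.2.1 - A.d (n+2) (n+1) u')
      (p.1.2.2 - B.d (n+2) (n+1) v') (by
        rw [map_sub, map_sub]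
        rw [hw] at h2
        exact sub_eq_sub_swap' h2)
    refine ⟨z, ?_⟩
    apply h.inj n
    rw [f_d_apply, hz1, map_sub, ← ModuleCat.comp_apply, A.d_comp_d, p.2.1]
    simp
  obtain ⟨δ, hδ⟩ : ∃ δ : W.homology (n + 1) →ₗ[ℂ] D.homology n, ∀ p, δ (q p) = r p := by
    refine ⟨(LinearMap.ker q).liftQ r hker ∘ₗ
      (q.quotKerEquivOfSurjective qsurj).symm.toLinearMap, fun p => ?_⟩
    have : (q.quotKerEquivOfSurjective qsurj).symm (q p) = Submodule.Quotient.mk p := by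
      rw [LinearEquiv.symm_apply_eq]
      rfl
    simp [this]
  refine ⟨δ, ?_, ?_⟩
  · intro w
    obtain ⟨p, rfl⟩ := qsurj w
    rw [hδ, hr, homologyπ_eq_zero_iff]
    constructor
    · rintro ⟨z, hz⟩
      obtain ⟨u, hu⟩ := exists_cycle A (n+1) (p.1.2.1 - i.f (n+1) z) (by
        intro m
        by_cases hm : m = n
        · subst hm
          rw [map_sub, p.2.1, ← f_d_apply, hz, sub_self]
        · rw [A.shape _ _ (by simpa using fun h => hm h)]
          rfl)
      obtain ⟨v, hv⟩ := exists_cycle B (n+1) (p.1.2.2 - j.f (n+1) z) (by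
        intro m
        by_cases hm : m = n
        · subst hm
          rw [map_sub, p.2.2, ← f_d_apply, hz, sub_self]
        · rw [B.shape _ _ (by simpa using fun h => hm h)]
          rfl)
      refine ⟨(A.homologyπ _ u, B.homologyπ _ v), ?_⟩
      change HomologicalComplex.homologyMap k _ (A.homologyπ _ u) +
        - HomologicalComplex.homologyMap l _ (B.homologyπ _ v) = _
      rw [homologyMap_π, homologyMap_π, ← sub_eq_add_neg, ← map_sub, hq]
      congr 1
      apply iCycles_inj
      rw [map_sub, iCycles_cyclesMap, iCycles_cyclesMap, hu, hv, hq0, map_sub, map_sub, h.comm]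
      abel
    · rintro ⟨⟨x, y⟩, hxy⟩
      obtain ⟨u, rfl⟩ := homologyπ_surj A _ x
      obtain ⟨v, rfl⟩ := homologyπ_surj B _ y
      let p' : triples i j n := ⟨(0, A.iCycles _ u, B.iCycles _ v), by
        simp [d_iCycles_apply], by simp [d_iCycles_apply]⟩
      have hp' : q p' = q p := by
        rw [← hxy]
        change _ = HomologicalComplex.homologyMap k _ (A.homologyπ _ u) +
          - HomologicalComplex.homologyMap l _ (B.homologyπ _ v)
        rw [homologyMap_π, homologyMap_π, ← sub_eq_add_neg, ← map_sub, hq]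
        congr 1
        apply iCycles_inj
        rw [map_sub, iCycles_cyclesMap, iCycles_cyclesMap, hq0]
      rw [← homologyπ_eq_zero_iff, ← hr, ← hδ, ← hp', hδ, hr]
      simp [p']
  · intro w
    obtain ⟨ζ, rfl⟩ := homologyπ_surj D _ w
    constructor
    · intro h0
      have h1 : HomologicalComplex.homologyMap i n (D.homologyπ n ζ) = 0 := congrArg Prod.fst h0
      have h2 : HomologicalComplex.homologyMap j n (D.homologyπ n ζ) = 0 := congrArg Prod.snd h0
      rw [homologyMap_π, homologyπ_eq_zero_iff] at h1 h2
      obtain ⟨u, hu⟩ := h1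
      obtain ⟨v, hv⟩ := h2
      rw [iCycles_cyclesMap] at hu hv
      exact ⟨q ⟨(ζ, u, v), hu, hv⟩, by rw [hδ, hr]⟩
    · rintro ⟨y, hy⟩
      obtain ⟨p, rfl⟩ := qsurj y
      rw [hδ, hr] at hy
      rw [← hy]
      refine Prod.ext ?_ ?_
      · change HomologicalComplex.homologyMap i n _ = 0
        rw [homologyMap_π, homologyπ_eq_zero_iff]
        exact ⟨p.1.2.1, by rw [iCycles_cyclesMap, p.2.1]⟩
      · change HomologicalComplex.homologyMap j n _ = 0
        rw [homologyMap_π, homologyπ_eq_zero_iff]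
        exact ⟨p.1.2.2, by rw [iCycles_cyclesMap, p.2.2]⟩

end MVData
end CubicHom

open MvPolynomial CategoryTheory
/-! ### The singular chain functor -/

namespace CubicHom
open Limits

/-- functorial version of `singularChainComplex` -/
noncomputable def SC : TopCat.{0} ⥤ ChainComplex (ModuleCat.{0} ℂ) ℕ :=
  TopCat.toSSet ⋙ (SimplicialObject.whiskering _ _).obj (ModuleCat.free ℂ) ⋙
    AlgebraicTopology.alternatingFaceMapComplex (ModuleCat ℂ)

lemma SC_obj (X : TopCat.{0}) : SC.obj X = singularChainComplex X := rfl

/-- The free module on a type as a coproduct -/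
noncomputable def freeIso : ModuleCat.free.{0} ℂ ≅ sigmaConst.obj (ModuleCat.of ℂ ℂ) :=
  NatIso.ofComponents (fun S =>
    { hom := ModuleCat.ofHom (Finsupp.lift _ ℂ S (fun s => (Sigma.ι (fun _ : S => ModuleCat.of ℂ ℂ) s).hom (1 : ℂ)))
      inv := Sigma.desc (fun s => ModuleCat.ofHom (Finsupp.lsingle s))
      hom_inv_id := by
        apply ModuleCat.free_hom_ext
        intro x
        change (Limits.Sigma.desc (fun s : S => ModuleCat.ofHom (Finsupp.lsingle (R := ℂ) (M := ℂ) s))).hom (Finsupp.lift _ ℂ S (fun s => (Sigma.ι (fun _ : S => ModuleCat.of ℂ ℂ) s).hom (1 : ℂ)) (Finsupp.single x 1)) = _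
        rw [Finsupp.lift_apply, Finsupp.sum_single_index (by simp), one_smul]
        have := Sigma.ι_desc (fun s : S => ModuleCat.ofHom (Finsupp.lsingle (R := ℂ) (M := ℂ) s)) x
        exact congrArg (fun f => f.hom (1 : ℂ)) this
      inv_hom_id := by
        apply Sigma.hom_ext
        intro x
        apply ModuleCat.hom_ext
        apply LinearMap.ext_ring
        have := Sigma.ι_desc (fun s : S => ModuleCat.ofHom (Finsupp.lsingle (R := ℂ) (M := ℂ) s)) x
        have := congrArg (fun f => f.hom (1 : ℂ)) this
        change (Finsupp.lift _ ℂ S (fun s => (Sigma.ι (fun _ : S => ModuleCat.of ℂ ℂ) s).hom (1 : ℂ)) ((Limits.Sigma.desc (fun s : S => ModuleCat.ofHom (Finsupp.lsingle (R := ℂ) (M := ℂ) s))).hom ((Sigma.ι (fun _ : S => ModuleCat.of ℂ ℂ) x).hom (1 : ℂ)))) = _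
        refine (congrArg _ this).trans ?_
        change (Finsupp.lift _ ℂ S (fun s => (Sigma.ι (fun _ : S => ModuleCat.of ℂ ℂ) s).hom (1 : ℂ)) (Finsupp.single x 1)) = _
        rw [Finsupp.lift_apply, Finsupp.sum_single_index (by simp), one_smul]
        rfl })
    (by
      intro S T f
      apply ModuleCat.free_hom_ext
      intro x
      rw [ModuleCat.comp_apply, ModuleCat.comp_apply, ModuleCat.free_map_apply]
      change (Finsupp.lift _ ℂ T (fun s => (Sigma.ι (fun _ : T => ModuleCat.of ℂ ℂ) s).hom (1 : ℂ)) (Finsupp.single (f x) 1)) = ((sigmaConst.obj (ModuleCat.of ℂ ℂ)).map f).hom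
        (Finsupp.lift _ ℂ S (fun s => (Sigma.ι (fun _ : S => ModuleCat.of ℂ ℂ) s).hom (1 : ℂ)) (Finsupp.single x 1))
      rw [Finsupp.lift_apply, Finsupp.sum_single_index (by simp), one_smul]
      rw [Finsupp.lift_apply, Finsupp.sum_single_index (by simp), one_smul]
      have := Sigma.ι_comp_map' (f := fun _ : S => ModuleCat.of ℂ ℂ) (g := fun _ : T => ModuleCat.of ℂ ℂ) f (fun _ => 𝟙 _) x
      have := congrArg (fun f => f.hom (1 : ℂ)) this
      exact this.symm)

/-- comparison with Mathlib's singular chain complex functor -/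
noncomputable def SCIso : SC ≅ (AlgebraicTopology.singularChainComplexFunctor (ModuleCat.{0} ℂ)).obj (ModuleCat.of ℂ ℂ) :=
  Functor.isoWhiskerLeft TopCat.toSSet (Functor.isoWhiskerRight ((SimplicialObject.whiskering _ _).mapIso freeIso) (AlgebraicTopology.alternatingFaceMapComplex (ModuleCat ℂ)))

/-- homology of a space -/
noncomputable abbrev HH (X : Type) [TopologicalSpace X] (n : ℕ) : ModuleCat.{0} ℂ := (SC.obj (TopCat.of X)).homology n

/-- homology map -/
noncomputable def hm {X Y : Type} [TopologicalSpace X] [TopologicalSpace Y] (f : C(X, Y)) (n : ℕ) :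
    HH X n →ₗ[ℂ] HH Y n := hmap (SC.map (TopCat.ofHom f)) n

variable {X Y Z : Type} [TopologicalSpace X] [TopologicalSpace Y] [TopologicalSpace Z]

lemma hm_id (n : ℕ) : hm (ContinuousMap.id X) n = LinearMap.id := by
  have : TopCat.ofHom (ContinuousMap.id X) = 𝟙 (TopCat.of X) := rfl
  rw [hm, hmap, this, SC.map_id, HomologicalComplex.homologyMap_id]; rfl

lemma hm_comp (f : C(X, Y)) (g : C(Y, Z)) (n : ℕ) : hm (g.comp f) n = hm g n ∘ₗ hm f n := by
  have : TopCat.ofHom (g.comp f) = TopCat.ofHom f ≫ TopCat.ofHom g := rfl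
  rw [hm, hmap, this, SC.map_comp, HomologicalComplex.homologyMap_comp]; rfl

lemma hm_comp_apply (f : C(X, Y)) (g : C(Y, Z)) (n : ℕ) (x : HH X n) : hm (g.comp f) n x = hm g n (hm f n x) := by
  rw [hm_comp]; rfl

lemma hm_homotopic {f g : C(X, Y)} (h : f.Homotopic g) (n : ℕ) : hm f n = hm g n := by
  obtain ⟨H⟩ := h
  have key := TopCat.Homotopy.congr_homologyMap_singularChainComplexFunctor (f := TopCat.ofHom f) (g := TopCat.ofHom g)
     H (ModuleCat.of ℂ ℂ) n
  have e : ∀ f : TopCat.of X ⟶ TopCat.of Y, SC.map f = SCIso.hom.app _ ≫ ((AlgebraicTopology.singularChainComplexFunctor (ModuleCat.{0} ℂ)).obj (ModuleCat.of ℂ ℂ)).map f ≫ SCIso.inv.app _ := by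
    intro f
    rw [← NatTrans.naturality_assoc, Iso.hom_inv_id_app, Category.comp_id]
  unfold hm hmap
  rw [e, e, HomologicalComplex.homologyMap_comp, HomologicalComplex.homologyMap_comp, key,
    ← HomologicalComplex.homologyMap_comp, ← HomologicalComplex.homologyMap_comp]

/-- homotopy equivalence induces iso -/
noncomputable def hequiv (f : C(X, Y)) (g : C(Y, X)) (h1 : (g.comp f).Homotopic (ContinuousMap.id X))
    (h2 : (f.comp g).Homotopic (ContinuousMap.id Y)) (n : ℕ) : HH X n ≃ₗ[ℂ] HH Y n :=
  LinearEquiv.ofLinearMap (hm f n) (hm g n)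
    (by rw [← hm_comp, hm_homotopic h2, hm_id]) (by rw [← hm_comp, hm_homotopic h1, hm_id])

/-- homology of point -/
lemma hh_isZero [TotallyDisconnectedSpace X] (n : ℕ) (hn : n ≠ 0) : Subsingleton (HH X n) := by
  have := AlgebraicTopology.isZero_singularHomologyFunctor_of_totallyDisconnectedSpace (ModuleCat.{0} ℂ) n (ModuleCat.of ℂ ℂ) (TopCat.of X) hn
  have h2 : IsZero (HH X n) := this.of_iso ((HomologicalComplex.homologyFunctor _ _ n).mapIso (SCIso.app (TopCat.of X)))
  exact ModuleCat.subsingleton_of_isZero h2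

/-- zeroth homology of a totally disconnected space -/
noncomputable def hhZero [TotallyDisconnectedSpace X] : HH X 0 ≃ₗ[ℂ] (X →₀ ℂ) :=
  (((HomologicalComplex.homologyFunctor _ _ 0).mapIso (SCIso.app (TopCat.of X))) ≪≫
    AlgebraicTopology.singularHomologyFunctorZeroOfTotallyDisconnectedSpace (ModuleCat.{0} ℂ) (ModuleCat.of ℂ ℂ) (TopCat.of X) ≪≫
     (freeIso.app X).symm).toLinearEquiv

end CubicHom

open MvPolynomial CategoryTheory
/-! ### Concrete singular chains -/

namespace CubicHom

/-- standard simplex -/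
abbrev Sim (n : ℕ) : Type := stdSimplex ℝ (Fin (n + 1))

/-- singular chains -/
abbrev Ch (X : Type) [TopologicalSpace X] (n : ℕ) : Type := C(Sim n, X) →₀ ℂ

/-- face inclusion -/
noncomputable def face {n : ℕ} (i : Fin (n + 2)) : C(Sim n, Sim (n + 1)) :=
  ⟨stdSimplex.map (Fin.succAbove i), stdSimplex.continuous_map _⟩

variable {X Y Z : Type} [TopologicalSpace X] [TopologicalSpace Y] [TopologicalSpace Z]

/-- boundary -/
noncomputable def bd (X : Type) [TopologicalSpace X] (n : ℕ) : Ch X (n + 1) →ₗ[ℂ] Ch X n :=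
  ∑ i : Fin (n + 2), ((-1 : ℂ) ^ (i : ℕ)) • Finsupp.lmapDomain ℂ ℂ (fun σ : C(Sim (n+1), X) => σ.comp (face i))

/-- identification of abstract and concrete chains -/
noncomputable def ce (X : Type) [TopologicalSpace X] (n : ℕ) : Ch X n ≃ₗ[ℂ] (SC.obj (TopCat.of X)).X n :=
  Finsupp.domLCongr (TopCat.toSSetObjEquiv (TopCat.of X) (Opposite.op (SimplexCategory.mk n))).symm

lemma ce_single (n : ℕ) (σ : C(Sim n, X)) :
    ce X n (Finsupp.single σ 1) = ModuleCat.freeMk ((TopCat.toSSetObjEquiv (TopCat.of X) (Opposite.op (SimplexCategory.mk n))).symm σ) := by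
  exact Finsupp.domLCongr_single _ _ _

lemma ce_map (f : C(X, Y)) (n : ℕ) (c : Ch X n) : (SC.map (TopCat.ofHom f)).f n (ce X n c) =
    ce Y n (Finsupp.lmapDomain ℂ ℂ (fun σ => f.comp σ) c) := by
  suffices h : ((SC.map (TopCat.ofHom f)).f n).hom ∘ₗ (ce X n).toLinearMap =
    (ce Y n).toLinearMap ∘ₗ (Finsupp.lmapDomain ℂ ℂ (fun σ => f.comp σ)) from congrArg (fun g => g c) h
  apply Finsupp.lhom_ext'
  intro σ
  apply LinearMap.ext_ring
  change (SC.map (TopCat.ofHom f)).f n (ce X n (Finsupp.single σ 1)) = ce Y n (Finsupp.lmapDomain ℂ ℂ (fun σ => f.comp σ) (Finsupp.single σ 1))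
  rw [Finsupp.lmapDomain_apply, Finsupp.mapDomain_single, ce_single, ce_single]
  exact ModuleCat.free_map_apply _ _

lemma sum_delta_apply (S : SimplicialObject (ModuleCat.{0} ℂ)) (n : ℕ) (f : S.obj (Opposite.op (SimplexCategory.mk (n+1))) ⟶ S.obj (Opposite.op (SimplexCategory.mk n)))
    (hf : f = ∑ i : Fin (n + 2), ((-1 : ℤ) ^ (i : ℕ)) • S.δ i) (x : S.obj (Opposite.op (SimplexCategory.mk (n+1)))) :
    f x = ∑ i : Fin (n + 2), ((-1 : ℂ) ^ (i : ℕ)) • S.δ i x := by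
  subst hf
  change (ModuleCat.Hom.hom _) x = _
  rw [ModuleCat.hom_sum, LinearMap.sum_apply]
  refine Finset.sum_congr rfl fun i _ => ?_
  rw [ModuleCat.hom_zsmul, LinearMap.smul_apply, ← Int.cast_smul_eq_zsmul ℂ]
  simp

lemma ce_d (n : ℕ) (c : Ch X (n+1)) : (SC.obj (TopCat.of X)).d (n+1) n (ce X (n+1) c) =
    ce X n (bd X n c) := by
  suffices h : ((SC.obj (TopCat.of X)).d (n+1) n).hom ∘ₗ (ce X (n+1)).toLinearMap =
    (ce X n).toLinearMap ∘ₗ bd X n from congrArg (fun g => g c) h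
  apply Finsupp.lhom_ext'
  intro σ
  apply LinearMap.ext_ring
  change (SC.obj (TopCat.of X)).d (n+1) n (ce X (n+1) (Finsupp.single σ 1)) = ce X n (bd X n (Finsupp.single σ 1))
  rw [ce_single]
  refine (sum_delta_apply (((SimplicialObject.whiskering _ _).obj (ModuleCat.free ℂ)).obj
    (TopCat.toSSet.obj (TopCat.of X))) n _ (AlgebraicTopology.alternatingFaceMapComplex_obj_d _ _) _).trans ?_
  rw [bd, LinearMap.sum_apply, map_sum]
  refine Finset.sum_congr rfl fun i _ => ?_
  rw [LinearMap.smul_apply, Finsupp.lmapDomain_apply, Finsupp.mapDomain_single, map_smul, ce_single]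
  refine congrArg (fun y => ((-1 : ℂ) ^ (i : ℕ)) • y) ?_
  exact ModuleCat.free_map_apply _ _
end CubicHom

open MvPolynomial CategoryTheory
/-! ### Combinatorial subdivision of tuples -/

namespace CubicHom
namespace Tup

/-- formal combinations of tuples -/
abbrev L (K : Type) (n : ℕ) : Type := (Fin n → K) →₀ ℂ

variable {K K' : Type}

/-- boundary of tuples -/
noncomputable def d (n : ℕ) : L K (n + 1) →ₗ[ℂ] L K n :=
  ∑ i : Fin (n + 1), ((-1 : ℂ) ^ (i : ℕ)) • Finsupp.lmapDomain ℂ ℂ (fun v : Fin (n+1) → K => v ∘ i.succAbove)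

/-- cone operator -/
noncomputable def cone (b : K) (n : ℕ) : L K n →ₗ[ℂ] L K (n + 1) :=
  Finsupp.lmapDomain ℂ ℂ (fun v : Fin n → K => (Fin.cons b v : Fin (n+1) → K))

lemma d_single (n : ℕ) (v : Fin (n+1) → K) : d n (Finsupp.single v 1) =
    ∑ i : Fin (n + 1), ((-1 : ℂ) ^ (i : ℕ)) • Finsupp.single (v ∘ i.succAbove) 1 := by
  simp [d, LinearMap.sum_apply]

lemma cone_single (b : K) (n : ℕ) (v : Fin n → K) :
    cone b n (Finsupp.single v 1) = Finsupp.single (Fin.cons b v : Fin (n+1) → K) 1 := by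
  simp [cone]

lemma hom_ext {M : Type*} [AddCommGroup M] [Module ℂ M] {n : ℕ} {f g : L K n →ₗ[ℂ] M}
    (h : ∀ v, f (Finsupp.single v 1) = g (Finsupp.single v 1)) (c : L K n) : f c = g c := by
  have : f = g := Finsupp.lhom_ext' fun v => LinearMap.ext_ring (h v)
  rw [this]

lemma cons_comp_succ_succAbove {n : ℕ} (b : K) (v : Fin (n+1) → K) (i : Fin (n+1)) :
    (Fin.cons b v : Fin (n+2) → K) ∘ (i.succ).succAbove = Fin.cons b (v ∘ i.succAbove) := by
  funext j
  refine Fin.cases ?_ (fun j => ?_) j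
  · simp
  · simp [Fin.succ_succAbove_succ]

lemma d_cone (b : K) (n : ℕ) (c : L K (n+1)) :
    d (n+1) (cone b (n+1) c) = c - cone b n (d n c) := by
  refine hom_ext (f := d (n+1) ∘ₗ cone b (n+1)) (g := LinearMap.id - cone b n ∘ₗ d n) (fun v => ?_) c
  simp only [LinearMap.comp_apply, LinearMap.sub_apply, LinearMap.id_apply, cone_single, d_single]
  rw [Fin.sum_univ_succ, map_sum, sub_eq_add_neg, ← Finset.sum_neg_distrib]
  congr 1
  · simp
  · refine Finset.sum_congr rfl fun i _ => ?_
    rw [map_smul, cone_single, cons_comp_succ_succAbove, ← neg_smul]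
    congr 1
    simp [pow_succ]

lemma d_cone_zero (b : K) (c : L K 0) : d 0 (cone b 0 c) = c := by
  refine hom_ext (f := d 0 ∘ₗ cone b 0) (g := LinearMap.id) (fun v => ?_) c
  simp only [LinearMap.comp_apply, LinearMap.id_apply, cone_single, d_single]
  rw [Fin.sum_univ_one]
  simp

lemma d_d (n : ℕ) (c : L K (n+2)) : d n (d (n+1) c) = 0 := by
  refine hom_ext (f := d n ∘ₗ d (n+1)) (g := 0) (fun v => ?_) c
  have hv : (Finsupp.single v 1 : L K (n+2)) = cone (v 0) (n+1) (Finsupp.single (Fin.tail v) 1) := by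
    rw [cone_single, Fin.cons_self_tail]
  rw [LinearMap.comp_apply, hv, d_cone, map_sub]
  cases n with
  | zero => rw [d_cone_zero]; simp
  | succ n => rw [d_cone, d_d n]; simp

variable (b : ∀ n, (Fin (n+1) → K) → K) (b' : ∀ n, (Fin (n+1) → K') → K')

/-- subdivision -/
noncomputable def S : ∀ n, L K n →ₗ[ℂ] L K n
  | 0 => LinearMap.id
  | n+1 => Finsupp.lift _ ℂ _ (fun v => cone (b n v) n (S n (d n (Finsupp.single v 1))))

/-- chain homotopy -/
noncomputable def T : ∀ n, L K n →ₗ[ℂ] L K (n+1)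
  | 0 => 0
  | n+1 => Finsupp.lift _ ℂ _ (fun v => cone (b n v) (n+1) (Finsupp.single v 1 - T n (d n (Finsupp.single v 1))))

lemma S_succ (n : ℕ) (v : Fin (n+1) → K) : S b (n+1) (Finsupp.single v 1) =
    cone (b n v) n (S b n (d n (Finsupp.single v 1))) := by
  simp [S]

lemma T_succ (n : ℕ) (v : Fin (n+1) → K) : T b (n+1) (Finsupp.single v 1) =
    cone (b n v) (n+1) (Finsupp.single v 1 - T b n (d n (Finsupp.single v 1))) := by
  simp [T]

lemma d_T (n : ℕ) (c : L K (n+1)) : d (n+1) (T b (n+1) c) = c - S b (n+1) c - T b n (d n c) := by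
  refine hom_ext (f := d (n+1) ∘ₗ T b (n+1)) (g := LinearMap.id - S b (n+1) - T b n ∘ₗ d n) (fun v => ?_) c
  simp only [LinearMap.comp_apply, LinearMap.sub_apply, LinearMap.id_apply]
  rw [T_succ, d_cone, S_succ]
  cases n with
  | zero => simp [T, S]
  | succ n =>
    rw [map_sub, d_T n, d_d]
    simp
    abel

/-- push-forward of tuples -/
noncomputable def mp (g : K → K') (n : ℕ) : L K n →ₗ[ℂ] L K' n :=
  Finsupp.lmapDomain ℂ ℂ (fun v => g ∘ v)

lemma mp_single (g : K → K') (n : ℕ) (v : Fin n → K) :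
    mp g n (Finsupp.single v 1) = Finsupp.single (g ∘ v) 1 := by simp [mp]

lemma mp_d (g : K → K') (n : ℕ) (c : L K (n+1)) : mp g n (d n c) = d n (mp g (n+1) c) := by
  refine hom_ext (f := mp g n ∘ₗ d n) (g := d n ∘ₗ mp g (n+1)) (fun v => ?_) c
  simp only [LinearMap.comp_apply, d_single, mp_single, map_sum, map_smul]
  rfl

lemma mp_cone (g : K → K') (n : ℕ) (p : K) (c : L K n) :
    mp g (n+1) (cone p n c) = cone (g p) n (mp g n c) := by
  refine hom_ext (f := mp g (n+1) ∘ₗ cone p n) (g := cone (g p) n ∘ₗ mp g n) (fun v => ?_) c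
  simp only [LinearMap.comp_apply, cone_single, mp_single]
  congr 1
  exact (Fin.comp_cons g p v)

variable {b b'}
lemma mp_S (g : K → K') (hg : ∀ n v, g (b n v) = b' n (g ∘ v)) (n : ℕ) (c : L K n) :
    mp g n (S b n c) = S b' n (mp g n c) := by
  induction n with
  | zero => simp [S]
  | succ n ih =>
    refine hom_ext (f := mp g (n+1) ∘ₗ S b (n+1)) (g := S b' (n+1) ∘ₗ mp g (n+1)) (fun v => ?_) c
    simp only [LinearMap.comp_apply]
    rw [mp_single, S_succ, S_succ, mp_cone, ih, mp_d, mp_single, hg]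

lemma mp_T (g : K → K') (hg : ∀ n v, g (b n v) = b' n (g ∘ v)) (n : ℕ) (c : L K n) :
    mp g (n+1) (T b n c) = T b' n (mp g n c) := by
  induction n with
  | zero => simp [T]
  | succ n ih =>
    refine hom_ext (f := mp g (n+2) ∘ₗ T b (n+1)) (g := T b' (n+1) ∘ₗ mp g (n+1)) (fun v => ?_) c
    simp only [LinearMap.comp_apply]
    rw [mp_single, T_succ, T_succ, mp_cone, map_sub, ih, mp_d, mp_single, hg]

/-- chains whose tuples satisfy P -/
def Sat {n : ℕ} (P : (Fin n → K) → Prop) : Submodule ℂ (L K n) := Finsupp.supported ℂ ℂ {v | P v}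

lemma sat_single {n : ℕ} {P : (Fin n → K) → Prop} {v : Fin n → K} (h : P v) (c : ℂ) :
    Finsupp.single v c ∈ Sat P := by
  exact Finsupp.single_mem_supported ℂ c h

lemma sat_map {n m : ℕ} {P : (Fin n → K) → Prop} {Q : (Fin m → K) → Prop} (f : L K n →ₗ[ℂ] L K m)
    (h : ∀ v, P v → f (Finsupp.single v 1) ∈ Sat Q) {c : L K n} (hc : c ∈ Sat P) : f c ∈ Sat Q := by
  rw [Sat, Finsupp.supported_eq_span_single] at hc
  have : Submodule.span ℂ ((fun i => Finsupp.single i (1:ℂ)) '' {v | P v}) ≤ (Sat Q).comap f := by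
    rw [Submodule.span_le]
    rintro _ ⟨v, hv, rfl⟩
    exact h v hv
  exact this hc

/-- The mesh estimate: S produces tuples staying in each closed ball containing the given one,
and shrinks the diameter. -/
lemma S_mesh [PseudoMetricSpace K] (N : ℕ) (ρ : ℝ) (hρ : 0 ≤ ρ)
    (hb1 : ∀ n v p R, (∀ i, dist p (v i) ≤ R) → dist p (b n v) ≤ R)
    (hb2 : ∀ n v δ, n ≤ N → (∀ i j, dist (v i) (v j) ≤ δ) → ∀ i, dist (b n v) (v i) ≤ ρ * δ)
    (n : ℕ) (hn : n ≤ N + 1) (v : Fin n → K) (δ : ℝ) (hδ : 0 ≤ δ) (hv : ∀ i j, dist (v i) (v j) ≤ δ) :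
    S b n (Finsupp.single v 1) ∈ Sat (fun w => (∀ i j, dist (w i) (w j) ≤ ρ * δ) ∧
      ∀ p R, (∀ i, dist p (v i) ≤ R) → ∀ i, dist p (w i) ≤ R) := by
  induction n with
  | zero => exact sat_single ⟨fun i => i.elim0, fun p R _ i => i.elim0⟩ _
  | succ n ih =>
    rw [S_succ, d_single, map_sum]
    have key : ∑ i : Fin (n+1), S b n (((-1:ℂ)^(i:ℕ)) • Finsupp.single (v ∘ Fin.succAbove i) 1) ∈
      Sat (fun w : Fin n → K => (∀ i j, dist (w i) (w j) ≤ ρ * δ) ∧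
        ∀ p R, (∀ i, dist p (v i) ≤ R) → ∀ i, dist p (w i) ≤ R) := by
      refine Submodule.sum_mem _ fun i _ => ?_
      rw [map_smul]
      refine Submodule.smul_mem _ _ ?_
      refine Finsupp.supported_mono ?_ (ih (by omega) (v ∘ i.succAbove) (fun _ _ => hv _ _))
      rintro w ⟨h1, h2⟩
      exact ⟨h1, fun p R h => h2 p R fun j => h _⟩
    refine sat_map _ ?_ key
    rintro w ⟨h1, h2⟩
    rw [cone_single]
    have hbw : ∀ j, dist (b n v) (w j) ≤ ρ * δ := h2 _ _ (hb2 n v δ (by omega) hv)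
    refine sat_single ⟨?_, ?_⟩ _
    · intro i j
      refine Fin.cases ?_ (fun i => ?_) i <;> refine Fin.cases ?_ (fun j => ?_) j
      · simp; positivity
      · simpa using hbw j
      · simpa [dist_comm] using hbw i
      · simpa using h1 i j
    · intro p R h i
      refine Fin.cases ?_ (fun i => ?_) i
      · simpa using hb1 n v p R h
      · simpa using h2 p R h i

end Tup
end CubicHom

open MvPolynomial CategoryTheory
/-! ### Affine simplices and subdivision of singular chains -/

namespace CubicHom
open Tup

lemma affmem {n m : ℕ} (v : Fin (n+1) → Sim m) (t : Sim n) :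
    (∑ i, t.1 i • (v i).1) ∈ stdSimplex ℝ (Fin (m+1)) :=
  (convex_stdSimplex ℝ (Fin (m+1))).sum_mem (fun i _ => t.2.1 i) t.2.2 (fun i _ => (v i).2)

/-- affine simplex -/
noncomputable def aff {n m : ℕ} (v : Fin (n+1) → Sim m) : C(Sim n, Sim m) where
  toFun t := ⟨∑ i, t.1 i • (v i).1, affmem v t⟩
  continuous_toFun := by
    refine Continuous.subtype_mk (continuous_finsetSum _ fun i _ => ?_) _
    exact ((continuous_apply i).comp continuous_subtype_val).smul continuous_const

lemma aff_val {n m : ℕ} (v : Fin (n+1) → Sim m) (t : Sim n) : (aff v t).1 = ∑ i, t.1 i • (v i).1 := rfl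

/-- vertices -/
noncomputable def vtx (n : ℕ) : Fin (n+1) → Sim n := fun i => ⟨Pi.single i 1, single_mem_stdSimplex ℝ i⟩

lemma aff_vtx_id (n : ℕ) : aff (vtx n) = ContinuousMap.id _ := by
  ext t j
  change (aff (vtx n) t).1 j = t.1 j
  rw [aff_val]
  simp [vtx, Finset.sum_apply, Pi.single_apply]

lemma aff_vtx {n m : ℕ} (v : Fin (n+1) → Sim m) (i : Fin (n+1)) : aff v (vtx n i) = v i := by
  apply Subtype.ext
  rw [aff_val]
  simp [vtx, Pi.single_apply]

lemma aff_comp_vtx {n m : ℕ} (v : Fin (n+1) → Sim m) : aff v ∘ vtx n = v := funext (aff_vtx v)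

lemma aff_comp {n m k : ℕ} (v : Fin (n+1) → Sim m) (w : Fin (m+1) → Sim k) :
    (aff w).comp (aff v) = aff (aff w ∘ v) := by
  ext t j
  change (aff w (aff v t)).1 j = (aff (aff w ∘ v) t).1 j
  rw [aff_val, aff_val, aff_val]
  simp only [Finset.sum_apply, Pi.smul_apply, smul_eq_mul, Function.comp_apply, aff_val, Finset.sum_mul, Finset.mul_sum]
  rw [Finset.sum_comm]
  simp only [mul_assoc]

lemma face_eq {n : ℕ} (i : Fin (n+2)) : face i = aff (vtx (n+1) ∘ i.succAbove) := by
  ext t j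
  change (stdSimplex.map (Fin.succAbove i) t) j = (aff (vtx (n+1) ∘ i.succAbove) t).1 j
  rw [stdSimplex.map_coe, FunOnFinite.linearMap_apply_apply, aff_val]
  simp only [Finset.sum_apply, Pi.smul_apply, smul_eq_mul, Function.comp_apply, vtx, Pi.single_apply, mul_ite, mul_one, mul_zero]
  rw [Finset.sum_filter]
  simp only [eq_comm]
  rfl

lemma aff_face {n m : ℕ} (v : Fin (n+2) → Sim m) (i : Fin (n+2)) :
    (aff v).comp (face i) = aff (v ∘ i.succAbove) := by
  rw [face_eq, aff_comp]
  congr 1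
  funext j
  exact aff_vtx v _

/-- barycenter of the standard simplex -/
noncomputable def bc (n : ℕ) : Sim n := ⟨fun _ => 1 / ((n:ℝ)+1), by
  refine ⟨fun _ => by positivity, ?_⟩
  simp
  field_simp⟩

/-- barycenter of tuple -/
noncomputable def bar {m : ℕ} (n : ℕ) (v : Fin (n+1) → Sim m) : Sim m := aff v (bc n)

lemma bar_aff {m k : ℕ} (w : Fin (m+1) → Sim k) (n : ℕ) (v : Fin (n+1) → Sim m) :
    aff w (bar n v) = bar n (aff w ∘ v) := by
  have := congrArg (fun f => f (bc n)) (aff_comp v w)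
  exact this

lemma dist_aff_le {n m : ℕ} (v : Fin (n+1) → Sim m) (p : Sim m) (R : ℝ) (h : ∀ i, dist p (v i) ≤ R) (t : Sim n) :
    dist p (aff v t) ≤ R := by
  have : (aff v t).1 ∈ Metric.closedBall p.1 R := by
    rw [aff_val]
    refine (convex_closedBall p.1 R).sum_mem (fun i _ => t.2.1 i) t.2.2 (fun i _ => ?_)
    rw [Metric.mem_closedBall, dist_comm]
    exact h i
  rw [Metric.mem_closedBall, dist_comm] at this
  exact this

lemma dist_bar_le {m : ℕ} (n : ℕ) (v : Fin (n+1) → Sim m) (δ : ℝ) (h : ∀ i j, dist (v i) (v j) ≤ δ) (i : Fin (n+1)) :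
    dist (bar n v) (v i) ≤ ((n:ℝ) / (n+1)) * δ := by
  change dist (bar n v).1 (v i).1 ≤ _
  rw [bar, aff_val, dist_eq_norm]
  have : (∑ j, (bc n).1 j • (v j).1) - (v i).1 = ∑ j, (1 / ((n:ℝ)+1)) • ((v j).1 - (v i).1) := by
    simp only [smul_sub, Finset.sum_sub_distrib, bc]
    congr 1
    rw [Finset.sum_const, Finset.card_univ, Fintype.card_fin, ← Nat.cast_smul_eq_nsmul ℝ, smul_smul]
    push_cast
    rw [mul_one_div_cancel (by positivity), one_smul]
  rw [this, ← Finset.smul_sum, norm_smul]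
  rw [Real.norm_of_nonneg (by positivity), div_mul_eq_mul_div, one_mul, div_mul_eq_mul_div]
  gcongr
  refine (norm_sum_le _ _).trans ?_
  rw [← Finset.add_sum_erase _ _ (Finset.mem_univ i), sub_self, norm_zero, zero_add]
  refine (Finset.sum_le_card_nsmul _ _ δ (fun j _ => ?_)).trans ?_
  · rw [← dist_eq_norm]; exact h j i
  · simp

variable {X : Type} [TopologicalSpace X]

/-- realisation of tuples as singular chains -/
noncomputable def Phi {m : ℕ} (σ : C(Sim m, X)) (n : ℕ) : L (Sim m) (n+1) →ₗ[ℂ] Ch X n :=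
  Finsupp.lmapDomain ℂ ℂ (fun v => σ.comp (aff v))

lemma Phi_single {m : ℕ} (σ : C(Sim m, X)) (n : ℕ) (v : Fin (n+1) → Sim m) :
    Phi σ n (Finsupp.single v 1) = Finsupp.single (σ.comp (aff v)) 1 := by simp [Phi]

lemma bd_single (n : ℕ) (σ : C(Sim (n+1), X)) : bd X n (Finsupp.single σ 1) =
    ∑ i : Fin (n + 2), ((-1 : ℂ) ^ (i : ℕ)) • Finsupp.single (σ.comp (face i)) 1 := by
  simp [bd, LinearMap.sum_apply]

lemma bd_Phi {m : ℕ} (σ : C(Sim m, X)) (n : ℕ) (c : L (Sim m) (n+2)) :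
    bd X n (Phi σ (n+1) c) = Phi σ n (d (n+1) c) := by
  refine hom_ext (f := bd X n ∘ₗ Phi σ (n+1)) (g := Phi σ n ∘ₗ d (n+1)) (fun v => ?_) c
  simp only [LinearMap.comp_apply, Phi_single, d_single, bd_single, map_sum, map_smul]
  refine Finset.sum_congr rfl fun i _ => ?_
  rw [ContinuousMap.comp_assoc, aff_face]

lemma Phi_mp {m k : ℕ} (σ : C(Sim k, X)) (w : Fin (m+1) → Sim k) (n : ℕ) (c : L (Sim m) (n+1)) :
    Phi σ n (mp (aff w) (n+1) c) = Phi (σ.comp (aff w)) n c := by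
  refine hom_ext (f := Phi σ n ∘ₗ mp (aff w) (n+1)) (g := Phi (σ.comp (aff w)) n) (fun v => ?_) c
  simp only [LinearMap.comp_apply, Phi_single, mp_single]
  rw [ContinuousMap.comp_assoc, aff_comp]

/-- fundamental tuple -/
noncomputable abbrev fund (n : ℕ) : L (Sim n) (n+1) := Finsupp.single (vtx n) 1

/-- subdivision of singular chains -/
noncomputable def SdX (X : Type) [TopologicalSpace X] (n : ℕ) : Ch X n →ₗ[ℂ] Ch X n :=
  Finsupp.lift _ ℂ _ (fun σ => Phi σ n (S bar (n+1) (fund n)))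

/-- chain homotopy of singular chains -/
noncomputable def TX (X : Type) [TopologicalSpace X] (n : ℕ) : Ch X n →ₗ[ℂ] Ch X (n+1) :=
  Finsupp.lift _ ℂ _ (fun σ => Phi σ (n+1) (T bar (n+1) (fund n)))

lemma SdX_single (n : ℕ) (σ : C(Sim n, X)) : SdX X n (Finsupp.single σ 1) = Phi σ n (S bar (n+1) (fund n)) := by
  simp [SdX]

lemma TX_single (n : ℕ) (σ : C(Sim n, X)) : TX X n (Finsupp.single σ 1) = Phi σ (n+1) (T bar (n+1) (fund n)) := by
  simp [TX]

lemma mp_fund {n m : ℕ} (v : Fin (n+1) → Sim m) : mp (aff v) (n+1) (fund n) = Finsupp.single v 1 := by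
  rw [mp_single, aff_comp_vtx]

lemma Phi_S {m : ℕ} (σ : C(Sim m, X)) (n : ℕ) (c : L (Sim m) (n+1)) :
    Phi σ n (S bar (n+1) c) = SdX X n (Phi σ n c) := by
  refine hom_ext (f := Phi σ n ∘ₗ S bar (n+1)) (g := SdX X n ∘ₗ Phi σ n) (fun v => ?_) c
  simp only [LinearMap.comp_apply]
  rw [Phi_single, SdX_single, ← Phi_mp, mp_S (b := bar) (b' := bar) _ (bar_aff v), mp_fund]

lemma Phi_T {m : ℕ} (σ : C(Sim m, X)) (n : ℕ) (c : L (Sim m) (n+1)) :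
    Phi σ (n+1) (T bar (n+1) c) = TX X n (Phi σ n c) := by
  refine hom_ext (f := Phi σ (n+1) ∘ₗ T bar (n+1)) (g := TX X n ∘ₗ Phi σ n) (fun v => ?_) c
  simp only [LinearMap.comp_apply]
  rw [Phi_single, TX_single, ← Phi_mp, mp_T (b := bar) (b' := bar) _ (bar_aff v), mp_fund]

lemma Phi_fund (n : ℕ) (σ : C(Sim n, X)) : Phi σ n (fund n) = Finsupp.single σ 1 := by
  rw [Phi_single, aff_vtx_id, ContinuousMap.comp_id]

lemma ch_ext {M : Type*} [AddCommGroup M] [Module ℂ M] {n : ℕ} {f g : Ch X n →ₗ[ℂ] M}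
    (h : ∀ σ, f (Finsupp.single σ 1) = g (Finsupp.single σ 1)) (c : Ch X n) : f c = g c := by
  have : f = g := Finsupp.lhom_ext' fun v => LinearMap.ext_ring (h v)
  rw [this]

lemma bd_TX_zero (c : Ch X 0) : bd X 0 (TX X 0 c) = c - SdX X 0 c := by
  refine ch_ext (f := bd X 0 ∘ₗ TX X 0) (g := LinearMap.id - SdX X 0) (fun σ => ?_) c
  simp only [LinearMap.comp_apply, LinearMap.sub_apply, LinearMap.id_apply]
  rw [TX_single, bd_Phi, d_T, SdX_single, ← Phi_fund]
  simp [T]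

lemma bd_TX_succ (n : ℕ) (c : Ch X (n+1)) :
    bd X (n+1) (TX X (n+1) c) = c - SdX X (n+1) c - TX X n (bd X n c) := by
  refine ch_ext (f := bd X (n+1) ∘ₗ TX X (n+1)) (g := LinearMap.id - SdX X (n+1) - TX X n ∘ₗ bd X n) (fun σ => ?_) c
  simp only [LinearMap.comp_apply, LinearMap.sub_apply, LinearMap.id_apply]
  rw [TX_single, bd_Phi, d_T, SdX_single, ← Phi_fund, map_sub, map_sub, Phi_T, bd_Phi]

/-- chains supported in a set of simplices -/
def Sup (n : ℕ) (P : Set (C(Sim n, X))) : Submodule ℂ (Ch X n) := Finsupp.supported ℂ ℂ P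

lemma sup_map {n : ℕ} {P : Set C(Sim n, X)} {M : Type*} [AddCommGroup M] [Module ℂ M] {N : Submodule ℂ M} (f : Ch X n →ₗ[ℂ] M)
    (h : ∀ v ∈ P, f (Finsupp.single v 1) ∈ N) {c : Ch X n} (hc : c ∈ Sup n P) : f c ∈ N := by
  rw [Sup, Finsupp.supported_eq_span_single] at hc
  have : Submodule.span ℂ ((fun i => Finsupp.single i (1:ℂ)) '' P) ≤ N.comap f := by
    rw [Submodule.span_le]
    rintro _ ⟨v, hv, rfl⟩
    exact h v hv
  exact this hc

/-- small simplices -/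
def Sm (U V : Set X) (n : ℕ) : Set C(Sim n, X) := {σ | (∀ t, σ t ∈ U) ∨ (∀ t, σ t ∈ V)}

lemma Phi_mem_small (U V : Set X) {m : ℕ} (n : ℕ) (σ : C(Sim m, X)) (h : σ ∈ Sm U V m) (c : L (Sim m) (n+1)) :
    Phi σ n c ∈ Sup n (Sm U V n) := by
  have hc : c ∈ Sat (fun _ : Fin (n+1) → Sim m => True) := by
    rw [Sat, Set.ofPred_true, Finsupp.supported_univ]; trivial
  rw [Sat, Finsupp.supported_eq_span_single] at hc
  have : Submodule.span ℂ ((fun i => Finsupp.single i (1:ℂ)) '' {v : Fin (n+1) → Sim m | True}) ≤ (Sup n (Sm U V n)).comap (Phi σ n) := by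
    rw [Submodule.span_le]
    rintro _ ⟨v, hv, rfl⟩
    change Phi σ n (Finsupp.single v 1) ∈ Sup n (Sm U V n)
    rw [Phi_single]
    refine Finsupp.single_mem_supported ℂ _ ?_
    rcases h with h | h
    · left; intro t; exact h _
    · right; intro t; exact h _
  exact this hc

lemma TX_small (U V : Set X) (n : ℕ) {c : Ch X n} (hc : c ∈ Sup n (Sm U V n)) :
    TX X n c ∈ Sup (n+1) (Sm U V (n+1)) :=
  sup_map _ (fun σ hσ => by rw [TX_single]; exact Phi_mem_small U V _ σ hσ _) hc

lemma bd_small (U V : Set X) (n : ℕ) {c : Ch X (n+1)} (hc : c ∈ Sup (n+1) (Sm U V (n+1))) :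
    bd X n c ∈ Sup n (Sm U V n) :=
  sup_map _ (fun σ hσ => by rw [← Phi_fund, bd_Phi]; exact Phi_mem_small U V _ σ hσ _) hc

lemma SdX_small (U V : Set X) (n : ℕ) {c : Ch X n} (hc : c ∈ Sup n (Sm U V n)) :
    SdX X n c ∈ Sup n (Sm U V n) :=
  sup_map _ (fun σ hσ => by rw [SdX_single]; exact Phi_mem_small U V _ σ hσ _) hc

lemma Phi_S_iter {m : ℕ} (σ : C(Sim m, X)) (n k : ℕ) (c : L (Sim m) (n+1)) :
    Phi σ n ((S bar (n+1) ^ k) c) = (SdX X n ^ k) (Phi σ n c) := by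
  induction k with
  | zero => simp
  | succ k ih => rw [pow_succ', pow_succ', Module.End.mul_apply, Module.End.mul_apply, Phi_S, ih]

lemma S_iter_mesh (n k : ℕ) : (S bar (n+1) ^ k) (fund n) ∈
    Sat (fun w : Fin (n+1) → Sim n => ∀ i j, dist (w i) (w j) ≤ ((n:ℝ)/(n+1))^k * 1) := by
  induction k with
  | zero =>
    refine sat_single ?_ _
    intro i j
    simp only [pow_zero, one_mul]
    change dist (vtx n i).1 (vtx n j).1 ≤ 1
    rw [dist_pi_le_iff (by norm_num)]
    intro l
    simp only [vtx, Pi.single_apply]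
    split_ifs <;> simp
  | succ k ih =>
    rw [pow_succ' (S bar (n+1)), Module.End.mul_apply]
    refine sat_map _ ?_ ih
    intro v hv
    refine Finsupp.supported_mono ?_ (S_mesh (b := bar) n ((n:ℝ)/(n+1)) (by positivity)
      (fun n v p R h => dist_aff_le v p R h _) ?_ (n+1) le_rfl v _ (by positivity) hv)
    · rintro w ⟨h1, h2⟩ i j
      refine (h1 i j).trans (le_of_eq ?_)
      ring
    · intro l v δ hl h i
      have hδ : 0 ≤ δ := dist_nonneg.trans (h 0 0)
      refine (dist_bar_le l v δ h i).trans ?_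
      gcongr ?_ * _
      rw [div_le_div_iff₀ (by positivity) (by positivity)]
      have : (l:ℝ) ≤ n := by exact_mod_cast hl
      nlinarith

lemma SdX_iter_small_single (U V : Set X) (hU : IsOpen U) (hV : IsOpen V) (hUV : U ∪ V = Set.univ) (n : ℕ) (σ : C(Sim n, X)) :
    ∃ k₀, ∀ k ≥ k₀, (SdX X n ^ k) (Finsupp.single σ 1) ∈ Sup n (Sm U V n) := by
  obtain ⟨ε, hε, hL⟩ := lebesgue_number_lemma_of_metric (s := (Set.univ : Set (Sim n))) (c := fun b : Bool => σ ⁻¹' (if b then U else V))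
    isCompact_univ (by
      intro b
      refine IsOpen.preimage σ.continuous ?_
      split_ifs <;> assumption) (by
      intro x _
      have : σ x ∈ U ∪ V := by rw [hUV]; trivial
      rcases this with h | h
      · exact Set.mem_iUnion.2 ⟨true, h⟩
      · exact Set.mem_iUnion.2 ⟨false, h⟩)
  obtain ⟨k₀, hk₀⟩ := exists_pow_lt_of_lt_one hε (show ((n:ℝ)/(n+1)) < 1 by
    rw [div_lt_one (by positivity)]; linarith)
  refine ⟨k₀, fun k hk => ?_⟩
  rw [← Phi_fund, ← Phi_S_iter]
  have h1 := S_iter_mesh n k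
  rw [Sat, Finsupp.supported_eq_span_single] at h1
  refine (show _ ≤ (Sup n (Sm U V n)).comap (Phi σ n) from ?_) h1
  rw [Submodule.span_le]
  rintro _ ⟨v, hv, rfl⟩
  change Phi σ n (Finsupp.single v 1) ∈ Sup n (Sm U V n)
  rw [Phi_single]
  refine Finsupp.single_mem_supported ℂ _ ?_
  obtain ⟨b, hb⟩ := hL (v 0) trivial
  have hin : ∀ t, aff v t ∈ Metric.ball (v 0) ε := by
    intro t
    rw [Metric.mem_ball, dist_comm]
    refine lt_of_le_of_lt (dist_aff_le v (v 0) _ (fun i => hv 0 i) t) ?_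
    rw [mul_one]
    refine lt_of_le_of_lt (pow_le_pow_of_le_one (by positivity) ?_ hk) hk₀
    rw [div_le_one (by positivity)]; linarith
  cases b
  · right; intro t; simpa using hb (hin t)
  · left; intro t; simpa using hb (hin t)

lemma SdX_iter_small (U V : Set X) (hU : IsOpen U) (hV : IsOpen V) (hUV : U ∪ V = Set.univ) (n : ℕ) (c : Ch X n) :
    ∃ k₀, ∀ k ≥ k₀, (SdX X n ^ k) c ∈ Sup n (Sm U V n) := by
  induction c using Finsupp.induction_linear with
  | zero => exact ⟨0, fun k _ => by rw [map_zero]; exact Submodule.zero_mem _⟩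
  | add f g hf hg =>
    obtain ⟨k1, h1⟩ := hf
    obtain ⟨k2, h2⟩ := hg
    refine ⟨max k1 k2, fun k hk => ?_⟩
    rw [map_add]
    exact Submodule.add_mem _ (h1 k (by omega)) (h2 k (by omega))
  | single σ a =>
    obtain ⟨k1, h1⟩ := SdX_iter_small_single U V hU hV hUV n σ
    refine ⟨k1, fun k hk => ?_⟩
    have : (Finsupp.single σ a : Ch X n) = a • Finsupp.single σ 1 := by simp
    rw [this, map_smul]
    exact Submodule.smul_mem _ _ (h1 k hk)

lemma bd_bd (n : ℕ) (c : Ch X (n+2)) : bd X n (bd X (n+1) c) = 0 := by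
  refine ch_ext (f := bd X n ∘ₗ bd X (n+1)) (g := 0) (fun σ => ?_) c
  simp only [LinearMap.comp_apply]
  rw [← Phi_fund, bd_Phi, bd_Phi, d_d]
  simp

lemma small_zero (U V : Set X) (hUV : U ∪ V = Set.univ) (c : Ch X 0) : c ∈ Sup 0 (Sm U V 0) := by
  intro σ _
  have : σ (vtx 0 0) ∈ U ∪ V := by rw [hUV]; trivial
  rcases this with h | h
  · left; intro t; rw [Subsingleton.elim t (vtx 0 0)]; exact h
  · right; intro t; rw [Subsingleton.elim t (vtx 0 0)]; exact h

/-- Every chain with small boundary is homologous to a small one. -/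
lemma exists_small_succ (U V : Set X) (hU : IsOpen U) (hV : IsOpen V) (hUV : U ∪ V = Set.univ) (n : ℕ)
    (c : Ch X (n+1)) (hc : bd X n c ∈ Sup n (Sm U V n)) :
    ∃ t : Ch X (n+2), c - bd X (n+1) t ∈ Sup (n+1) (Sm U V (n+1)) := by
  obtain ⟨k, hk⟩ := SdX_iter_small U V hU hV hUV (n+1) c
  replace hk := hk k le_rfl
  induction k generalizing c with
  | zero => exact ⟨0, by simpa using hk⟩
  | succ k ih =>
    have e := bd_TX_succ n c
    have hT : TX X n (bd X n c) ∈ Sup (n+1) (Sm U V (n+1)) := TX_small U V n hc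
    obtain ⟨t, ht⟩ := ih (SdX X (n+1) c) (by
      have e2 : SdX X (n+1) c = c - bd X (n+1) (TX X (n+1) c) - TX X n (bd X n c) := by
        rw [e]; abel
      rw [e2, map_sub, map_sub, bd_bd, sub_zero]
      exact Submodule.sub_mem _ hc (bd_small U V n hT)) (by
      rw [pow_succ, Module.End.mul_apply] at hk; exact hk)
    refine ⟨t + TX X (n+1) c, ?_⟩
    rw [map_add, e]
    have := Submodule.add_mem _ ht hT
    convert this using 1
    abel

end CubicHom

open MvPolynomial CategoryTheory
/-! ### Mayer-Vietoris for open covers -/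

namespace CubicHom
open Topology

variable {D A B X : Type} [TopologicalSpace D] [TopologicalSpace A] [TopologicalSpace B] [TopologicalSpace X]

/-- An open cover by two pieces with a model of the intersection. -/
structure OpenCover (i : C(D, A)) (j : C(D, B)) (k : C(A, X)) (l : C(B, X)) : Prop where
  hk : IsOpenEmbedding k
  hl : IsOpenEmbedding l
  hi : IsEmbedding i
  comm : ∀ x, k (i x) = l (j x)
  cover : ∀ x, (∃ a, k a = x) ∨ (∃ b, l b = x)
  inter : ∀ a b, k a = l b → ∃ x, i x = a

lemma exists_lift {f : C(A, X)} (hf : IsEmbedding f) {n : ℕ} (σ : C(Sim n, X)) (h : ∀ t, ∃ a, f a = σ t) :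
    ∃ τ : C(Sim n, A), f.comp τ = σ := by
  choose g hg using h
  have hc : Continuous g := by
    rw [hf.continuous_iff]
    convert σ.continuous using 1
    funext t
    exact hg t
  exact ⟨⟨g, hc⟩, by ext t; exact hg t⟩

/-- pushforward of chains -/
noncomputable abbrev push (f : C(A, X)) (n : ℕ) : Ch A n →ₗ[ℂ] Ch X n :=
  Finsupp.lmapDomain ℂ ℂ (fun σ => f.comp σ)

lemma push_inj {f : C(A, X)} (hf : Function.Injective f) (n : ℕ) : Function.Injective (push f n) := by
  apply Finsupp.mapDomain_injective
  intro σ τ h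
  ext t
  exact hf (congrArg (fun g : C(Sim n, X) => g t) h)

lemma mem_range_push {f : C(A, X)} (n : ℕ) (c : Ch X n) (h : ∀ σ ∈ c.support, ∃ τ, f.comp τ = σ) :
    ∃ c', push f n c' = c := by
  have hc : c ∈ Finsupp.supported ℂ ℂ {σ | ∃ τ : C(Sim n, A), f.comp τ = σ} := fun σ hσ => h σ hσ
  rw [Finsupp.supported_eq_span_single] at hc
  refine (show _ ≤ LinearMap.range (push f n) from ?_) hc
  rw [Submodule.span_le]
  rintro _ ⟨_, ⟨τ, rfl⟩, rfl⟩
  exact ⟨Finsupp.single τ 1, by simp [push]⟩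

namespace OpenCover
variable {i : C(D, A)} {j : C(D, B)} {k : C(A, X)} {l : C(B, X)}

lemma small_decomp (h : OpenCover i j k l) (n : ℕ) (c : Ch X n) :
    c ∈ Sup n (Sm (Set.range k) (Set.range l) n) ↔ ∃ u v, c = push k n u - push l n v := by
  constructor
  · intro hc
    have hc' : c ∈ Finsupp.supported ℂ ℂ (Sm (Set.range k) (Set.range l) n) := hc
    rw [Finsupp.supported_eq_span_single] at hc'
    have : c ∈ LinearMap.range (push k n) ⊔ LinearMap.range (push l n) := by
      refine (show _ ≤ LinearMap.range (push k n) ⊔ LinearMap.range (push l n) from ?_) hc'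
      rw [Submodule.span_le]
      rintro _ ⟨σ, hσ, rfl⟩
      rcases hσ with hσ | hσ
      · obtain ⟨τ, rfl⟩ := exists_lift h.hk.isEmbedding σ hσ
        exact Submodule.mem_sup_left ⟨Finsupp.single τ 1, by simp [push]⟩
      · obtain ⟨τ, rfl⟩ := exists_lift h.hl.isEmbedding σ hσ
        exact Submodule.mem_sup_right ⟨Finsupp.single τ 1, by simp [push]⟩
    rw [Submodule.mem_sup] at this
    obtain ⟨_, ⟨u, rfl⟩, _, ⟨v, rfl⟩, rfl⟩ := this
    exact ⟨u, -v, by rw [map_neg, sub_neg_eq_add]⟩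
  · rintro ⟨u, v, rfl⟩
    refine Submodule.sub_mem _ ?_ ?_
    · refine sup_map (P := Set.univ) (push k n) (fun σ _ => ?_) (by rw [Sup, Finsupp.supported_univ]; trivial)
      rw [Finsupp.lmapDomain_apply, Finsupp.mapDomain_single]
      exact Finsupp.single_mem_supported ℂ _ (Or.inl fun t => ⟨_, rfl⟩)
    · refine sup_map (P := Set.univ) (push l n) (fun σ _ => ?_) (by rw [Sup, Finsupp.supported_univ]; trivial)
      rw [Finsupp.lmapDomain_apply, Finsupp.mapDomain_single]
      exact Finsupp.single_mem_supported ℂ _ (Or.inr fun t => ⟨_, rfl⟩)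

lemma mvData (h : OpenCover i j k l) : MVData (SC.map (TopCat.ofHom i)) (SC.map (TopCat.ofHom j))
    (SC.map (TopCat.ofHom k)) (SC.map (TopCat.ofHom l)) where
  comm n x := by
    obtain ⟨x, rfl⟩ := (ce D n).surjective x
    rw [ce_map, ce_map, ce_map, ce_map]
    congr 1
    have hkl : k.comp i = l.comp j := by ext x; exact h.comm x
    refine ch_ext (f := push k n ∘ₗ push i n) (g := push l n ∘ₗ push j n) (fun σ => ?_) x
    simp [push, ← ContinuousMap.comp_assoc, hkl]
  inj n := by
    intro x y hxy
    obtain ⟨x, rfl⟩ := (ce D n).surjective x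
    obtain ⟨y, rfl⟩ := (ce D n).surjective y
    rw [ce_map, ce_map] at hxy
    rw [push_inj h.hi.injective n ((ce A n).injective hxy)]
  inter n u v huv := by
    obtain ⟨u, rfl⟩ := (ce A n).surjective u
    obtain ⟨v, rfl⟩ := (ce B n).surjective v
    rw [ce_map, ce_map] at huv
    replace huv : push k n u = push l n v := (ce X n).injective huv
    obtain ⟨z, rfl⟩ := mem_range_push (f := i) n u (by
      intro σ hσ
      have hinj : Function.Injective (fun σ : C(Sim n, A) => k.comp σ) := by
        intro σ τ h'
        ext t
        exact h.hk.injective (congrArg (fun g : C(Sim n, X) => g t) h')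
      have h1 : k.comp σ ∈ (push k n u).support := by
        rw [Finsupp.mem_support_iff, Finsupp.lmapDomain_apply]
        rw [Finsupp.mapDomain_apply hinj]
        exact Finsupp.mem_support_iff.1 hσ
      rw [huv] at h1
      classical
      have h2 := Finsupp.mapDomain_support h1
      rw [Finset.mem_image] at h2
      obtain ⟨τ, _, hτ⟩ := h2
      exact exists_lift h.hi σ (fun t => h.inter (σ t) (τ t)
        (congrArg (fun g : C(Sim n, X) => g t) hτ.symm)))
    refine ⟨ce D n z, ce_map _ _ _, ?_⟩
    rw [ce_map]
    congr 1
    apply push_inj h.hl.injective n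
    rw [← huv]
    have hkl : k.comp i = l.comp j := by ext x; exact h.comm x
    refine (ch_ext (f := push k n ∘ₗ push i n) (g := push l n ∘ₗ push j n) (fun σ => ?_) z).symm
    simp [push, ← ContinuousMap.comp_assoc, hkl]
  small n c hc := by
    obtain ⟨c, rfl⟩ := (ce X n).surjective c
    have hUV : Set.range k ∪ Set.range l = Set.univ := by
      ext x; simpa using h.cover x
    obtain ⟨t, ht⟩ : ∃ t : Ch X (n+1), c - bd X n t ∈ Sup n (Sm (Set.range k) (Set.range l) n) := by
      cases n with
      | zero => exact ⟨0, small_zero _ _ hUV _⟩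
      | succ n =>
        apply exists_small_succ _ _ h.hk.isOpen_range h.hl.isOpen_range hUV
        obtain ⟨u, v, huv⟩ := hc n
        obtain ⟨u, rfl⟩ := (ce A n).surjective u
        obtain ⟨v, rfl⟩ := (ce B n).surjective v
        rw [ce_d, ce_map, ce_map, ← map_sub] at huv
        exact (h.small_decomp n _).2 ⟨u, v, (ce X n).injective huv⟩
    obtain ⟨u, v, huv⟩ := (h.small_decomp n _).1 ht
    refine ⟨ce X (n+1) t, ce A n u, ce B n v, ?_⟩
    rw [ce_d, ce_map, ce_map, ← map_sub, ← map_sub, huv]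

lemma mv_mid (h : OpenCover i j k l) (n : ℕ) :
    Function.Exact ((hm i n).prod (hm j n)) ((hm k n).coprod (-(hm l n))) := h.mvData.exact_mid n

lemma mv_surj (h : OpenCover i j k l) : Function.Surjective ((hm k 0).coprod (-(hm l 0))) := h.mvData.surj_zero

lemma mv_delta (h : OpenCover i j k l) (n : ℕ) : ∃ δ : HH X (n+1) →ₗ[ℂ] HH D n,
    Function.Exact ((hm k (n+1)).coprod (-(hm l (n+1)))) δ ∧ Function.Exact δ ((hm i n).prod (hm j n)) :=
  h.mvData.exists_delta n

end OpenCover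
end CubicHom

open MvPolynomial CategoryTheory
/-! ### Betti numbers -/

namespace CubicHom
open Topology Module

/-- Betti numbers `h0 h1 h2`, all higher ones vanish -/
structure Betti (X : Type) [TopologicalSpace X] (h0 h1 h2 : ℕ) : Prop where
  fin : ∀ n, Module.Finite ℂ (HH X n)
  b0 : finrank ℂ (HH X 0) = h0
  b1 : finrank ℂ (HH X 1) = h1
  b2 : finrank ℂ (HH X 2) = h2
  b3 : ∀ n, 3 ≤ n → finrank ℂ (HH X n) = 0

variable {D A B X Y : Type} [TopologicalSpace D] [TopologicalSpace A] [TopologicalSpace B] [TopologicalSpace X] [TopologicalSpace Y]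

lemma Betti.of_equiv {h0 h1 h2 : ℕ} (h : Betti X h0 h1 h2) (e : ∀ n, HH X n ≃ₗ[ℂ] HH Y n) : Betti Y h0 h1 h2 where
  fin n := by have := h.fin n; exact Module.Finite.equiv (e n)
  b0 := (e 0).finrank_eq.symm.trans h.b0
  b1 := (e 1).finrank_eq.symm.trans h.b1
  b2 := (e 2).finrank_eq.symm.trans h.b2
  b3 n hn := (e n).finrank_eq.symm.trans (h.b3 n hn)

lemma Betti.of_hequiv {h0 h1 h2 : ℕ} (h : Betti X h0 h1 h2) (e : ContinuousMap.HomotopyEquiv X Y) : Betti Y h0 h1 h2 :=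
  h.of_equiv (fun n => hequiv e.toFun e.invFun e.left_inv e.right_inv n)

lemma Betti.of_homeo {h0 h1 h2 : ℕ} (h : Betti X h0 h1 h2) (e : X ≃ₜ Y) : Betti Y h0 h1 h2 :=
  h.of_hequiv e.toHomotopyEquiv

lemma betti_unit : Betti Unit 1 0 0 where
  fin n := by
    rcases Nat.eq_zero_or_pos n with rfl | hn
    · exact Module.Finite.equiv (hhZero (X := Unit)).symm
    · have := hh_isZero (X := Unit) n (by omega)
      infer_instance
  b0 := by rw [(hhZero (X := Unit)).finrank_eq]; simp
  b1 := by have := hh_isZero (X := Unit) 1 (by omega); exact finrank_zero_of_subsingleton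
  b2 := by have := hh_isZero (X := Unit) 2 (by omega); exact finrank_zero_of_subsingleton
  b3 n hn := by have := hh_isZero (X := Unit) n (by omega); exact finrank_zero_of_subsingleton

lemma betti_empty [IsEmpty X] : Betti X 0 0 0 where
  fin n := by
    rcases Nat.eq_zero_or_pos n with rfl | hn
    · exact Module.Finite.equiv (hhZero (X := X)).symm
    · have := hh_isZero (X := X) n (by omega)
      infer_instance
  b0 := by rw [(hhZero (X := X)).finrank_eq]; exact finrank_zero_of_subsingleton
  b1 := by have := hh_isZero (X := X) 1 (by omega); exact finrank_zero_of_subsingleton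
  b2 := by have := hh_isZero (X := X) 2 (by omega); exact finrank_zero_of_subsingleton
  b3 n hn := by have := hh_isZero (X := X) n (by omega); exact finrank_zero_of_subsingleton

lemma betti_contractible [ContractibleSpace X] : Betti X 1 0 0 := by
  obtain ⟨e⟩ := ContractibleSpace.hequiv_unit X
  exact betti_unit.of_hequiv e.symm

lemma hm_zero_ne_zero [Nonempty D] (i : C(D, A)) : hm i 0 ≠ 0 := by
  intro h
  obtain ⟨x⟩ := ‹Nonempty D›
  let p : C(Unit, D) := ContinuousMap.const _ x
  let q : C(A, Unit) := ContinuousMap.const _ ()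
  have h1 : q.comp (i.comp p) = ContinuousMap.id Unit := by ext
  have h2 : hm (q.comp (i.comp p)) 0 = 0 := by
    rw [hm_comp, hm_comp, h, LinearMap.zero_comp, LinearMap.comp_zero]
  rw [h1, hm_id] at h2
  have h3 := betti_unit.b0
  have : Subsingleton (HH Unit 0) := ⟨fun a b => by
    have ha : LinearMap.id (R := ℂ) a = 0 := by rw [h2]; rfl
    have hb : LinearMap.id (R := ℂ) b = 0 := by rw [h2]; rfl
    exact ha.trans hb.symm⟩
  rw [finrank_zero_of_subsingleton] at h3
  omega

lemma one_le_h0 [Nonempty X] [Module.Finite ℂ (HH X 0)] : 1 ≤ finrank ℂ (HH X 0) := by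
  by_contra hcon
  have h0 : finrank ℂ (HH X 0) = 0 := by omega
  have : Subsingleton (HH X 0) := finrank_zero_iff.1 h0
  apply hm_zero_ne_zero (ContinuousMap.id X)
  ext x
  exact Subsingleton.elim _ _

/-- rank of the first MV map -/
noncomputable def rk (i : C(D, A)) (j : C(D, B)) (n : ℕ) : ℕ :=
  finrank ℂ (LinearMap.range ((hm i n).prod (hm j n)))

lemma rk_pos [Nonempty D] (i : C(D, A)) (j : C(D, B)) [Module.Finite ℂ (HH D 0)] : 1 ≤ rk i j 0 := by
  by_contra hcon
  have h0 : finrank ℂ (LinearMap.range ((hm i 0).prod (hm j 0))) = 0 := by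
    unfold rk at hcon; omega
  rw [Submodule.finrank_eq_zero, LinearMap.range_eq_bot] at h0
  apply hm_zero_ne_zero i
  ext x
  have := congrArg (fun f => (f x).1) h0
  simpa using this

lemma rk_le_left (i : C(D, A)) (j : C(D, B)) (n : ℕ) [Module.Finite ℂ (HH D n)] : rk i j n ≤ finrank ℂ (HH D n) :=
  LinearMap.finrank_range_le _

lemma rk_le_right (i : C(D, A)) (j : C(D, B)) (n : ℕ) [Module.Finite ℂ (HH A n)] [Module.Finite ℂ (HH B n)] :
    rk i j n ≤ finrank ℂ (HH A n) + finrank ℂ (HH B n) := by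
  unfold rk
  exact (Submodule.finrank_le _).trans (le_of_eq (finrank_prod))

namespace OpenCover
variable {i : C(D, A)} {j : C(D, B)} {k : C(A, X)} {l : C(B, X)}

lemma zero_rank (h : OpenCover i j k l) [Module.Finite ℂ (HH A 0)] [Module.Finite ℂ (HH B 0)] :
    Module.Finite ℂ (HH X 0) ∧ finrank ℂ (HH X 0) + rk i j 0 = finrank ℂ (HH A 0) + finrank ℂ (HH B 0) := by
  refine ⟨Module.Finite.of_surjective _ h.mv_surj, ?_⟩
  have h1 := LinearMap.finrank_range_add_finrank_ker ((hm k 0).coprod (-(hm l 0)))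
  rw [LinearMap.range_eq_top.2 h.mv_surj, finrank_top, (LinearMap.exact_iff.1 (h.mv_mid 0)), finrank_prod] at h1
  exact h1

lemma succ_rank (h : OpenCover i j k l) (n : ℕ) [Module.Finite ℂ (HH A (n+1))] [Module.Finite ℂ (HH B (n+1))]
    [Module.Finite ℂ (HH D n)] :
    Module.Finite ℂ (HH X (n+1)) ∧ finrank ℂ (HH X (n+1)) + rk i j (n+1) + rk i j n =
      finrank ℂ (HH A (n+1)) + finrank ℂ (HH B (n+1)) + finrank ℂ (HH D n) := by
  obtain ⟨δ, hδ1, hδ2⟩ := h.mv_delta n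
  have hker := LinearMap.exact_iff.1 hδ1
  have hker2 := LinearMap.exact_iff.1 hδ2
  have f1 : Module.Finite ℂ (LinearMap.ker δ) := by rw [hker]; infer_instance
  have hfin : Module.Finite ℂ (HH X (n+1)) := by
    have f2 : Module.Finite ℂ (LinearMap.range δ) := inferInstance
    have f3 : Module.Finite ℂ (HH X (n+1) ⧸ LinearMap.ker δ) := Module.Finite.equiv δ.quotKerEquivRange.symm
    exact Module.Finite.of_submodule_quotient (LinearMap.ker δ)
  refine ⟨hfin, ?_⟩
  have h1 := LinearMap.finrank_range_add_finrank_ker ((hm k (n+1)).coprod (-(hm l (n+1))))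
  have h2 := LinearMap.finrank_range_add_finrank_ker δ
  have h3 := LinearMap.finrank_range_add_finrank_ker ((hm i n).prod (hm j n))
  rw [LinearMap.exact_iff.1 (h.mv_mid (n+1)), finrank_prod] at h1
  rw [hker] at h2
  rw [hker2] at h3
  unfold rk
  omega

lemma glue (h : OpenCover i j k l) {b b' : ℕ} (hD : Betti D 1 1 0) (hA : Betti A 1 0 b) (hB : Betti B 1 0 b') :
    Betti X 1 0 (b + b' + 1) := by
  have := hD.fin; have := hA.fin; have := hB.fin
  have : Nonempty D := by
    by_contra hne
    rw [not_nonempty_iff] at hne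
    have := (betti_empty (X := D)).b0
    rw [hD.b0] at this; omega
  have r0 := rk_pos i j
  have r0' := rk_le_left i j 0
  have r1 := rk_le_right i j 1
  have r2 := rk_le_left i j 2
  have z := h.zero_rank.2
  have s1 : finrank ℂ (HH X 1) + rk i j 1 + rk i j 0 =
    finrank ℂ (HH A 1) + finrank ℂ (HH B 1) + finrank ℂ (HH D 0) := (h.succ_rank 0).2
  have s2 : finrank ℂ (HH X 2) + rk i j 2 + rk i j 1 =
    finrank ℂ (HH A 2) + finrank ℂ (HH B 2) + finrank ℂ (HH D 1) := (h.succ_rank 1).2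
  rw [hA.b0, hB.b0] at z
  rw [hD.b0] at r0'
  rw [hA.b1, hB.b1] at r1
  rw [hD.b2] at r2
  rw [hA.b1, hB.b1, hD.b0] at s1
  rw [hA.b2, hB.b2, hD.b1] at s2
  refine ⟨fun n => ?_, by omega, by omega, by omega, fun n hn => ?_⟩
  · cases n with
    | zero => exact h.zero_rank.1
    | succ n => exact (h.succ_rank n).1
  · obtain ⟨n, rfl⟩ : ∃ m, n = m + 1 := ⟨n - 1, by omega⟩
    have s := (h.succ_rank n).2
    rw [hA.b3 _ hn, hB.b3 _ hn] at s
    have : finrank ℂ (HH D n) = 0 := by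
      rcases Nat.lt_or_ge n 3 with h' | h'
      · obtain rfl : n = 2 := by omega
        exact hD.b2
      · exact hD.b3 n h'
    omega

/-- disjoint unions -/
lemma disj (h : OpenCover i j k l) [IsEmpty D] {a0 a1 a2 b0 b1 b2 : ℕ} (hA : Betti A a0 a1 a2) (hB : Betti B b0 b1 b2) :
    Betti X (a0 + b0) (a1 + b1) (a2 + b2) := by
  have hD := betti_empty (X := D)
  have := hD.fin; have := hA.fin; have := hB.fin
  have hd : ∀ n, finrank ℂ (HH D n) = 0 := by
    intro n
    rcases Nat.lt_or_ge n 3 with h' | h'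
    · interval_cases n
      exacts [hD.b0, hD.b1, hD.b2]
    · exact hD.b3 n h'
  have hr : ∀ n, rk i j n = 0 := fun n => by
    have := rk_le_left i j n
    rw [hd] at this; omega
  have hs : ∀ n, finrank ℂ (HH X n) = finrank ℂ (HH A n) + finrank ℂ (HH B n) := by
    intro n
    cases n with
    | zero => have := h.zero_rank.2; rw [hr] at this; omega
    | succ n => have := (h.succ_rank n).2; rw [hr, hr, hd] at this; omega
  refine ⟨fun n => ?_, by rw [hs, hA.b0, hB.b0], by rw [hs, hA.b1, hB.b1], by rw [hs, hA.b2, hB.b2], fun n hn => by rw [hs, hA.b3 n hn, hB.b3 n hn]⟩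
  cases n with
  | zero => exact h.zero_rank.1
  | succ n => exact (h.succ_rank n).1

/-- circle-like gluing -/
lemma circ (h : OpenCover i j k l) (hD : Betti D 2 0 0) (hA : Betti A 1 0 0) (hB : Betti B 1 0 0) :
    Betti X 1 1 0 := by
  have := hD.fin; have := hA.fin; have := hB.fin
  have : Nonempty D := by
    by_contra hne
    rw [not_nonempty_iff] at hne
    have := (betti_empty (X := D)).b0
    rw [hD.b0] at this; omega
  obtain ⟨d⟩ := this
  have : Nonempty D := ⟨d⟩
  have : Nonempty X := ⟨k (i d)⟩
  have := h.zero_rank.1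
  have x0 := one_le_h0 (X := X)
  have r0 := rk_pos i j
  have r1 := rk_le_right i j 1
  have r2 := rk_le_left i j 2
  have z := h.zero_rank.2
  have s1 : finrank ℂ (HH X 1) + rk i j 1 + rk i j 0 =
    finrank ℂ (HH A 1) + finrank ℂ (HH B 1) + finrank ℂ (HH D 0) := (h.succ_rank 0).2
  have s2 : finrank ℂ (HH X 2) + rk i j 2 + rk i j 1 =
    finrank ℂ (HH A 2) + finrank ℂ (HH B 2) + finrank ℂ (HH D 1) := (h.succ_rank 1).2
  rw [hA.b0, hB.b0] at z
  rw [hA.b1, hB.b1] at r1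
  rw [hD.b2] at r2
  rw [hA.b1, hB.b1, hD.b0] at s1
  rw [hA.b2, hB.b2, hD.b1] at s2
  refine ⟨fun n => ?_, by omega, by omega, by omega, fun n hn => ?_⟩
  · cases n with
    | zero => exact h.zero_rank.1
    | succ n => exact (h.succ_rank n).1
  · obtain ⟨n, rfl⟩ : ∃ m, n = m + 1 := ⟨n - 1, by omega⟩
    have s := (h.succ_rank n).2
    rw [hA.b3 _ hn, hB.b3 _ hn] at s
    have : finrank ℂ (HH D n) = 0 := by
      rcases Nat.lt_or_ge n 3 with h' | h'
      · obtain rfl : n = 2 := by omega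
        exact hD.b2
      · exact hD.b3 n h'
    omega

end OpenCover

/-- cover of a subset by two relatively open subsets -/
lemma openCover_sets {E : Type} [TopologicalSpace E] {W U V D : Set E} (O₁ O₂ : Set E) (h₁ : IsOpen O₁) (h₂ : IsOpen O₂)
    (hU : U = W ∩ O₁) (hV : V = W ∩ O₂) (hW : W ⊆ O₁ ∪ O₂) (hD : D = U ∩ V) :
    OpenCover (D := D) (A := U) (B := V) (X := W)
      ⟨Set.inclusion (by rw [hD]; exact Set.inter_subset_left), continuous_inclusion _⟩
      ⟨Set.inclusion (by rw [hD]; exact Set.inter_subset_right), continuous_inclusion _⟩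
      ⟨Set.inclusion (by rw [hU]; exact Set.inter_subset_left), continuous_inclusion _⟩
      ⟨Set.inclusion (by rw [hV]; exact Set.inter_subset_left), continuous_inclusion _⟩ where
  hk := by
    have hs : U ⊆ W := by rw [hU]; exact Set.inter_subset_left
    refine ⟨IsEmbedding.inclusion hs, ?_⟩
    change IsOpen (Set.range (Set.inclusion hs))
    rw [Set.range_inclusion]
    convert h₁.preimage (continuous_subtype_val (p := (· ∈ W))) using 1
    ext x
    simp [hU, x.2]
  hl := by
    have hs : V ⊆ W := by rw [hV]; exact Set.inter_subset_left
    refine ⟨IsEmbedding.inclusion hs, ?_⟩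
    change IsOpen (Set.range (Set.inclusion hs))
    rw [Set.range_inclusion]
    convert h₂.preimage (continuous_subtype_val (p := (· ∈ W))) using 1
    ext x
    simp [hV, x.2]
  hi := by
    have hs : D ⊆ U := by rw [hD]; exact Set.inter_subset_left
    exact IsEmbedding.inclusion hs
  comm x := rfl
  cover x := by
    rcases hW x.2 with h | h
    · exact Or.inl ⟨⟨x, by rw [hU]; exact ⟨x.2, h⟩⟩, rfl⟩
    · exact Or.inr ⟨⟨x, by rw [hV]; exact ⟨x.2, h⟩⟩, rfl⟩
  inter a b hab := by
    have : a.1 = b.1 := congrArg Subtype.val hab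
    exact ⟨⟨a.1, by rw [hD]; exact ⟨a.2, by rw [this]; exact b.2⟩⟩, rfl⟩

end CubicHom

open MvPolynomial CategoryTheory
/-! ### The punctured plane -/

namespace CubicHom
open Topology Module

section
variable {D A B X Y Z : Type} [TopologicalSpace D] [TopologicalSpace A] [TopologicalSpace B] [TopologicalSpace X]
  [TopologicalSpace Y] [TopologicalSpace Z]

lemma Betti.prod_contractible [ContractibleSpace Y] {a b c : ℕ} (h : Betti X a b c) : Betti (X × Y) a b c := by
  obtain ⟨e⟩ := ContractibleSpace.hequiv_unit Y
  have e1 : ContinuousMap.HomotopyEquiv X (X × Unit) := (Homeomorph.prodPUnit X).symm.toHomotopyEquiv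
  exact h.of_hequiv (e1.trans ((ContinuousMap.HomotopyEquiv.refl X).prodCongr e.symm))

lemma OpenCover.prod {i : C(D, A)} {j : C(D, B)} {k : C(A, X)} {l : C(B, X)} (h : OpenCover i j k l) :
    OpenCover ((ContinuousMap.id Z).prodMap i) ((ContinuousMap.id Z).prodMap j)
      ((ContinuousMap.id Z).prodMap k) ((ContinuousMap.id Z).prodMap l) where
  hk := IsOpenEmbedding.id.prodMap h.hk
  hl := IsOpenEmbedding.id.prodMap h.hl
  hi := IsEmbedding.id.prodMap h.hi
  comm x := Prod.ext rfl (h.comm x.2)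
  cover x := by
    rcases h.cover x.2 with ⟨a, ha⟩ | ⟨a, ha⟩
    · exact Or.inl ⟨(x.1, a), Prod.ext rfl ha⟩
    · exact Or.inr ⟨(x.1, a), Prod.ext rfl ha⟩
  inter a b hab := by
    obtain ⟨x, hx⟩ := h.inter a.2 b.2 (congrArg Prod.snd hab)
    exact ⟨(a.1, x), Prod.ext rfl hx⟩

lemma hm_of_factor_contractible [ContractibleSpace Y] (f : C(X, Y)) (g : C(Y, Z)) {n : ℕ} (hn : n ≠ 0) :
    hm (g.comp f) n = 0 := by
  have hY := betti_contractible (X := Y)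
  have h0 : finrank ℂ (HH Y n) = 0 := by
    rcases Nat.lt_or_ge n 3 with h' | h'
    · interval_cases n
      exacts [absurd rfl hn, hY.b1, hY.b2]
    · exact hY.b3 n h'
  have := hY.fin n
  have : Subsingleton (HH Y n) := finrank_zero_iff.1 h0
  ext x
  rw [hm_comp_apply, Subsingleton.elim (hm f n x) 0, map_zero]; rfl

end

abbrev Cx : Set ℂ := {z | z ≠ 0}
abbrev Sp : Set ℂ := Complex.slitPlane
abbrev Sn : Set ℂ := {z | -z ∈ Complex.slitPlane}
abbrev Dc : Set ℂ := {z | z.im ≠ 0}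
abbrev Up : Set ℂ := {z | 0 < z.im}
abbrev Lo : Set ℂ := {z | z.im < 0}

lemma isOpen_Sn : IsOpen Sn := Complex.isOpen_slitPlane.preimage continuous_neg

lemma betti_Up : Betti Up 1 0 0 := by
  have : ContractibleSpace Up := Convex.contractibleSpace (convex_halfSpace_im_gt 0) ⟨Complex.I, by simp⟩
  exact betti_contractible

lemma betti_Lo : Betti Lo 1 0 0 := by
  have : ContractibleSpace Lo := Convex.contractibleSpace (convex_halfSpace_im_lt 0) ⟨-Complex.I, by simp⟩
  exact betti_contractible

instance : ContractibleSpace Up := Convex.contractibleSpace (convex_halfSpace_im_gt 0) ⟨Complex.I, by simp⟩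
instance : ContractibleSpace Lo := Convex.contractibleSpace (convex_halfSpace_im_lt 0) ⟨-Complex.I, by simp⟩
instance : ContractibleSpace Sp := Complex.starConvex_one_slitPlane.contractibleSpace ⟨1, by simp⟩
instance : ContractibleSpace Sn := by
  have e : Sp ≃ₜ Sn := (Homeomorph.neg ℂ).subtype (fun x => by simp)
  exact e.contractibleSpace_iff.1 inferInstance

lemma cover_Dc : ∃ (i : C((∅ : Set ℂ), Up)) (j : C((∅ : Set ℂ), Lo)) (k : C(Up, Dc)) (l : C(Lo, Dc)), OpenCover i j k l :=
  ⟨_, _, _, _, openCover_sets (W := Dc) (U := Up) (V := Lo) (D := ∅) Up Lo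
    (isOpen_lt continuous_const Complex.continuous_im)
    (isOpen_lt Complex.continuous_im continuous_const)
    (by ext x; simp +contextual [ne_of_gt])
    (by ext x; simp +contextual [ne_of_lt])
    (by intro x hx; rcases lt_or_gt_of_ne hx with h | h; exacts [Or.inr h, Or.inl h])
    (by ext x; simp; intro h; exact le_of_lt h)⟩

lemma betti_Dc : Betti Dc 2 0 0 := by
  obtain ⟨i, j, k, l, h⟩ := cover_Dc
  exact h.disj betti_contractible betti_contractible

lemma sub_Cx_Sp : Sp = Cx ∩ Sp := by
  ext x; simp; exact Complex.slitPlane_ne_zero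
lemma sub_Cx_Sm : Sn = Cx ∩ Sn := by
  ext x; simp; intro h hx; rw [hx] at h; simp at h
lemma Cx_cover : Cx ⊆ Sp ∪ Sn := by
  intro x hx
  simp only [Set.mem_union, Sp, Sn, Set.mem_setOf_eq, Complex.mem_slitPlane_iff, Complex.neg_re, Complex.neg_im]
  by_contra hcon
  push Not at hcon
  apply hx
  apply Complex.ext
  · simp; linarith [hcon.1.1, hcon.2.1]
  · exact hcon.1.2
lemma Dc_eq : Dc = Sp ∩ Sn := by
  ext x
  simp only [Set.mem_inter_iff, Sp, Sn, Dc, Set.mem_setOf_eq, Complex.mem_slitPlane_iff, Complex.neg_re, Complex.neg_im, neg_ne_zero]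
  constructor
  · tauto
  · rintro ⟨h1 | h1, h2 | h2⟩ <;> first | assumption | linarith

lemma cover_Cx : ∃ (i : C(Dc, Sp)) (j : C(Dc, Sn)) (k : C(Sp, Cx)) (l : C(Sn, Cx)), OpenCover i j k l :=
  ⟨_, _, _, _, openCover_sets (W := Cx) (U := Sp) (V := Sn) (D := Dc) Sp Sn Complex.isOpen_slitPlane isOpen_Sn
    sub_Cx_Sp sub_Cx_Sm Cx_cover Dc_eq⟩

lemma betti_Cx : Betti Cx 1 1 0 := by
  obtain ⟨i, j, k, l, h⟩ := cover_Cx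
  exact h.circ betti_Dc betti_contractible betti_contractible

lemma hm_Cx_ne_zero : (LinearMap.id : HH Cx 1 →ₗ[ℂ] HH Cx 1) ≠ 0 := by
  intro h
  have : Subsingleton (HH Cx 1) := ⟨fun a b => by
    have ha : LinearMap.id (R := ℂ) a = 0 := by rw [h]; rfl
    have hb : LinearMap.id (R := ℂ) b = 0 := by rw [h]; rfl
    exact ha.trans hb.symm⟩
  have h3 := betti_Cx.b1
  rw [finrank_zero_of_subsingleton] at h3
  omega

lemma torus_fin : Module.Finite ℂ (HH (Cx × Cx) 1) ∧ finrank ℂ (HH (Cx × Cx) 1) ≤ 2 := by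
  obtain ⟨i, j, k, l, h⟩ := cover_Cx
  obtain ⟨i', j', k', l', h'⟩ := cover_Dc
  have hD : Betti (Cx × Dc) 2 2 0 :=
    (h'.prod (Z := Cx)).disj betti_Cx.prod_contractible betti_Cx.prod_contractible
  have hA : Betti (Cx × Sp) 1 1 0 := betti_Cx.prod_contractible
  have hB : Betti (Cx × Sn) 1 1 0 := betti_Cx.prod_contractible
  have := hD.fin; have := hA.fin; have := hB.fin
  have hc := h.prod (Z := Cx)
  have s1 : finrank ℂ (HH (Cx × Cx) 1) + rk ((ContinuousMap.id Cx).prodMap i) ((ContinuousMap.id Cx).prodMap j) 1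
      + rk ((ContinuousMap.id Cx).prodMap i) ((ContinuousMap.id Cx).prodMap j) 0 =
    finrank ℂ (HH (Cx × Sp) 1) + finrank ℂ (HH (Cx × Sn) 1) + finrank ℂ (HH (Cx × Dc) 0) := (hc.succ_rank 0).2
  refine ⟨(hc.succ_rank 0).1, ?_⟩
  have : Nonempty Cx := ⟨⟨1, by simp⟩⟩
  have : Nonempty Dc := ⟨⟨Complex.I, by simp⟩⟩
  have r0 := rk_pos ((ContinuousMap.id Cx).prodMap i) ((ContinuousMap.id Cx).prodMap j)
  have r1 : rk ((ContinuousMap.id Cx).prodMap i) ((ContinuousMap.id Cx).prodMap j) 1 ≠ 0 := by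
    intro h0
    unfold rk at h0
    rw [Submodule.finrank_eq_zero, LinearMap.range_eq_bot] at h0
    have h1 : hm ((ContinuousMap.id Cx).prodMap i) 1 = 0 := by
      ext x
      have := congrArg (fun f => (f x).1) h0
      simpa using this
    apply hm_Cx_ne_zero
    let p : C(Cx, Cx × Dc) := ⟨fun z => (z, ⟨Complex.I, by simp⟩), by fun_prop⟩
    have h2 : (ContinuousMap.fst : C(Cx × Sp, Cx)).comp (((ContinuousMap.id Cx).prodMap i).comp p) = ContinuousMap.id Cx := rfl
    rw [← hm_id, ← h2, hm_comp, hm_comp, h1, LinearMap.zero_comp, LinearMap.comp_zero]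
  rw [hA.b1, hB.b1, hD.b0] at s1
  omega

def sqCx : C(Cx, Cx) := ⟨fun z => ⟨z.1 ^ 2, pow_ne_zero 2 z.2⟩, by fun_prop⟩
def mulCx : C(Cx × Cx, Cx) := ⟨fun z => ⟨z.1.1 * z.2.1, mul_ne_zero z.1.2 z.2.2⟩, by fun_prop⟩
def oneCx : Cx := ⟨1, one_ne_zero⟩

lemma hm_const (X : Type) [TopologicalSpace X] (z : Cx) : hm (ContinuousMap.const X z) 1 = 0 :=
  hm_of_factor_contractible (Y := Unit) (ContinuousMap.const X ()) (ContinuousMap.const Unit z) one_ne_zero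

lemma hm_sq (x : HH Cx 1) : hm sqCx 1 x = (2 : ℂ) • x := by
  let p1 : C(Cx × Cx, Cx) := ContinuousMap.fst
  let p2 : C(Cx × Cx, Cx) := ContinuousMap.snd
  let i1 : C(Cx, Cx × Cx) := ⟨fun z => (z, oneCx), by fun_prop⟩
  let i2 : C(Cx, Cx × Cx) := ⟨fun z => (oneCx, z), by fun_prop⟩
  let dg : C(Cx, Cx × Cx) := ⟨fun z => (z, z), by fun_prop⟩
  obtain ⟨hf, hr⟩ := torus_fin
  have := betti_Cx.fin 1
  have e11 : ∀ y, hm p1 1 (hm i1 1 y) = y := fun y => by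
    rw [← hm_comp_apply, show p1.comp i1 = ContinuousMap.id _ from rfl, hm_id]; rfl
  have e22 : ∀ y, hm p2 1 (hm i2 1 y) = y := fun y => by
    rw [← hm_comp_apply, show p2.comp i2 = ContinuousMap.id _ from rfl, hm_id]; rfl
  have e12 : ∀ y, hm p1 1 (hm i2 1 y) = 0 := fun y => by
    rw [← hm_comp_apply, show p1.comp i2 = ContinuousMap.const _ oneCx from rfl, hm_const]; rfl
  have e21 : ∀ y, hm p2 1 (hm i1 1 y) = 0 := fun y => by
    rw [← hm_comp_apply, show p2.comp i1 = ContinuousMap.const _ oneCx from rfl, hm_const]; rfl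
  have d1 : hm p1 1 (hm dg 1 x) = x := by
    rw [← hm_comp_apply, show p1.comp dg = ContinuousMap.id _ from rfl, hm_id]; rfl
  have d2 : hm p2 1 (hm dg 1 x) = x := by
    rw [← hm_comp_apply, show p2.comp dg = ContinuousMap.id _ from rfl, hm_id]; rfl
  have hsurj : Function.Surjective ((hm p1 1).prod (hm p2 1)) := by
    rintro ⟨a, b⟩
    refine ⟨hm i1 1 a + hm i2 1 b, ?_⟩
    simp [e11, e12, e21, e22]
  have hfr : finrank ℂ (HH (Cx × Cx) 1) = finrank ℂ (HH Cx 1 × HH Cx 1) := by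
    apply le_antisymm
    · rw [finrank_prod, betti_Cx.b1]; exact hr
    · exact LinearMap.finrank_le_finrank_of_surjective hsurj
  have hinj := (LinearMap.injective_iff_surjective_of_finrank_eq_finrank hfr).2 hsurj
  have hd : hm dg 1 x = hm i1 1 x + hm i2 1 x := by
    apply hinj
    simp [e11, e12, e21, e22, d1, d2]
  have m0 : sqCx = mulCx.comp dg := by
    ext z; simp [sqCx, mulCx, dg, sq]
  have m1 : mulCx.comp i1 = ContinuousMap.id _ := by
    ext z; simp [mulCx, i1, oneCx]
  have m2 : mulCx.comp i2 = ContinuousMap.id _ := by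
    ext z; simp [mulCx, i2, oneCx]
  rw [m0, hm_comp_apply, hd, map_add, ← hm_comp_apply, ← hm_comp_apply, m1, m2, hm_id, two_smul]; rfl

lemma hm_sq_injective : Function.Injective (hm sqCx 1) := by
  intro x y h
  rw [hm_sq, hm_sq] at h
  exact smul_right_injective _ two_ne_zero h

/-- gluing with injective first map on `H₁` and simply connected second piece -/
lemma OpenCover.inj_glue {D A B X : Type} [TopologicalSpace D] [TopologicalSpace A] [TopologicalSpace B] [TopologicalSpace X]
    {i : C(D, A)} {j : C(D, B)} {k : C(A, X)} {l : C(B, X)} (h : OpenCover i j k l)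
    (hD : Betti D 1 1 0) (hA : Betti A 1 1 0) (hB : Betti B 1 0 0) (hi : Function.Injective (hm i 1)) :
    Betti X 1 0 0 := by
  have := hD.fin; have := hA.fin; have := hB.fin
  have : Nonempty D := by
    by_contra hne
    rw [not_nonempty_iff] at hne
    have := (betti_empty (X := D)).b0
    rw [hD.b0] at this; omega
  have r0 := rk_pos i j
  have r0' := rk_le_left i j 0
  have r1 : rk i j 1 = 1 := by
    unfold rk
    rw [LinearMap.finrank_range_of_inj, hD.b1]
    intro x y hxy
    exact hi (congrArg Prod.fst hxy)
  have r2 := rk_le_left i j 2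
  have z := h.zero_rank.2
  have s1 : finrank ℂ (HH X 1) + rk i j 1 + rk i j 0 =
    finrank ℂ (HH A 1) + finrank ℂ (HH B 1) + finrank ℂ (HH D 0) := (h.succ_rank 0).2
  have s2 : finrank ℂ (HH X 2) + rk i j 2 + rk i j 1 =
    finrank ℂ (HH A 2) + finrank ℂ (HH B 2) + finrank ℂ (HH D 1) := (h.succ_rank 1).2
  rw [hA.b0, hB.b0] at z
  rw [hD.b0] at r0'
  rw [hD.b2] at r2
  rw [hA.b1, hB.b1, hD.b0] at s1
  rw [hA.b2, hB.b2, hD.b1] at s2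
  refine ⟨fun n => ?_, by omega, by omega, by omega, fun n hn => ?_⟩
  · cases n with
    | zero => exact h.zero_rank.1
    | succ n => exact (h.succ_rank n).1
  · obtain ⟨n, rfl⟩ : ∃ m, n = m + 1 := ⟨n - 1, by omega⟩
    have s := (h.succ_rank n).2
    rw [hA.b3 _ hn, hB.b3 _ hn] at s
    have : finrank ℂ (HH D n) = 0 := by
      rcases Nat.lt_or_ge n 3 with h' | h'
      · obtain rfl : n = 2 := by omega
        exact hD.b2
      · exact hD.b3 n h'
    omega

end CubicHom

open MvPolynomial CategoryTheory
/-! ### Local pieces of the surface -/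

namespace CubicHom
open Topology Module

/-- homeomorphism between subsets -/
def homeoOn {E E' : Type} [TopologicalSpace E] [TopologicalSpace E'] {S : Set E} {S' : Set E'} (f : E → E') (g : E' → E)
    (hf : ∀ x ∈ S, f x ∈ S') (hg : ∀ x ∈ S', g x ∈ S) (h1 : ∀ x ∈ S, g (f x) = x) (h2 : ∀ x ∈ S', f (g x) = x)
    (cf : ContinuousOn f S) (cg : ContinuousOn g S') : S ≃ₜ S' where
  toFun x := ⟨f x, hf x x.2⟩
  invFun x := ⟨g x, hg x x.2⟩
  left_inv x := Subtype.ext (h1 x x.2)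
  right_inv x := Subtype.ext (h2 x x.2)
  continuous_toFun := Continuous.subtype_mk (continuousOn_iff_continuous_domRestrict.1 cf) _
  continuous_invFun := Continuous.subtype_mk (continuousOn_iff_continuous_domRestrict.1 cg) _

lemma slit_of_convex {V : Set ℂ} (hV : Convex ℝ V) {v a t : ℂ} (hv : v ∈ V) (ha : a ∉ V) (ht : t ∈ V) :
    (t - a) / (v - a) ∈ Complex.slitPlane := by
  have hva : v - a ≠ 0 := fun h => ha (by rw [← sub_eq_zero.1 h]; exact hv)
  by_contra hcon
  rw [Complex.mem_slitPlane_iff] at hcon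
  push Not at hcon
  obtain ⟨h1, h2⟩ := hcon
  set u := (t - a) / (v - a) with hu
  have hu' : u = (u.re : ℂ) := Complex.ext rfl (by simpa using h2)
  set m : ℝ := u.re with hm
  have ht' : t = a + m * (v - a) := by
    rw [← hu', hu]; field_simp; ring
  apply ha
  have h3 : (0:ℝ) < 1 - m := by linarith
  have key : (-m / (1 - m)) • v + (1 / (1 - m)) • t = a := by
    have h4 : ((1 : ℂ) - m) ≠ 0 := by exact_mod_cast h3.ne'
    rw [ht', Complex.real_smul, Complex.real_smul]
    push_cast
    field_simp
    ring
  rw [← key]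
  apply hV hv ht
  · apply div_nonneg <;> linarith
  · positivity
  · field_simp; ring

lemma exists_sqrt_linear {V : Set ℂ} (hV : Convex ℝ V) {a : ℂ} (ha : a ∉ V) :
    ∃ r : ℂ → ℂ, DifferentiableOn ℂ r V ∧ ∀ t ∈ V, r t ^ 2 = t - a := by
  rcases V.eq_empty_or_nonempty with rfl | ⟨v, hv⟩
  · exact ⟨0, by simp, by simp⟩
  have hva : v - a ≠ 0 := fun h => ha (by rw [← sub_eq_zero.1 h]; exact hv)
  obtain ⟨c, hc⟩ := IsAlgClosed.exists_pow_nat_eq (v - a) (n := 2) (by norm_num)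
  refine ⟨fun t => c * ((t - a) / (v - a)) ^ (1 / 2 : ℂ), ?_, ?_⟩
  · intro t ht
    refine DifferentiableWithinAt.const_mul ?_ _
    refine DifferentiableWithinAt.cpow_const ?_ (slit_of_convex hV hv ha ht)
    fun_prop
  · intro t ht
    have : (((t - a) / (v - a)) ^ (1 / 2 : ℂ)) ^ 2 = (t - a) / (v - a) := by
      rw [one_div]
      exact Complex.cpow_nat_inv_pow _ (n := 2) (by norm_num)
    simp only [mul_pow, this, hc]
    field_simp

lemma exists_sqrt_poly {V : Set ℂ} (hV : Convex ℝ V) (P : Polynomial ℂ) (hP : ∀ t ∈ V, P.eval t ≠ 0) :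
    ∃ r : ℂ → ℂ, DifferentiableOn ℂ r V ∧ ∀ t ∈ V, r t ^ 2 = P.eval t := by
  by_cases h0 : P = 0
  · subst h0
    exact ⟨0, differentiableOn_const 0, fun t ht => absurd (by simp) (hP t ht)⟩
  have key : ∀ M : Multiset ℂ, (∀ a ∈ M, a ∉ V) → ∃ r : ℂ → ℂ, DifferentiableOn ℂ r V ∧
      ∀ t ∈ V, r t ^ 2 = (M.map (fun a => t - a)).prod := by
    intro M
    induction M using Multiset.induction_on with
    | empty => intro _; exact ⟨fun _ => 1, differentiableOn_const 1, fun t _ => by simp⟩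
    | cons a M ih =>
      intro h
      obtain ⟨r, hr, hr2⟩ := ih (fun b hb => h b (Multiset.mem_cons_of_mem hb))
      obtain ⟨r', hr', hr2'⟩ := exists_sqrt_linear hV (h a (Multiset.mem_cons_self a M))
      refine ⟨fun t => r' t * r t, hr'.mul hr, fun t ht => ?_⟩
      simp only [mul_pow, hr2 t ht, hr2' t ht, Multiset.map_cons, Multiset.prod_cons]
  obtain ⟨r, hr, hr2⟩ := key P.roots (fun a ha hav => hP a hav ((Polynomial.mem_roots h0).1 ha))
  obtain ⟨c, hc⟩ := IsAlgClosed.exists_pow_nat_eq P.leadingCoeff (n := 2) (by norm_num)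
  refine ⟨fun t => c * r t, hr.const_mul c, fun t ht => ?_⟩
  simp only [mul_pow, hr2 t ht, hc]
  have hs := (IsAlgClosed.splits P).eq_prod_roots
  conv_rhs => rw [hs]
  simp [Polynomial.eval_mul, Polynomial.eval_multiset_prod, Multiset.map_map]

/-- the surface in the `(t,s,d)` coordinates over `V` -/
def Sx (α β : ℂ) (c : Polynomial ℂ) (V : Set ℂ) : Set (ℂ × ℂ × ℂ) :=
  {w | w.1 ∈ V ∧ w.1 * w.2.1 ^ 2 + (4 - w.1) * w.2.2 ^ 2 = α * w.2.1 + β * w.2.2 + 4 * c.eval w.1}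

/-- The discriminant -/
noncomputable def PP (α β : ℂ) (c : Polynomial ℂ) : Polynomial ℂ :=
  Polynomial.X * (16 * c * (4 - Polynomial.X) + Polynomial.C (β ^ 2)) + Polynomial.C (α ^ 2) * (4 - Polynomial.X)

lemma PP_eval (α β : ℂ) (c : Polynomial ℂ) (t : ℂ) :
    (PP α β c).eval t = t * (16 * c.eval t * (4 - t) + β ^ 2) + α ^ 2 * (4 - t) := by
  simp [PP]

/-- normal form -/
def Md (α : ℂ) (g : ℂ → ℂ) (V : Set ℂ) : Set (ℂ × ℂ × ℂ) :=
  {w | w.1 ∈ V ∧ w.1 * w.2.1 ^ 2 - α * w.2.1 + w.2.2 ^ 2 = g w.1}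

noncomputable def gg (β : ℂ) (c : Polynomial ℂ) (t : ℂ) : ℂ := 4 * c.eval t + β ^ 2 / (4 * (4 - t))

lemma four_sub_ne {V : Set ℂ} (h4 : (4:ℂ) ∉ V) {t : ℂ} (ht : t ∈ V) : 4 - t ≠ 0 := fun h => h4 (by
  rw [sub_eq_zero.1 h]; exact ht)

lemma gg_cont (β : ℂ) (c : Polynomial ℂ) {V : Set ℂ} (h4 : (4:ℂ) ∉ V) : ContinuousOn (gg β c) V := by
  intro t ht
  have := four_sub_ne h4 ht
  apply ContinuousAt.continuousWithinAt
  unfold gg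
  refine ContinuousAt.add (by fun_prop) (ContinuousAt.div (by fun_prop) (by fun_prop) (by simpa using this))

lemma exists_sx_md (α β : ℂ) (c : Polynomial ℂ) {V : Set ℂ} (hV : Convex ℝ V) (h4 : (4:ℂ) ∉ V) :
    Nonempty (Md α (gg β c) V ≃ₜ Sx α β c V) := by
  obtain ⟨r, hr, hr2⟩ := exists_sqrt_poly hV (4 - Polynomial.X) (fun t ht => by
    simpa using four_sub_ne h4 ht)
  replace hr2 : ∀ t ∈ V, r t ^ 2 = 4 - t := fun t ht => by simpa using hr2 t ht
  have hr0 : ∀ t ∈ V, r t ≠ 0 := fun t ht h => four_sub_ne h4 ht (by rw [← hr2 t ht, h]; simp)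
  have hrc := hr.continuousOn
  refine ⟨homeoOn (fun w => (w.1, w.2.1, w.2.2 / r w.1 + β / (2 * (4 - w.1))))
    (fun w => (w.1, w.2.1, r w.1 * (w.2.2 - β / (2 * (4 - w.1))))) ?_ ?_ ?_ ?_ ?_ ?_⟩
  · rintro ⟨t, s, e⟩ ⟨ht, h⟩
    refine ⟨ht, ?_⟩
    have h1 := hr0 t ht; have h2 := four_sub_ne h4 ht; have h3 := hr2 t ht
    simp only [gg] at h ⊢
    have : (4 - t) * (e / r t + β / (2 * (4 - t))) ^ 2 = e ^ 2 + β * (e / r t) + β ^ 2 / (4 * (4 - t)) := by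
      rw [← h3]; field_simp; ring
    rw [this]
    have h5 : β * (e / r t + β / (2 * (4 - t))) = β * (e / r t) + 2 * (β ^ 2 / (4 * (4 - t))) := by field_simp; ring
    rw [h5]
    linear_combination h
  · rintro ⟨t, s, d⟩ ⟨ht, h⟩
    refine ⟨ht, ?_⟩
    have h1 := hr0 t ht; have h2 := four_sub_ne h4 ht; have h3 := hr2 t ht
    simp only [gg] at h ⊢
    have : (r t * (d - β / (2 * (4 - t)))) ^ 2 = (4 - t) * d ^ 2 - β * d + β ^ 2 / (4 * (4 - t)) := by
      rw [mul_pow, h3]; field_simp; ring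
    rw [this]
    linear_combination h
  · rintro ⟨t, s, e⟩ ⟨ht, h⟩
    have h1 := hr0 t ht
    simp only [Prod.mk.injEq, true_and]
    field_simp
    ring
  · rintro ⟨t, s, e⟩ ⟨ht, h⟩
    have h1 := hr0 t ht
    simp only [Prod.mk.injEq, true_and]
    field_simp
    ring
  · have hc : ContinuousOn (fun w : ℂ × ℂ × ℂ => r w.1) (Md α (gg β c) V) :=
      hrc.comp continuous_fst.continuousOn (fun w hw => hw.1)
    refine ContinuousOn.prodMk (by fun_prop) (ContinuousOn.prodMk (by fun_prop) ?_)
    refine ContinuousOn.add (ContinuousOn.div (by fun_prop) hc (fun w hw => hr0 _ hw.1))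
      (ContinuousOn.div (by fun_prop) (by fun_prop) (fun w hw => by simpa using four_sub_ne h4 hw.1))
  · have hc : ContinuousOn (fun w : ℂ × ℂ × ℂ => r w.1) (Sx α β c V) :=
      hrc.comp continuous_fst.continuousOn (fun w hw => hw.1)
    refine ContinuousOn.prodMk (by fun_prop) (ContinuousOn.prodMk (by fun_prop) ?_)
    refine ContinuousOn.mul hc (ContinuousOn.sub (by fun_prop) 
      (ContinuousOn.div (by fun_prop) (by fun_prop) (fun w hw => by simpa using four_sub_ne h4 hw.1)))

lemma gg_PP (α β : ℂ) (c : Polynomial ℂ) {t : ℂ} (h : 4 - t ≠ 0) :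
    t * gg β c t + α ^ 2 / 4 = (PP α β c).eval t / (4 * (4 - t)) := by
  rw [PP_eval, gg]; field_simp; ring

/-- hyperbola bundle -/
def Hy (G : ℂ → ℂ) (V : Set ℂ) : Set (ℂ × ℂ × ℂ) := {w | w.1 ∈ V ∧ w.2.1 * w.2.2 = G w.1}

lemma exists_md_hy (α : ℂ) (g G : ℂ → ℂ) {V : Set ℂ} (hV : Convex ℝ V) (h0 : (0:ℂ) ∉ V)
    (hG : ∀ t ∈ V, t * g t + α ^ 2 / 4 = G t) : Nonempty (Hy G V ≃ₜ Md α g V) := by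
  obtain ⟨q, hq, hq2⟩ := exists_sqrt_linear hV h0
  simp only [sub_zero] at hq2
  have ht0 : ∀ t ∈ V, t ≠ 0 := fun t ht h => h0 (h ▸ ht)
  have hq0 : ∀ t ∈ V, q t ≠ 0 := fun t ht h => ht0 t ht (by rw [← hq2 t ht, h]; simp)
  have hqc := hq.continuousOn
  have hI := Complex.I_ne_zero
  have hI2 := Complex.I_sq
  refine ⟨homeoOn (fun w => (w.1, ((w.2.1 + w.2.2) / 2 + α / 2) / w.1, (w.2.1 - w.2.2) / (2 * Complex.I * q w.1)))
    (fun w => (w.1, w.1 * w.2.1 - α / 2 + Complex.I * q w.1 * w.2.2, w.1 * w.2.1 - α / 2 - Complex.I * q w.1 * w.2.2))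
     ?_ ?_ ?_ ?_ ?_ ?_⟩
  · rintro ⟨t, a, b⟩ ⟨ht, h⟩
    refine ⟨ht, ?_⟩
    have h1 := hq0 t ht; have h2 := hq2 t ht; have h3 := hG t ht; have h4 := ht0 t ht
    simp only at h ⊢
    apply mul_left_cancel₀ h4
    have e1 : t * ((a - b) / (2 * Complex.I * q t)) ^ 2 = - (a - b) ^ 2 / 4 := by
      rw [div_pow, mul_pow, mul_pow, hI2, h2]; field_simp; ring
    have e2 : t * (((a + b) / 2 + α / 2) / t) = (a + b) / 2 + α / 2 := by field_simp
    set s := ((a + b) / 2 + α / 2) / t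
    linear_combination e1 + (t * s - α + ((a + b) / 2 + α / 2)) * e2 + h - h3
  · rintro ⟨t, s, e⟩ ⟨ht, h⟩
    refine ⟨ht, ?_⟩
    have h1 := hq0 t ht; have h2 := hq2 t ht; have h3 := hG t ht; have h4 := ht0 t ht
    simp only at h ⊢
    linear_combination t * h + h3 - (q t) ^ 2 * e ^ 2 * hI2 + e ^ 2 * h2
  · rintro ⟨t, s, e⟩ ⟨ht, h⟩
    have h1 := hq0 t ht;  have h4 := ht0 t ht
    simp only [Prod.mk.injEq, true_and]
    constructor <;> · field_simp; ring
  · rintro ⟨t, s, e⟩ ⟨ht, h⟩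
    have h1 := hq0 t ht;  have h4 := ht0 t ht
    simp only [Prod.mk.injEq, true_and]
    constructor <;> · field_simp; ring
  · have hc : ContinuousOn (fun w : ℂ × ℂ × ℂ => q w.1) (Hy G V) :=
      hqc.comp continuous_fst.continuousOn (fun w hw => hw.1)
    refine ContinuousOn.prodMk (by fun_prop) (ContinuousOn.prodMk ?_ ?_)
    · exact ContinuousOn.div (by fun_prop) (by fun_prop) (fun w hw => ht0 _ hw.1)
    · exact ContinuousOn.div (by fun_prop) (continuousOn_const.mul hc) (fun w hw => mul_ne_zero (by simp) (hq0 _ hw.1))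
  · have hc : ContinuousOn (fun w : ℂ × ℂ × ℂ => q w.1) (Md α g V) :=
      hqc.comp continuous_fst.continuousOn (fun w hw => hw.1)
    have hc2 : ContinuousOn (fun w : ℂ × ℂ × ℂ => Complex.I * q w.1 * w.2.2) (Md α g V) :=
      (continuousOn_const.mul hc).mul (by fun_prop)
    refine ContinuousOn.prodMk (by fun_prop) (ContinuousOn.prodMk ?_ ?_)
    · exact ContinuousOn.add (by fun_prop) hc2
    · exact ContinuousOn.sub (by fun_prop) hc2

lemma betti_hy_unramified (G : ℂ → ℂ) {V : Set ℂ} (hV : Convex ℝ V) (hne : V.Nonempty) (hc : ContinuousOn G V)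
    (h : ∀ t ∈ V, G t ≠ 0) : Betti (Hy G V) 1 1 0 := by
  have : ContractibleSpace V := hV.contractibleSpace hne
  have e : (Cx ×ˢ V : Set (ℂ × ℂ)) ≃ₜ Hy G V := homeoOn (fun w => (w.2, w.1, G w.2 / w.1)) (fun w => (w.2.1, w.1))
    (fun w hw => ⟨hw.2, by have := hw.1; simp only [Set.mem_ofPred_eq] at this; simp only []; field_simp⟩)
    (fun w hw => ⟨fun h0 => h _ hw.1 (by rw [← hw.2, h0, zero_mul]), hw.1⟩)
    (fun w hw => rfl)
    (fun w hw => by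
      obtain ⟨t, a, b⟩ := w
      obtain ⟨ht, hab⟩ := hw
      have : a ≠ 0 := fun h0 => h _ ht (by rw [← hab]; simp [h0])
      simp only [Prod.mk.injEq, true_and] at hab ⊢
      rw [← hab]; field_simp)
    (by
      have hcc : ContinuousOn (fun w : ℂ × ℂ => G w.2) (Cx ×ˢ V : Set (ℂ × ℂ)) :=
        hc.comp continuous_snd.continuousOn (fun w hw => hw.2)
      refine ContinuousOn.prodMk (by fun_prop) (ContinuousOn.prodMk (by fun_prop) ?_)
      exact hcc.div (by fun_prop) (fun w hw => hw.1))
    (by fun_prop)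
  exact (betti_Cx.prod_contractible (Y := V)).of_homeo ((Homeomorph.Set.prod Cx V).symm.trans e)

lemma betti_hy_node (G h : ℂ → ℂ) {V : Set ℂ} (hV : Convex ℝ V) {a : ℂ} (ha : a ∈ V) (hc : ContinuousOn h V)
    (h0 : ∀ t ∈ V, h t ≠ 0) (hG : ∀ t ∈ V, G t = (t - a) * h t) : Betti (Hy G V) 1 0 0 := by
  let T : Set (ℂ × ℂ) := {w | w.1 * w.2 + a ∈ V}
  have hT : StarConvex ℝ 0 T := by
    rw [starConvex_zero_iff]
    rintro ⟨x, y⟩ hx m hm0 hm1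
    have : (m * x) * (m * y) + a = (m ^ 2 : ℝ) • (x * y + a) + (1 - m ^ 2 : ℝ) • a := by
      simp only [Complex.real_smul]; push_cast; ring
    change (m • x) * (m • y) + a ∈ V
    rw [Complex.real_smul, Complex.real_smul, this]
    exact hV hx ha (by positivity) (by nlinarith) (by ring)
  have : ContractibleSpace T := hT.contractibleSpace ⟨0, by simpa [T] using ha⟩
  have e : T ≃ₜ Hy G V := homeoOn (fun w => (w.1 * w.2 + a, w.1, w.2 * h (w.1 * w.2 + a)))
    (fun w => (w.2.1, w.2.2 / h w.1))
    (fun w hw => ⟨hw, by simp only []; rw [hG _ hw]; ring⟩)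
    (fun w hw => by
      have h1 := h0 _ hw.1
      have h2 := hw.2
      rw [hG _ hw.1] at h2
      change w.2.1 * (w.2.2 / h w.1) + a ∈ V
      rw [← mul_div_assoc, h2, mul_div_assoc, div_self h1]
      simpa using hw.1)
    (fun w hw => by
      have h1 := h0 _ hw
      refine Prod.ext rfl ?_
      exact mul_div_cancel_right₀ _ h1)
    (fun w hw => by
      have h1 := h0 _ hw.1
      have h2 := hw.2
      rw [hG _ hw.1] at h2
      have h3 : w.2.1 * (w.2.2 / h w.1) + a = w.1 := by
        rw [← mul_div_assoc, h2, mul_div_assoc, div_self h1]; ring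
      simp only [h3]
      refine Prod.ext rfl (Prod.ext rfl ?_)
      simp only []; field_simp)
    (by
      have hcc : ContinuousOn (fun w : ℂ × ℂ => h (w.1 * w.2 + a)) T :=
        hc.comp (by fun_prop) (fun w hw => hw)
      exact ContinuousOn.prodMk (by fun_prop) (ContinuousOn.prodMk (by fun_prop) (ContinuousOn.mul (by fun_prop) hcc)))
    (by
      have hcc : ContinuousOn (fun w : ℂ × ℂ × ℂ => h w.1) (Hy G V) :=
        hc.comp (by fun_prop) (fun w hw => hw.1)
      exact ContinuousOn.prodMk (by fun_prop) (ContinuousOn.div (by fun_prop) hcc (fun w hw => h0 _ hw.1)))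
  exact (betti_contractible (X := T)).of_homeo e

section
variable {α β : ℂ} {c : Polynomial ℂ} {V : Set ℂ}

lemma local_L0 (hV : Convex ℝ V) (hne : V.Nonempty) (h4 : (4:ℂ) ∉ V) (h0 : (0:ℂ) ∉ V)
    (hP : ∀ t ∈ V, (PP α β c).eval t ≠ 0) : Betti (Sx α β c V) 1 1 0 := by
  obtain ⟨e1⟩ := exists_sx_md α β c hV h4
  obtain ⟨e2⟩ := exists_md_hy α (gg β c) (fun t => (PP α β c).eval t / (4 * (4 - t))) hV h0
    (fun t ht => gg_PP α β c (four_sub_ne h4 ht))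
  refine Betti.of_homeo ?_ (e2.trans e1)
  refine betti_hy_unramified _ hV hne ?_ ?_
  · exact ContinuousOn.div (by fun_prop) (by fun_prop) (fun t ht => by simpa using four_sub_ne h4 ht)
  · intro t ht
    exact div_ne_zero (hP t ht) (by simpa using four_sub_ne h4 ht)

lemma local_L1 (hV : Convex ℝ V) (h4 : (4:ℂ) ∉ V) (h0 : (0:ℂ) ∉ V) {a : ℂ} (ha : a ∈ V) (hPa : (PP α β c).eval a = 0)
    (hd : (PP α β c).derivative.eval a ≠ 0)
    (hP : ∀ t ∈ V, (PP α β c).eval t = 0 → t = a) : Betti (Sx α β c V) 1 0 0 := by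
  obtain ⟨e1⟩ := exists_sx_md α β c hV h4
  obtain ⟨e2⟩ := exists_md_hy α (gg β c) (fun t => (PP α β c).eval t / (4 * (4 - t))) hV h0
    (fun t ht => gg_PP α β c (four_sub_ne h4 ht))
  refine Betti.of_homeo ?_ (e2.trans e1)
  obtain ⟨Q, hQ⟩ := Polynomial.dvd_iff_isRoot.2 hPa
  refine betti_hy_node _ (fun t => Q.eval t / (4 * (4 - t))) hV ha ?_ ?_ ?_
  · exact ContinuousOn.div (by fun_prop) (by fun_prop) (fun t ht => by simpa using four_sub_ne h4 ht)
  · intro t ht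
    refine div_ne_zero (fun hq => ?_) (by simpa using four_sub_ne h4 ht)
    have : t = a := hP t ht (by rw [hQ]; simp [hq])
    subst this
    apply hd
    rw [hQ]; simp [hq]
  · intro t ht
    simp only [hQ, Polynomial.eval_mul, Polynomial.eval_sub, Polynomial.eval_X, Polynomial.eval_C]
    ring

end

end CubicHom

open MvPolynomial CategoryTheory
/-! ### Degenerate fibres -/

namespace CubicHom
open Topology Module

def SQ (Q : ℂ × ℂ × ℂ → Prop) (V : Set ℂ) : Set (ℂ × ℂ × ℂ) := {w | w.1 ∈ V ∧ Q w}

lemma scale_mem {V : Set ℂ} (hV : Convex ℝ V) (h0 : (0:ℂ) ∈ V) {t : ℂ} (ht : t ∈ V) {m : ℝ} (hm : 0 < m) (hm1 : m ≤ 1) :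
    (m ^ 2 : ℝ) • t ∈ V := by
  have := hV ht h0 (a := m ^ 2) (b := 1 - m ^ 2) (by positivity) (by nlinarith) (by ring)
  simpa using this

section
noncomputable def mu (r : ℝ) (t : ℂ) : ℝ := r / (r + ‖t‖)
lemma mu_pos {r : ℝ} (hr : 0 < r) (t : ℂ) : 0 < mu r t := by unfold mu; positivity
lemma mu_le {r : ℝ} (hr : 0 < r) (t : ℂ) : mu r t ≤ 1 := by
  unfold mu
  rw [div_le_one (by positivity)]
  linarith [norm_nonneg t]
lemma mu_cont {r : ℝ} (hr : 0 < r) : Continuous (mu r) := by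
  unfold mu
  exact continuous_const.div (by fun_prop) (fun t => by positivity)
lemma mu_norm {r : ℝ} (hr : 0 < r) (t : ℂ) : ‖(mu r t ^ 2 : ℝ) • t‖ < r := by
  have h1 := mu_pos hr t
  have h2 := mu_le hr t
  rw [norm_smul, Real.norm_of_nonneg (by positivity)]
  have h3 : mu r t * ‖t‖ < r := by
    unfold mu
    rw [div_mul_eq_mul_div, div_lt_iff₀ (by positivity)]
    nlinarith
  have h4 : mu r t ^ 2 * ‖t‖ ≤ mu r t * ‖t‖ := by
    apply mul_le_mul_of_nonneg_right _ (norm_nonneg t)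
    nlinarith
  linarith

lemma scale_homotopic (Q : ℂ × ℂ × ℂ → Prop) (φ : ℝ × (ℂ × ℂ × ℂ) → ℂ × ℂ × ℂ)
  (hφ : ContinuousOn φ {p | 0 < p.1}) (h1 : ∀ w, φ (1, w) = w) (hfst : ∀ m w, (φ (m, w)).1 = (m ^ 2 : ℝ) • w.1)
  (hQ : ∀ m w, 0 < m → Q w → Q (φ (m, w)))
    {V : Set ℂ} (hV : Convex ℝ V) (h0 : (0:ℂ) ∈ V) {r : ℝ} (hr : 0 < r)
    (f : C(SQ Q V, SQ Q V)) (hf : ∀ w, (f w).1 = φ (mu r w.1.1, w.1)) : f.Homotopic (ContinuousMap.id _) := by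
  have pos : ∀ (τ : unitInterval) (t : ℂ), 0 < (1 - τ.1) * mu r t + τ.1 := by
    intro τ t
    have := mu_pos hr t
    rcases eq_or_lt_of_le τ.2.1 with h | h
    · rw [← h]; simpa
    · have h2 : 0 ≤ (1 - τ.1) * mu r t := mul_nonneg (by linarith [τ.2.2]) this.le
      linarith
  have le1 : ∀ (τ : unitInterval) (t : ℂ), (1 - τ.1) * mu r t + τ.1 ≤ 1 := by
    intro τ t
    have := mu_le hr t
    have h2 : (1 - τ.1) * mu r t ≤ (1 - τ.1) * 1 := mul_le_mul_of_nonneg_left this (by linarith [τ.2.2])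
    linarith
  have hmu := mu_cont hr
  refine ⟨⟨⟨fun p => ⟨φ ((1 - p.1.1) * mu r p.2.1.1 + p.1.1, p.2.1), ?_, hQ _ _ (pos _ _) p.2.2.2⟩, ?_⟩, ?_, ?_⟩⟩
  · rw [hfst]
    exact scale_mem hV h0 p.2.2.1 (pos _ _) (le1 _ _)
  · refine Continuous.subtype_mk ?_ _
    exact hφ.comp_continuous (by fun_prop) (fun p => pos _ _)
  · intro w
    apply Subtype.ext
    simp [hf]
  · intro w
    apply Subtype.ext
    simp [h1]

lemma betti_scale (Q : ℂ × ℂ × ℂ → Prop) (φ : ℝ × (ℂ × ℂ × ℂ) → ℂ × ℂ × ℂ)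
  (hφ : ContinuousOn φ {p | 0 < p.1}) (h1 : ∀ w, φ (1, w) = w) (hfst : ∀ m w, (φ (m, w)).1 = (m ^ 2 : ℝ) • w.1)
  (hQ : ∀ m w, 0 < m → Q w → Q (φ (m, w)))
    {V : Set ℂ} (hV : Convex ℝ V) (hVo : IsOpen V) (h0 : (0:ℂ) ∈ V) {a b c : ℕ}
    (hB : Betti (SQ Q Set.univ) a b c) : Betti (SQ Q V) a b c := by
  obtain ⟨r, hr, hball⟩ := Metric.isOpen_iff.1 hVo 0 h0
  have hmu := mu_cont hr
  let f : C(SQ Q Set.univ, SQ Q V) := ⟨fun w => ⟨φ (mu r w.1.1, w.1), by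
      rw [hfst]
      exact hball (by simpa using mu_norm hr w.1.1), hQ _ _ (mu_pos hr _) w.2.2⟩,
    Continuous.subtype_mk (hφ.comp_continuous (by fun_prop) (fun p => mu_pos hr _)) _⟩
  let g : C(SQ Q V, SQ Q Set.univ) := ⟨fun w => ⟨w.1, trivial, w.2.2⟩, by fun_prop⟩
  refine hB.of_equiv (fun n => hequiv f g ?_ ?_ n)
  · exact scale_homotopic Q φ hφ h1 hfst hQ convex_univ (Set.mem_univ _) hr _ (fun w => rfl)
  · exact scale_homotopic Q φ hφ h1 hfst hQ hV h0 hr _ (fun w => rfl)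

end

/-! #### the double line -/

abbrev Om2 : Set ℂ := {e | 1 + e ∈ Complex.slitPlane ∧ 1 - e ∈ Complex.slitPlane}

lemma slit_scale {u : ℂ} (a : ℝ) (ha : 0 < a) (hu : (a : ℂ) - u ∈ Complex.slitPlane) {m : ℝ} (hm0 : 0 ≤ m) (hm1 : m ≤ 1) :
    (a : ℂ) - m * u ∈ Complex.slitPlane := by
  have h := Complex.starConvex_slitPlane (z := (a:ℂ)) (by exact_mod_cast ha) hu (a := 1 - m) (b := m) (by linarith) hm0 (by ring)
  convert h using 1
  simp only [Complex.real_smul]; push_cast; ring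

lemma Om2_contr : ContractibleSpace Om2 := by
  have : StarConvex ℝ 0 Om2 := by
    rw [starConvex_zero_iff]
    intro x hx m h0 h1
    have e1 := slit_scale (u := x) 1 one_pos (by simpa using hx.2) h0 h1
    have e2 := slit_scale (u := -x) 1 one_pos (by simpa using hx.1) h0 h1
    simp only [Complex.real_smul]
    exact ⟨by simpa using e2, by simpa using e1⟩
  exact this.contractibleSpace ⟨0, by simp⟩

abbrev Th : Set (ℂ × ℂ) := {w | 2 - w.2 * w.1 ^ 2 ∈ Complex.slitPlane}

lemma Th_contr : ContractibleSpace Th := by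
  have : StarConvex ℝ 0 Th := by
    rw [starConvex_zero_iff]
    rintro ⟨x, y⟩ hx m h0 h1
    have e1 := slit_scale (u := y * x ^ 2) (m := m ^ 3) 2 two_pos (by simpa using hx) (by positivity) (pow_le_one₀ h0 h1)
    change 2 - (m • y) * (m • x) ^ 2 ∈ Complex.slitPlane
    simp only [Complex.real_smul]
    convert e1 using 1
    push_cast; ring
  exact this.contractibleSpace ⟨0, by simp⟩

def Wd : Set (ℂ × ℂ × ℂ) := {w | w.1 * w.2.1 ^ 2 + w.2.2 ^ 2 = 1}

lemma betti_half (σ : ℂ) (hσ : σ ^ 2 = 1) :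
    Betti (Wd ∩ {w | 1 + σ * w.2.2 ∈ Complex.slitPlane} : Set (ℂ × ℂ × ℂ)) 1 0 0 := by
  have := Th_contr
  refine (betti_contractible (X := Th)).of_homeo (homeoOn (fun w => (w.2 * (2 - w.2 * w.1 ^ 2), w.1, σ * (1 - w.2 * w.1 ^ 2)))
    (fun w => (w.2.1, w.1 / (1 + σ * w.2.2))) ?_ ?_ ?_ ?_ ?_ ?_)
  · rintro ⟨s, q⟩ h
    refine ⟨?_, ?_⟩
    · simp only [Wd, Set.mem_ofPred_eq]
      linear_combination (1 - q * s ^ 2) ^ 2 * hσ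
    · simp only [Set.mem_ofPred_eq] at h ⊢
      convert h using 1
      linear_combination (1 - q * s ^ 2) * hσ
  · rintro ⟨t, s, e⟩ ⟨h, h'⟩
    simp only [Wd, Set.mem_ofPred_eq] at h h' ⊢
    have hne := Complex.slitPlane_ne_zero h'
    have : 2 - t / (1 + σ * e) * s ^ 2 = 1 + σ * e := by
      field_simp
      linear_combination -h - e ^ 2 * hσ + e ^ 2 * hσ - e ^ 2 * hσ
    rw [this]; exact h'
  · rintro ⟨s, q⟩ h
    have hne := Complex.slitPlane_ne_zero h
    have h2 : 1 + σ * (σ * (1 - q * s ^ 2)) = 2 - q * s ^ 2 := by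
      linear_combination (1 - q * s ^ 2) * hσ
    simp only [h2]
    refine Prod.ext rfl ?_
    exact mul_div_cancel_right₀ _ hne
  · rintro ⟨t, s, e⟩ ⟨h, h'⟩
    simp only [Wd, Set.mem_ofPred_eq] at h h' ⊢
    have hne := Complex.slitPlane_ne_zero h'
    have : 2 - t / (1 + σ * e) * s ^ 2 = 1 + σ * e := by
      field_simp
      linear_combination -h - e ^ 2 * hσ
    have h3 : 1 - t / (1 + σ * e) * s ^ 2 = σ * e := by linear_combination this
    rw [this, h3]
    refine Prod.ext ?_ (Prod.ext rfl ?_)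
    · simp only []; field_simp
    · simp only []; linear_combination e * hσ
  · fun_prop
  · refine ContinuousOn.prodMk (by fun_prop) (ContinuousOn.div (by fun_prop) (by fun_prop) ?_)
    intro w hw
    exact Complex.slitPlane_ne_zero hw.2

lemma betti_Wd : Betti Wd 1 0 1 := by
  have hA := betti_half 1 (by norm_num)
  have hB := betti_half (-1) (by norm_num)
  have hD : Betti ((Wd ∩ {w | 1 + 1 * w.2.2 ∈ Complex.slitPlane}) ∩ (Wd ∩ {w | 1 + (-1) * w.2.2 ∈ Complex.slitPlane}) :
      Set (ℂ × ℂ × ℂ)) 1 1 0 := by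
    have := Om2_contr
    have e : (Cx ×ˢ Om2 : Set (ℂ × ℂ)) ≃ₜ ((Wd ∩ {w | 1 + 1 * w.2.2 ∈ Complex.slitPlane}) ∩ (Wd ∩ {w | 1 + (-1) * w.2.2 ∈ Complex.slitPlane}) :
      Set (ℂ × ℂ × ℂ)) := homeoOn (fun w => ((1 - w.2 ^ 2) / w.1 ^ 2, w.1, w.2)) (fun w => w.2)
        (by
          rintro ⟨s, e⟩ ⟨hs, h1, h2⟩
          have h3 : ((1 - e ^ 2) / s ^ 2, s, e) ∈ Wd := by
            simp only [Wd, Set.mem_ofPred_eq] at hs ⊢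
            field_simp; ring
          exact ⟨⟨h3, by simpa using h1⟩, ⟨h3, by simpa [← sub_eq_add_neg] using h2⟩⟩)
        (by
          rintro ⟨t, s, e⟩ ⟨⟨h, h1⟩, ⟨_, h2⟩⟩
          simp only [Set.mem_ofPred_eq, one_mul, neg_mul, ← sub_eq_add_neg] at h1 h2
          refine ⟨?_, h1, h2⟩
          intro hs
          simp only [Wd, Set.mem_ofPred_eq] at h hs
          rw [hs] at h
          have h3 : (1 + e) * (1 - e) = 0 := by linear_combination -h
          exact mul_ne_zero (Complex.slitPlane_ne_zero h1) (Complex.slitPlane_ne_zero h2) h3)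
        (fun w hw => rfl)
        (by
          rintro ⟨t, s, e⟩ ⟨⟨h, h1⟩, ⟨_, h2⟩⟩
          simp only [Set.mem_ofPred_eq, one_mul, neg_mul, ← sub_eq_add_neg] at h1 h2
          have hs : s ≠ 0 := by
            intro hs
            simp only [Wd, Set.mem_ofPred_eq] at h hs
            rw [hs] at h
            have h3 : (1 + e) * (1 - e) = 0 := by linear_combination -h
            exact mul_ne_zero (Complex.slitPlane_ne_zero h1) (Complex.slitPlane_ne_zero h2) h3
          simp only [Wd, Set.mem_ofPred_eq] at h
          refine Prod.ext ?_ rfl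
          simp only []
          field_simp
          linear_combination -h)
        (by
          refine ContinuousOn.prodMk (ContinuousOn.div (by fun_prop) (by fun_prop) ?_) (by fun_prop)
          intro w hw
          exact pow_ne_zero 2 hw.1)
        (by fun_prop)
    exact (betti_Cx.prod_contractible (Y := Om2)).of_homeo ((Homeomorph.Set.prod Cx Om2).symm.trans e)
  refine (openCover_sets (W := Wd) {w | 1 + 1 * w.2.2 ∈ Complex.slitPlane} {w | 1 + (-1) * w.2.2 ∈ Complex.slitPlane}
    (Complex.isOpen_slitPlane.preimage (by fun_prop)) (Complex.isOpen_slitPlane.preimage (by fun_prop)) rfl rfl ?_ rfl).glue hD hA hB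
  intro w hw
  simp only [Set.mem_union, Set.mem_ofPred_eq, Complex.mem_slitPlane_iff]
  by_contra hcon
  push Not at hcon
  have h1 := hcon.1.1
  have h2 := hcon.2.1
  simp at h1 h2
  linarith

/-! #### the parabola -/

abbrev Om1 : Set ℂ := {u | 1 - u ∈ Complex.slitPlane}

lemma Om1_contr : ContractibleSpace Om1 := by
  have : StarConvex ℝ 0 Om1 := by
    rw [starConvex_zero_iff]
    intro x hx m h0 h1
    have e1 := slit_scale (u := x) 1 one_pos (by simpa using hx) h0 h1
    simp only [Complex.real_smul]
    simpa using e1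
  exact this.contractibleSpace ⟨0, by simp⟩

abbrev Th1 : Set (ℂ × ℂ) := {w | 1 - w.1 * w.2 ^ 2 ∈ Complex.slitPlane}

lemma Th1_contr : ContractibleSpace Th1 := by
  have : StarConvex ℝ 0 Th1 := by
    rw [starConvex_zero_iff]
    rintro ⟨x, y⟩ hx m h0 h1
    have e1 := slit_scale (u := x * y ^ 2) (m := m ^ 3) 1 one_pos (by simpa using hx) (by positivity) (pow_le_one₀ h0 h1)
    change 1 - (m • x) * (m • y) ^ 2 ∈ Complex.slitPlane
    simp only [Complex.real_smul]
    convert e1 using 1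
    push_cast; ring
  exact this.contractibleSpace ⟨0, by simp⟩

def Wp : Set (ℂ × ℂ × ℂ) := {w | w.1 * w.2.1 ^ 2 - 2 * w.2.1 + w.2.2 ^ 2 = 0}

noncomputable def csq (z : ℂ) : ℂ := z ^ (1 / 2 : ℂ)
lemma csq_sq (z : ℂ) : csq z ^ 2 = z := by
  unfold csq
  rw [one_div]
  exact Complex.cpow_nat_inv_pow _ (n := 2) (by norm_num)
lemma csq_cont : ContinuousOn csq Complex.slitPlane := by
  intro z hz
  exact (continuousAt_cpow_const hz).continuousWithinAt
lemma csq_re {z : ℂ} (hz : z ∈ Complex.slitPlane) : 0 < (csq z).re := by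
  have hz0 := Complex.slitPlane_ne_zero hz
  unfold csq
  rw [Complex.cpow_def_of_ne_zero hz0, Complex.exp_re]
  have him : (Complex.log z * (1 / 2)).im = z.arg / 2 := by
    rw [show (1 / 2 : ℂ) = ((1 / 2 : ℝ) : ℂ) by push_cast; ring, Complex.im_mul_ofReal, Complex.log_im]; ring
  rw [him]
  have h1 := Complex.neg_pi_lt_arg z
  have h2 := Complex.arg_le_pi z
  have h3 : z.arg ≠ Real.pi := (Complex.mem_slitPlane_iff_arg.1 hz).1
  have h4 : z.arg < Real.pi := lt_of_le_of_ne h2 h3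
  exact mul_pos (Real.exp_pos _) (Real.cos_pos_of_mem_Ioo ⟨by linarith, by linarith⟩)
lemma sq_mem_slit {y : ℂ} (hy : 0 < y.re) : y ^ 2 ∈ Complex.slitPlane := by
  rw [Complex.mem_slitPlane_iff, sq, Complex.mul_re, Complex.mul_im]
  by_cases h : y.im = 0
  · left; rw [h]; simp; positivity
  · right
    have : y.re * y.im ≠ 0 := mul_ne_zero hy.ne' h
    intro h2; apply this; linarith
lemma csq_unique {y z : ℂ} (hy : 0 < y.re) (h : y ^ 2 = z) : csq z = y := by
  have hz : z ∈ Complex.slitPlane := h ▸ sq_mem_slit hy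
  have h1 : csq z ^ 2 = y ^ 2 := by rw [csq_sq, h]
  rcases sq_eq_sq_iff_eq_or_eq_neg.1 h1 with h2 | h2
  · exact h2
  · have := csq_re hz
    rw [h2] at this; simp at this; linarith

abbrev Np : Set (ℂ × ℂ × ℂ) := Wp ∩ {w | 0 < (1 - w.1 * w.2.1).re}
abbrev Op : Set (ℂ × ℂ × ℂ) := Wp ∩ {w | w.2.1 ≠ 0}

lemma one_add_ne {y : ℂ} (hy : 0 < y.re) : 1 + y ≠ 0 := by
  intro h
  have := congrArg Complex.re h
  simp at this; linarith

lemma Wp_sq {t s e : ℂ} (h : t * s ^ 2 - 2 * s + e ^ 2 = 0) : (1 - t * s) ^ 2 = 1 - t * e ^ 2 := by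
  linear_combination t * h

noncomputable def npHomeo : Th1 ≃ₜ Np := homeoOn (fun w => (w.1, w.2 ^ 2 / (1 + csq (1 - w.1 * w.2 ^ 2)), w.2)) (fun w => (w.1, w.2.2))
  (by
    rintro ⟨t, e⟩ h
    simp only [Set.mem_ofPred_eq] at h
    have h1 := csq_re h
    have h2 := csq_sq (1 - t * e ^ 2)
    have h3 := one_add_ne h1
    simp only []
    set y := csq (1 - t * e ^ 2)
    refine ⟨?_, ?_⟩
    · simp only [Wp, Set.mem_ofPred_eq]
      field_simp
      linear_combination e ^ 2 * h2
    · have : 1 - t * (e ^ 2 / (1 + y)) = y := by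
        field_simp
        linear_combination -h2
      simp only [Set.mem_ofPred_eq]
      rw [this]; exact h1)
  (by
    rintro ⟨t, s, e⟩ ⟨h, h1⟩
    simp only [Set.mem_ofPred_eq, Wp] at h h1 ⊢
    rw [← Wp_sq h]
    exact sq_mem_slit h1)
  (fun w hw => rfl)
  (by
    rintro ⟨t, s, e⟩ ⟨h, h1⟩
    simp only [Set.mem_ofPred_eq, Wp] at h h1 ⊢
    rw [csq_unique h1 (Wp_sq h)]
    have h3 := one_add_ne h1
    refine Prod.ext rfl (Prod.ext ?_ rfl)
    simp only []
    rw [div_eq_iff h3]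
    linear_combination h)
  (by
    have hc : ContinuousOn (fun w : ℂ × ℂ => csq (1 - w.1 * w.2 ^ 2)) Th1 := csq_cont.comp (by fun_prop) (fun w hw => hw)
    refine ContinuousOn.prodMk (by fun_prop) (ContinuousOn.prodMk (ContinuousOn.div (by fun_prop) (continuousOn_const.add hc) ?_) (by fun_prop))
    intro w hw
    exact one_add_ne (csq_re hw))
  (by fun_prop)

noncomputable def opHomeo : (Cx ×ˢ Set.univ : Set (ℂ × ℂ)) ≃ₜ Op := homeoOn (fun w => ((2 * w.1 - w.2 ^ 2) / w.1 ^ 2, w.1, w.2)) (fun w => w.2)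
  (by
    rintro ⟨s, e⟩ ⟨h, -⟩
    simp only [Set.mem_ofPred_eq] at h
    refine ⟨?_, h⟩
    simp only [Wp, Set.mem_ofPred_eq]
    field_simp
    ring)
  (by
    rintro ⟨t, s, e⟩ ⟨h, h1⟩
    exact ⟨h1, trivial⟩)
  (fun w hw => rfl)
  (by
    rintro ⟨t, s, e⟩ ⟨h, h1⟩
    simp only [Set.mem_ofPred_eq, Wp] at h h1 ⊢
    refine Prod.ext ?_ rfl
    simp only []
    field_simp
    linear_combination -h)
  (by
    refine ContinuousOn.prodMk (ContinuousOn.div (by fun_prop) (by fun_prop) ?_) (by fun_prop)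
    intro w hw
    exact pow_ne_zero 2 hw.1)
  (by fun_prop)

noncomputable def dpHomeo : (Cx ×ˢ Om1 : Set (ℂ × ℂ)) ≃ₜ (Op ∩ Np : Set (ℂ × ℂ × ℂ)) :=
  homeoOn (fun w => (w.2 / w.1 ^ 2, w.1 ^ 2 / (1 + csq (1 - w.2)), w.1)) (fun w => (w.2.2, w.1 * w.2.2 ^ 2))
  (by
    rintro ⟨e, u⟩ ⟨h0, h⟩
    simp only [Set.mem_ofPred_eq] at h h0
    have h1 := csq_re h
    have h2 := csq_sq (1 - u)
    have h3 := one_add_ne h1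
    simp only []
    set y := csq (1 - u)
    have hW : (u / e ^ 2, e ^ 2 / (1 + y), e) ∈ Wp := by
      simp only [Wp, Set.mem_ofPred_eq]
      field_simp
      linear_combination e ^ 2 * h2
    refine ⟨⟨hW, div_ne_zero (pow_ne_zero 2 h0) h3⟩, hW, ?_⟩
    have : 1 - u / e ^ 2 * (e ^ 2 / (1 + y)) = y := by
      field_simp
      linear_combination -h2
    simp only [Set.mem_ofPred_eq]
    rw [this]; exact h1)
  (by
    rintro ⟨t, s, e⟩ ⟨⟨h, h0⟩, _, h1⟩
    simp only [Set.mem_ofPred_eq, Wp, Set.mem_prod] at h h1 h0 ⊢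
    refine ⟨?_, ?_⟩
    · intro he
      rw [he] at h
      have h2 : s * (1 + (1 - t * s)) = 0 := by linear_combination -h
      exact mul_ne_zero h0 (one_add_ne h1) h2
    · rw [← Wp_sq h]
      exact sq_mem_slit h1)
  (by
    rintro ⟨e, u⟩ ⟨h0, h⟩
    simp only [Set.mem_ofPred_eq] at h h0
    refine Prod.ext rfl ?_
    simp only []
    field_simp)
  (by
    rintro ⟨t, s, e⟩ ⟨⟨h, h0⟩, _, h1⟩
    simp only [Set.mem_ofPred_eq, Wp] at h h1 h0 ⊢
    have he : e ≠ 0 := by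
      intro he
      rw [he] at h
      have h2 : s * (1 + (1 - t * s)) = 0 := by linear_combination -h
      exact mul_ne_zero h0 (one_add_ne h1) h2
    rw [csq_unique h1 (Wp_sq h)]
    have h3 := one_add_ne h1
    refine Prod.ext ?_ (Prod.ext ?_ rfl)
    · simp only []
      field_simp
    · simp only []
      rw [div_eq_iff h3]
      linear_combination h)
  (by
    have hc : ContinuousOn (fun w : ℂ × ℂ => csq (1 - w.2)) (Cx ×ˢ Om1) := csq_cont.comp (by fun_prop) (fun w hw => hw.2)
    refine ContinuousOn.prodMk (ContinuousOn.div (by fun_prop) (by fun_prop) ?_)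
      (ContinuousOn.prodMk (ContinuousOn.div (by fun_prop) (continuousOn_const.add hc) ?_) (by fun_prop))
    · intro w hw
      exact pow_ne_zero 2 hw.1
    · intro w hw
      exact one_add_ne (csq_re hw.2))
  (by fun_prop)

lemma csq_one : csq 1 = 1 := csq_unique (by simp) (by simp)

lemma betti_Wp : Betti Wp 1 0 0 := by
  have := Th1_contr
  have := Om1_contr
  have : ContractibleSpace (Set.univ : Set ℂ) := convex_univ.contractibleSpace ⟨0, trivial⟩
  have hN : Betti Np 1 0 0 := (betti_contractible (X := Th1)).of_homeo npHomeo
  have hO : Betti Op 1 1 0 := (betti_Cx.prod_contractible (Y := (Set.univ : Set ℂ))).of_homeo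
    ((Homeomorph.Set.prod Cx Set.univ).symm.trans opHomeo)
  have hD : Betti (Op ∩ Np : Set (ℂ × ℂ × ℂ)) 1 1 0 := (betti_Cx.prod_contractible (Y := Om1)).of_homeo
    ((Homeomorph.Set.prod Cx Om1).symm.trans dpHomeo)
  have hcov := openCover_sets (W := Wp) {w | w.2.1 ≠ 0} {w | 0 < (1 - w.1 * w.2.1).re}
    (isOpen_ne_fun (by fun_prop) (by fun_prop)) (isOpen_lt (by fun_prop) (Complex.continuous_re.comp (by fun_prop))) rfl rfl
    (by
      intro w hw
      by_cases h : w.2.1 = 0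
      · right; simp [h]
      · left; exact h) rfl
  refine hcov.inj_glue hD hO hN ?_
  let c : C(Cx, (Op ∩ Np : Set (ℂ × ℂ × ℂ))) := ⟨fun e => dpHomeo ⟨(e.1, 0), e.2, by simp⟩,
    dpHomeo.continuous.comp (by fun_prop)⟩
  let p : C(Op, Cx) := ⟨fun w => ⟨2 * w.1.2.1, mul_ne_zero two_ne_zero w.2.2⟩, by fun_prop⟩
  let i : C((Op ∩ Np : Set (ℂ × ℂ × ℂ)), Op) := ⟨Set.inclusion Set.inter_subset_left, continuous_inclusion _⟩
  change Function.Injective (hm i 1)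
  have hcomp : p.comp (i.comp c) = sqCx := by
    ext e
    change 2 * (e.1 ^ 2 / (1 + csq (1 - 0))) = e.1 ^ 2
    rw [sub_zero, csq_one]
    ring
  have hinj : Function.Injective (hm p 1 ∘ₗ (hm i 1 ∘ₗ hm c 1)) := by
    rw [← hm_comp, ← hm_comp, hcomp]; exact hm_sq_injective
  have hcinj : Function.Injective (hm c 1) := by
    intro x y hxy
    apply hinj
    simp [hxy]
  have := betti_Cx.fin 1
  have := hD.fin 1
  have hcs := (LinearMap.injective_iff_surjective_of_finrank_eq_finrank (f := hm c 1) (by rw [betti_Cx.b1, hD.b1])).1 hcinj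
  intro x y hxy
  obtain ⟨x, rfl⟩ := hcs x
  obtain ⟨y, rfl⟩ := hcs y
  congr 1
  apply hinj
  simp [hxy]

end CubicHom

open MvPolynomial CategoryTheory

namespace CubicHom
open Topology Module

variable {α β : ℂ} {c : Polynomial ℂ} {V : Set ℂ}

lemma betti_double (hV : Convex ℝ V) (hVo : IsOpen V) (h0 : (0:ℂ) ∈ V) (ρ g : ℂ → ℂ) (hρ : ContinuousOn ρ V)
    (hρ0 : ∀ t ∈ V, ρ t ≠ 0) (hg : ∀ t ∈ V, ρ t ^ 2 = g t) : Betti (Md 0 g V) 1 0 1 := by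
  let Q : ℂ × ℂ × ℂ → Prop := fun w => w.1 * w.2.1 ^ 2 + w.2.2 ^ 2 = 1
  have hU : Betti (SQ Q Set.univ) 1 0 1 := by
    have : SQ Q Set.univ = Wd := by
      ext w
      simp [SQ, Wd, Q]
    rw [this]; exact betti_Wd
  have hB : Betti (SQ Q V) 1 0 1 := by
    refine betti_scale Q (fun p => ((p.1 ^ 2 : ℝ) • p.2.1, p.2.2.1 / (p.1 : ℂ), p.2.2.2)) ?_ ?_ ?_ ?_ hV hVo h0 hU
    · refine ContinuousOn.prodMk (by fun_prop) (ContinuousOn.prodMk (ContinuousOn.div (by fun_prop) (by fun_prop) ?_) (by fun_prop))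
      rintro p hp
      exact_mod_cast ne_of_gt hp
    · intro w; simp
    · intro m w; rfl
    · intro m w hm hw
      have hm' : (m : ℂ) ≠ 0 := by exact_mod_cast hm.ne'
      simp only [Q, Complex.real_smul] at hw ⊢
      rw [← hw]; push_cast
      field_simp
  refine hB.of_homeo (homeoOn (fun w => (w.1, w.2.1 * ρ w.1, w.2.2 * ρ w.1)) (fun w => (w.1, w.2.1 / ρ w.1, w.2.2 / ρ w.1)) ?_ ?_ ?_ ?_ ?_ ?_)
  · rintro ⟨t, s, e⟩ ⟨ht, h⟩
    refine ⟨ht, ?_⟩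
    simp only [Q] at h ⊢
    rw [← hg t ht]
    linear_combination ρ t ^ 2 * h
  · rintro ⟨t, s, e⟩ ⟨ht, h⟩
    refine ⟨ht, ?_⟩
    have := hρ0 t ht
    simp only [Q] at h ⊢
    rw [← hg t ht] at h
    field_simp
    linear_combination h
  · rintro ⟨t, s, e⟩ ⟨ht, h⟩
    have := hρ0 t ht
    simp only [Prod.mk.injEq, true_and]
    constructor <;> field_simp
  · rintro ⟨t, s, e⟩ ⟨ht, h⟩
    have := hρ0 t ht
    simp only [Prod.mk.injEq, true_and]
    constructor <;> field_simp
  · have hc : ContinuousOn (fun w : ℂ × ℂ × ℂ => ρ w.1) (SQ Q V) := hρ.comp (by fun_prop) (fun w hw => hw.1)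
    exact ContinuousOn.prodMk (by fun_prop) (ContinuousOn.prodMk (ContinuousOn.mul (by fun_prop) hc) (ContinuousOn.mul (by fun_prop) hc))
  · have hc : ContinuousOn (fun w : ℂ × ℂ × ℂ => ρ w.1) (Md 0 g V) := hρ.comp (by fun_prop) (fun w hw => hw.1)
    have hn : ∀ w ∈ Md 0 g V, ρ w.1 ≠ 0 := fun w hw => hρ0 _ hw.1
    exact ContinuousOn.prodMk (by fun_prop) (ContinuousOn.prodMk (ContinuousOn.div (by fun_prop) hc hn) (ContinuousOn.div (by fun_prop) hc hn))

lemma betti_parab (hV : Convex ℝ V) (hVo : IsOpen V) (h0 : (0:ℂ) ∈ V) (hα : α ≠ 0) (γ δ g : ℂ → ℂ) (hγ : ContinuousOn γ V)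
    (hδ : ContinuousOn δ V) (hγ0 : ∀ t ∈ V, γ t ≠ 0) (hγδ : ∀ t ∈ V, γ t = 1 - t * δ t)
    (hg : ∀ t ∈ V, g t = - (α ^ 2 / 4) * δ t * (1 + γ t)) : Betti (Md α g V) 1 0 0 := by
  let Q : ℂ × ℂ × ℂ → Prop := fun w => w.1 * w.2.1 ^ 2 - 2 * w.2.1 + w.2.2 ^ 2 = 0
  have hU : Betti (SQ Q Set.univ) 1 0 0 := by
    have : SQ Q Set.univ = Wp := by
      ext w
      simp [SQ, Wp, Q]
    rw [this]; exact betti_Wp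
  have hB : Betti (SQ Q V) 1 0 0 := by
    refine betti_scale Q (fun p => ((p.1 ^ 2 : ℝ) • p.2.1, p.2.2.1 / (p.1 : ℂ) ^ 2, p.2.2.2 / (p.1 : ℂ))) ?_ ?_ ?_ ?_ hV hVo h0 hU
    · refine ContinuousOn.prodMk (by fun_prop) (ContinuousOn.prodMk (ContinuousOn.div (by fun_prop) (by fun_prop) ?_)
        (ContinuousOn.div (by fun_prop) (by fun_prop) ?_))
      · rintro p hp
        exact pow_ne_zero 2 (by exact_mod_cast ne_of_gt hp)
      · rintro p hp
        exact_mod_cast ne_of_gt hp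
    · intro w; simp
    · intro m w; rfl
    · intro m w hm hw
      have hm' : (m : ℂ) ≠ 0 := by exact_mod_cast hm.ne'
      simp only [Q, Complex.real_smul] at hw ⊢
      push_cast
      have e : (m:ℂ) ^ 2 * w.1 * (w.2.1 / (m:ℂ) ^ 2) ^ 2 - 2 * (w.2.1 / (m:ℂ) ^ 2) + (w.2.2 / (m:ℂ)) ^ 2 =
        (w.1 * w.2.1 ^ 2 - 2 * w.2.1 + w.2.2 ^ 2) / (m:ℂ) ^ 2 := by field_simp
      rw [e, hw, zero_div]
  refine hB.of_homeo (homeoOn (fun w => (w.1, α / 2 * (δ w.1 + γ w.1 * w.2.1), α / 2 * (γ w.1 * w.2.2)))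
    (fun w => (w.1, (w.2.1 * 2 / α - δ w.1) / γ w.1, w.2.2 * 2 / α / γ w.1)) ?_ ?_ ?_ ?_ ?_ ?_)
  · rintro ⟨t, s, e⟩ ⟨ht, h⟩
    refine ⟨ht, ?_⟩
    simp only [Q] at h ⊢
    rw [hg t ht]
    linear_combination (α ^ 2 / 4) * γ t ^ 2 * h + (α ^ 2 / 4) * (δ t + 2 * γ t * s) * hγδ t ht
  · rintro ⟨t, s, e⟩ ⟨ht, h⟩
    refine ⟨ht, ?_⟩
    have h1 := hγ0 t ht
    have h2 := hγδ t ht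
    simp only [Q] at h ⊢
    rw [hg t ht] at h
    have hs : s = α / 2 * (δ t + γ t * ((s * 2 / α - δ t) / γ t)) := by field_simp; ring
    have he : e = α / 2 * (γ t * (e * 2 / α / γ t)) := by field_simp
    set s' := (s * 2 / α - δ t) / γ t
    set e' := e * 2 / α / γ t
    rw [hs, he] at h
    have h3 : (α ^ 2 / 4 * γ t ^ 2) * (t * s' ^ 2 - 2 * s' + e' ^ 2) = 0 := by
      linear_combination h - (α ^ 2 / 4) * (δ t + 2 * γ t * s') * h2
    exact (mul_eq_zero.1 h3).resolve_left (mul_ne_zero (div_ne_zero (pow_ne_zero 2 hα) (by norm_num : (4:ℂ) ≠ 0)) (pow_ne_zero 2 h1))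
  · rintro ⟨t, s, e⟩ ⟨ht, h⟩
    have := hγ0 t ht
    simp only [Prod.mk.injEq, true_and]
    constructor
    · field_simp; ring
    · field_simp
  · rintro ⟨t, s, e⟩ ⟨ht, h⟩
    have := hγ0 t ht
    simp only [Prod.mk.injEq, true_and]
    constructor
    · field_simp; ring
    · field_simp
  · have hc : ContinuousOn (fun w : ℂ × ℂ × ℂ => γ w.1) (SQ Q V) := hγ.comp (by fun_prop) (fun w hw => hw.1)
    have hd : ContinuousOn (fun w : ℂ × ℂ × ℂ => δ w.1) (SQ Q V) := hδ.comp (by fun_prop) (fun w hw => hw.1)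
    exact ContinuousOn.prodMk (by fun_prop) (ContinuousOn.prodMk
      (continuousOn_const.mul (hd.add (hc.mul (by fun_prop))))
      (continuousOn_const.mul (hc.mul (by fun_prop))))
  · have hc : ContinuousOn (fun w : ℂ × ℂ × ℂ => γ w.1) (Md α g V) := hγ.comp (by fun_prop) (fun w hw => hw.1)
    have hd : ContinuousOn (fun w : ℂ × ℂ × ℂ => δ w.1) (Md α g V) := hδ.comp (by fun_prop) (fun w hw => hw.1)
    have hn : ∀ w ∈ Md α g V, γ w.1 ≠ 0 := fun w hw => hγ0 _ hw.1
    refine ContinuousOn.prodMk (by fun_prop) (ContinuousOn.prodMk (ContinuousOn.div (ContinuousOn.sub (by fun_prop) hd) hc hn)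
      (ContinuousOn.div (by fun_prop) hc hn))

/-- square root of `P/(4(4-t))` -/
lemma exists_sqrt_quot (hV : Convex ℝ V) (h4 : (4:ℂ) ∉ V) (P : Polynomial ℂ) (hP : ∀ t ∈ V, P.eval t ≠ 0) :
    ∃ r : ℂ → ℂ, DifferentiableOn ℂ r V ∧ (∀ t ∈ V, r t ≠ 0) ∧ ∀ t ∈ V, r t ^ 2 = P.eval t / (4 * (4 - t)) := by
  obtain ⟨r, hr, hr2⟩ := exists_sqrt_poly hV P hP
  obtain ⟨q, hq, hq2⟩ := exists_sqrt_poly hV (4 * (4 - Polynomial.X)) (fun t ht => by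
    simpa using four_sub_ne h4 ht)
  replace hq2 : ∀ t ∈ V, q t ^ 2 = 4 * (4 - t) := fun t ht => by simpa using hq2 t ht
  have hq0 : ∀ t ∈ V, q t ≠ 0 := fun t ht h => four_sub_ne h4 ht (by
    have := hq2 t ht
    rw [h] at this
    simpa using this.symm)
  have hr0 : ∀ t ∈ V, r t ≠ 0 := fun t ht h => hP t ht (by rw [← hr2 t ht, h]; simp)
  refine ⟨fun t => r t / q t, hr.div hq hq0, fun t ht => div_ne_zero (hr0 t ht) (hq0 t ht), fun t ht => ?_⟩
  rw [div_pow, hr2 t ht, hq2 t ht]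

lemma local_L3 (hV : Convex ℝ V) (hVo : IsOpen V) (h4 : (4:ℂ) ∉ V) (h0 : (0:ℂ) ∈ V) (hP0 : (PP α β c).eval 0 = 0)
    (hd : (PP α β c).derivative.eval 0 ≠ 0)
    (hP : ∀ t ∈ V, (PP α β c).eval t = 0 → t = 0) : Betti (Sx α β c V) 1 0 1 := by
  have hα : α = 0 := by
    rw [PP_eval] at hP0; simpa using hP0
  subst hα
  obtain ⟨e1⟩ := exists_sx_md 0 β c hV h4
  refine Betti.of_homeo ?_ e1
  have hfac : PP 0 β c = Polynomial.X * (16 * c * (4 - Polynomial.X) + Polynomial.C (β ^ 2)) := by simp [PP]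
  obtain ⟨ρ, hρ, hρ0, hρ2⟩ := exists_sqrt_quot hV h4 (16 * c * (4 - Polynomial.X) + Polynomial.C (β ^ 2)) (by
    intro t ht hq
    have : t = 0 := hP t ht (by rw [hfac, Polynomial.eval_mul, hq, mul_zero])
    subst this
    apply hd
    rw [hfac, Polynomial.derivative_mul, Polynomial.eval_add, Polynomial.eval_mul, hq]
    simp)
  refine betti_double hV hVo h0 ρ _ hρ.continuousOn hρ0 (fun t ht => ?_)
  have := four_sub_ne h4 ht
  rw [hρ2 t ht, gg]
  simp
  field_simp
  ring

lemma local_L2 (hV : Convex ℝ V) (hVo : IsOpen V) (h4 : (4:ℂ) ∉ V) (h0 : (0:ℂ) ∈ V)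
    (hP : ∀ t ∈ V, (PP α β c).eval t ≠ 0) : Betti (Sx α β c V) 1 0 0 := by
  have hα : α ≠ 0 := by
    rintro rfl
    exact hP 0 h0 (by rw [PP_eval]; simp)
  obtain ⟨e1⟩ := exists_sx_md α β c hV h4
  refine Betti.of_homeo ?_ e1
  obtain ⟨r, hr, hr0, hr2⟩ := exists_sqrt_quot hV h4 (PP α β c) hP
  have hnh : V ∈ 𝓝 (0:ℂ) := hVo.mem_nhds h0
  let γ : ℂ → ℂ := fun t => r t / r 0
  have hγd : DifferentiableOn ℂ γ V := hr.div_const _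
  have hr00 : r 0 ^ 2 = α ^ 2 / 4 := by
    rw [hr2 0 h0, PP_eval]; norm_num; ring
  have hδ : ContinuousOn (fun t => - dslope γ 0 t) V := by
    refine ContinuousOn.neg ?_
    rw [continuousOn_dslope hnh]
    exact ⟨hγd.continuousOn, hγd.differentiableAt hnh⟩
  have hγδ : ∀ t ∈ V, γ t = 1 - t * (- dslope γ 0 t) := by
    intro t ht
    have := sub_smul_dslope γ 0 t
    rw [sub_zero, smul_eq_mul] at this
    have h1 : γ 0 = 1 := div_self (hr0 0 h0)
    rw [h1] at this
    linear_combination -this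
  refine betti_parab hV hVo h0 hα γ (fun t => - dslope γ 0 t) _ hγd.continuousOn hδ (fun t ht => div_ne_zero (hr0 t ht) (hr0 0 h0)) hγδ ?_
  have hne : ∀ t ∈ V, t ≠ 0 → gg β c t = - (α ^ 2 / 4) * (- dslope γ 0 t) * (1 + γ t) := by
    intro t ht ht0
    apply mul_left_cancel₀ ht0
    have h1 := gg_PP α β c (four_sub_ne h4 ht)
    have h2 : γ t ^ 2 = (PP α β c).eval t / (4 * (4 - t)) / (α ^ 2 / 4) := by
      simp only [γ]
      rw [div_pow, hr2 t ht, hr00]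
    have h3 : (PP α β c).eval t / (4 * (4 - t)) = γ t ^ 2 * (α ^ 2 / 4) := by
      rw [h2]; field_simp
    rw [h3] at h1
    linear_combination h1 + (α ^ 2 / 4) * (1 + γ t) * hγδ t ht
  intro t ht
  by_cases ht0 : t = 0
  · subst ht0
    have l1 : Filter.Tendsto (gg β c) (𝓝[≠] 0) (𝓝 (gg β c 0)) :=
      ((gg_cont β c h4).continuousAt hnh).tendsto.mono_left nhdsWithin_le_nhds
    have l2 : Filter.Tendsto (fun t => - (α ^ 2 / 4) * (- dslope γ 0 t) * (1 + γ t)) (𝓝[≠] 0)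
        (𝓝 (- (α ^ 2 / 4) * (- dslope γ 0 0) * (1 + γ 0))) := by
      refine Filter.Tendsto.mono_left ?_ nhdsWithin_le_nhds
      refine ContinuousAt.tendsto (f := fun t => - (α ^ 2 / 4) * (- dslope γ 0 t) * (1 + γ t)) ?_
      exact (continuousAt_const.mul (hδ.continuousAt hnh)).mul (continuousAt_const.add (hγd.continuousOn.continuousAt hnh))
    refine tendsto_nhds_unique (l1.congr' ?_) l2
    filter_upwards [self_mem_nhdsWithin, mem_nhdsWithin_of_mem_nhds hnh] with t h1 h2
    exact hne t h2 h1
  · exact hne t ht ht0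

end CubicHom

open MvPolynomial CategoryTheory
/-! ### Assembling the pieces -/

namespace CubicHom
open Topology Module

variable {α β : ℂ} {c : Polynomial ℂ} {V : Set ℂ}

/-- the symmetry exchanging the two degenerate fibres -/
noncomputable def sxSymm (α β : ℂ) (c : Polynomial ℂ) (V : Set ℂ) :
    Sx β α (c.comp (4 - Polynomial.X)) ((fun t => 4 - t) ⁻¹' V) ≃ₜ Sx α β c V :=
  homeoOn (fun w => (4 - w.1, w.2.2, w.2.1)) (fun w => (4 - w.1, w.2.2, w.2.1))
    (by
      rintro ⟨t, s, d⟩ ⟨ht, h⟩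
      refine ⟨ht, ?_⟩
      simp [Polynomial.eval_comp] at h ⊢
      linear_combination h)
    (by
      rintro ⟨t, s, d⟩ ⟨ht, h⟩
      refine ⟨by simpa using ht, ?_⟩
      simp [Polynomial.eval_comp] at h ⊢
      linear_combination h)
    (by rintro ⟨t, s, d⟩ _; simp)
    (by rintro ⟨t, s, d⟩ _; simp)
    (by fun_prop) (by fun_prop)

lemma PP_symm (α β : ℂ) (c : Polynomial ℂ) :
    PP β α (c.comp (4 - Polynomial.X)) = (PP α β c).comp (4 - Polynomial.X) := by
  simp only [PP, Polynomial.mul_comp, Polynomial.add_comp, Polynomial.sub_comp, Polynomial.X_comp, Polynomial.C_comp,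
    Polynomial.ofNat_comp]
  ring

lemma PP_symm_eval (α β : ℂ) (c : Polynomial ℂ) (t : ℂ) :
    (PP β α (c.comp (4 - Polynomial.X))).eval t = (PP α β c).eval (4 - t) := by
  rw [PP_symm, Polynomial.eval_comp]; simp

lemma PP_symm_deriv (α β : ℂ) (c : Polynomial ℂ) (t : ℂ) :
    (PP β α (c.comp (4 - Polynomial.X))).derivative.eval t = - (PP α β c).derivative.eval (4 - t) := by
  rw [PP_symm, Polynomial.derivative_comp]
  simp [Polynomial.eval_comp, Polynomial.derivative_ofNat]

lemma convex_flip (hV : Convex ℝ V) : Convex ℝ ((fun t : ℂ => 4 - t) ⁻¹' V) := by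
  intro x hx y hy a b ha hb hab
  have := hV hx hy ha hb hab
  simp only [Set.mem_preimage, Complex.real_smul] at this ⊢
  convert this using 1
  have h : (a : ℂ) + b = 1 := by exact_mod_cast hab
  linear_combination (-4 : ℂ) * h

lemma isOpen_flip (hV : IsOpen V) : IsOpen ((fun t : ℂ => 4 - t) ⁻¹' V) := hV.preimage (by fun_prop)

lemma local_L3' (hV : Convex ℝ V) (hVo : IsOpen V) (h4 : (0:ℂ) ∉ V) (h0 : (4:ℂ) ∈ V) (hP0 : (PP α β c).eval 4 = 0)
    (hd : (PP α β c).derivative.eval 4 ≠ 0)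
    (hP : ∀ t ∈ V, (PP α β c).eval t = 0 → t = 4) : Betti (Sx α β c V) 1 0 1 := by
  refine Betti.of_homeo ?_ (sxSymm α β c V)
  refine local_L3 (convex_flip hV) (isOpen_flip hVo) (by simpa using h4) (by simpa using h0)
    (by rw [PP_symm_eval]; simpa using hP0) (by rw [PP_symm_deriv]; simpa using hd) ?_
  intro t ht h
  rw [PP_symm_eval] at h
  have := hP _ ht h
  linear_combination -this

lemma local_L2' (hV : Convex ℝ V) (hVo : IsOpen V) (h4 : (0:ℂ) ∉ V) (h0 : (4:ℂ) ∈ V)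
    (hP : ∀ t ∈ V, (PP α β c).eval t ≠ 0) : Betti (Sx α β c V) 1 0 0 := by
  refine Betti.of_homeo ?_ (sxSymm α β c V)
  refine local_L2 (convex_flip hV) (isOpen_flip hVo) (by simpa using h4) (by simpa using h0) ?_
  intro t ht
  rw [PP_symm_eval]
  exact hP _ ht

/-- special points with multiplicity -/
noncomputable def MM (α β : ℂ) (c : Polynomial ℂ) : Multiset ℂ := 0 ::ₘ 4 ::ₘ (PP α β c).roots

open Classical in
noncomputable def nn (α β : ℂ) (c : Polynomial ℂ) (V : Set ℂ) : ℕ := (MM α β c).countP (· ∈ V)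

open Classical in
noncomputable def ss (α β : ℂ) (c : Polynomial ℂ) (V : Set ℂ) : Finset ℂ := (MM α β c).toFinset.filter (· ∈ V)

lemma mem_MM (hP : PP α β c ≠ 0) {t : ℂ} : t ∈ MM α β c ↔ t = 0 ∨ t = 4 ∨ (PP α β c).eval t = 0 := by
  simp [MM, hP]

lemma mem_ss {t : ℂ} : t ∈ ss α β c V ↔ t ∈ MM α β c ∧ t ∈ V := by
  simp [ss]

lemma nn_single (hP : PP α β c ≠ 0) (hs : ∀ a, (PP α β c).eval a = 0 → (PP α β c).derivative.eval a ≠ 0) {a : ℂ}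
    (h : ∀ t, t ∈ ss α β c V ↔ t = a) :
    nn α β c V = (if a = 0 ∨ a = 4 then 1 else 0) + (if (PP α β c).eval a = 0 then 1 else 0) := by
  classical
  have h1 : nn α β c V = (MM α β c).count a := by
    unfold nn Multiset.count
    apply Multiset.countP_congr rfl
    intro x hx
    have := h x
    rw [mem_ss] at this
    simp only [hx, true_and] at this
    rw [this]; exact propext eq_comm
  have hr : (PP α β c).roots.count a = (if (PP α β c).eval a = 0 then 1 else 0) := by
    split_ifs with h0
    · rw [Polynomial.count_roots]
      have h2 : ¬ 1 < (PP α β c).rootMultiplicity a := by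
        rw [Polynomial.one_lt_rootMultiplicity_iff_isRoot hP]
        rintro ⟨_, h3⟩
        exact hs a h0 h3
      have h3 : 0 < (PP α β c).rootMultiplicity a := (Polynomial.rootMultiplicity_pos hP).2 h0
      omega
    · rw [Multiset.count_eq_zero, Polynomial.mem_roots hP]
      exact h0
  rw [h1, MM, Multiset.count_cons, Multiset.count_cons, hr]
  by_cases h0 : a = 0
  · have : (0:ℂ) ≠ 4 := by norm_num
    simp [h0, this]; omega
  · by_cases h4 : a = 4
    · simp [h4]; omega
    · simp [h0, h4]

lemma nn_add {V₁ V₂ : Set ℂ} (h1 : ∀ t ∈ MM α β c, (t ∈ V ↔ t ∈ V₁ ∨ t ∈ V₂))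
    (h2 : ∀ t ∈ MM α β c, t ∈ V₁ → t ∉ V₂) : nn α β c V = nn α β c V₁ + nn α β c V₂ := by
  classical
  classical
  unfold nn
  generalize MM α β c = M at h1 h2
  induction M using Multiset.induction_on with
  | empty => simp
  | cons a M ih =>
    have ih' := ih (fun t ht => h1 t (Multiset.mem_cons_of_mem ht)) (fun t ht => h2 t (Multiset.mem_cons_of_mem ht))
    have e1 := h1 a (Multiset.mem_cons_self a M)
    have e2 := h2 a (Multiset.mem_cons_self a M)
    rw [Multiset.countP_cons, Multiset.countP_cons, Multiset.countP_cons, ih']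
    by_cases m1 : a ∈ V₁
    · have m2 := e2 m1
      have m : a ∈ V := e1.2 (Or.inl m1)
      simp [m, m1, m2]; omega
    · by_cases m2 : a ∈ V₂
      · have m : a ∈ V := e1.2 (Or.inr m2)
        simp [m, m1, m2]; omega
      · have m : a ∉ V := fun h => by
          rcases e1.1 h with h | h
          exacts [m1 h, m2 h]
        simp [m, m1, m2]

lemma base_zero (hP : PP α β c ≠ 0) (hV : Convex ℝ V) (hne : V.Nonempty) (h : ss α β c V = ∅) : Betti (Sx α β c V) 1 1 0 := by
  have key : ∀ t ∈ V, ¬ (t = 0 ∨ t = 4 ∨ (PP α β c).eval t = 0) := by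
    intro t ht hcon
    have : t ∈ ss α β c V := mem_ss.2 ⟨(mem_MM hP).2 hcon, ht⟩
    rw [h] at this
    simp at this
  exact local_L0 hV hne (fun h => key 4 h (by simp)) (fun h => key 0 h (by simp)) (fun t ht h => key t ht (by simp [h]))

lemma base_one (hP : PP α β c ≠ 0) (hs : ∀ a, (PP α β c).eval a = 0 → (PP α β c).derivative.eval a ≠ 0)
    (hV : Convex ℝ V) (hVo : IsOpen V) {a : ℂ}
    (h : ∀ t, t ∈ ss α β c V ↔ t = a) : ∃ b, nn α β c V = b + 1 ∧ Betti (Sx α β c V) 1 0 b := by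
  have hn := nn_single hP hs h
  have key : ∀ t ∈ V, (t = 0 ∨ t = 4 ∨ (PP α β c).eval t = 0) → t = a := by
    intro t ht hcon
    exact (h t).1 (mem_ss.2 ⟨(mem_MM hP).2 hcon, ht⟩)
  have ha := (h a).2 rfl
  rw [mem_ss, mem_MM hP] at ha
  obtain ⟨ha, haV⟩ := ha
  have h04 : (0:ℂ) ≠ 4 := by norm_num
  by_cases h0 : a = 0
  · subst h0
    have h4 : (4:ℂ) ∉ V := fun h => h04.symm (key 4 h (by simp))
    by_cases hp : (PP α β c).eval 0 = 0
    · exact ⟨1, by simpa [hp] using hn, local_L3 hV hVo h4 haV hp (hs 0 hp) (fun t ht h => key t ht (by simp [h]))⟩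
    · refine ⟨0, by simpa [hp] using hn, local_L2 hV hVo h4 haV (fun t ht h => hp ?_)⟩
      have e := key t ht (by simp [h]); rw [e] at h; exact h
  have h0V : (0:ℂ) ∉ V := fun h => h0 (key 0 h (by simp)).symm
  by_cases h4 : a = 4
  · subst h4
    by_cases hp : (PP α β c).eval 4 = 0
    · exact ⟨1, by simpa [hp] using hn, local_L3' hV hVo h0V haV hp (hs 4 hp) (fun t ht h => key t ht (by simp [h]))⟩
    · refine ⟨0, by simpa [hp] using hn, local_L2' hV hVo h0V haV (fun t ht h => hp ?_)⟩
      have e := key t ht (by simp [h]); rw [e] at h; exact h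
  have h4V : (4:ℂ) ∉ V := fun h => h4 (key 4 h (by simp)).symm
  have hp : (PP α β c).eval a = 0 := by tauto
  exact ⟨0, by simpa [hp, h0, h4] using hn, local_L1 hV h4V h0V haV hp (hs a hp) (fun t ht h => key t ht (by simp [h]))⟩

lemma Sx_inter (V₁ : Set ℂ) : Sx α β c (V ∩ V₁) = Sx α β c V ∩ (Prod.fst ⁻¹' V₁) := by
  ext w
  simp only [Sx, Set.mem_ofPred_eq, Set.mem_inter_iff, Set.mem_preimage]
  tauto

theorem main_ind (hP : PP α β c ≠ 0) (hs : ∀ a, (PP α β c).eval a = 0 → (PP α β c).derivative.eval a ≠ 0) (N : ℕ) :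
    ∀ V : Set ℂ, Convex ℝ V → IsOpen V → (ss α β c V).card = N + 1 →
      ∃ b, nn α β c V = b + 1 ∧ Betti (Sx α β c V) 1 0 b := by
  induction N using Nat.strong_induction_on with
  | _ N ih =>
  intro V hV hVo hcard
  rcases Nat.eq_zero_or_pos N with rfl | hN
  · obtain ⟨a, ha⟩ := Finset.card_eq_one.1 hcard
    exact base_one hP hs hV hVo (a := a) (fun t => by rw [ha]; simp)
  obtain ⟨a, ha, b, hb, hab⟩ := Finset.one_lt_card.1 (show 1 < (ss α β c V).card by omega)
  obtain ⟨ℓ, a, b, ha, hb, hlt⟩ : ∃ (ℓ : ℂ →L[ℝ] ℝ) (a b : ℂ), a ∈ ss α β c V ∧ b ∈ ss α β c V ∧ ℓ a < ℓ b := by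
    by_cases hre : a.re = b.re
    · have him : a.im ≠ b.im := fun h => hab (Complex.ext hre h)
      rcases lt_or_gt_of_ne him with h | h
      · exact ⟨Complex.imCLM, a, b, ha, hb, h⟩
      · exact ⟨Complex.imCLM, b, a, hb, ha, h⟩
    · rcases lt_or_gt_of_ne hre with h | h
      · exact ⟨Complex.reCLM, a, b, ha, hb, h⟩
      · exact ⟨Complex.reCLM, b, a, hb, ha, h⟩
  classical
  obtain ⟨x, ε, hε, hx⟩ : ∃ x ε : ℝ, 0 < ε ∧ ∀ y, x - ε ≤ y → y ≤ x + ε → (ℓ a < y ∧ y < ℓ b ∧ ∀ t ∈ ss α β c V, ℓ t ≠ y) := by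
    let T : Finset ℝ := (ss α β c V).image ℓ
    have hop : IsOpen (Set.Ioo (ℓ a) (ℓ b) \ (T : Set ℝ)) := isOpen_Ioo.sdiff T.finite_toSet.isClosed
    have hinf : (Set.Ioo (ℓ a) (ℓ b) \ (T : Set ℝ)).Infinite := (Set.Ioo_infinite hlt).diff T.finite_toSet
    obtain ⟨x, hx⟩ := hinf.nonempty
    obtain ⟨ε, hε, hball⟩ := Metric.nhds_basis_closedBall.mem_iff.1 (hop.mem_nhds hx)
    refine ⟨x, ε, hε, fun y h1 h2 => ?_⟩
    have := hball (show y ∈ Metric.closedBall x ε by rw [Real.closedBall_eq_Icc]; exact ⟨h1, h2⟩)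
    refine ⟨this.1.1, this.1.2, fun t ht h => this.2 ?_⟩
    simp only [T, Finset.coe_image]
    exact ⟨t, ht, h⟩
  have hℓ : Continuous ℓ := ℓ.continuous
  let O₁ : Set ℂ := {t | ℓ t < x + ε}
  let O₂ : Set ℂ := {t | x - ε < ℓ t}
  have hO1 : IsOpen O₁ := isOpen_lt hℓ continuous_const
  have hO2 : IsOpen O₂ := isOpen_lt continuous_const hℓ
  have hC1 : Convex ℝ O₁ := convex_halfSpace_lt ℓ.isBoundedLinearMap.toIsLinearMap _
  have hC2 : Convex ℝ O₂ := convex_halfSpace_gt ℓ.isBoundedLinearMap.toIsLinearMap _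
  have hV1 : Convex ℝ (V ∩ O₁) := hV.inter hC1
  have hV2 : Convex ℝ (V ∩ O₂) := hV.inter hC2
  have haV := (mem_ss.1 ha).2
  have hbV := (mem_ss.1 hb).2
  have hx0 := hx x (by linarith) (by linarith)
  have hxm := hx (x - ε) (by linarith) (by linarith)
  have hxp := hx (x + ε) (by linarith) (by linarith)
  have ha1 : a ∈ ss α β c (V ∩ O₁) := mem_ss.2 ⟨(mem_ss.1 ha).1, haV, by simp only [O₁, Set.mem_ofPred_eq]; linarith [hx0.1]⟩
  have hb2 : b ∈ ss α β c (V ∩ O₂) := mem_ss.2 ⟨(mem_ss.1 hb).1, hbV, by simp only [O₂, Set.mem_ofPred_eq]; linarith [hx0.2.1]⟩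
  have hb1 : b ∉ ss α β c (V ∩ O₁) := fun h => by
    have := (mem_ss.1 h).2.2
    simp only [O₁, Set.mem_ofPred_eq] at this
    linarith [hxp.2.1]
  have ha2 : a ∉ ss α β c (V ∩ O₂) := fun h => by
    have := (mem_ss.1 h).2.2
    simp only [O₂, Set.mem_ofPred_eq] at this
    linarith [hxm.1]
  have hss : ∀ O, ss α β c (V ∩ O) ⊆ ss α β c V := fun O t ht => by
    rw [mem_ss] at ht ⊢
    exact ⟨ht.1, ht.2.1⟩
  have hc1 : (ss α β c (V ∩ O₁)).card < (ss α β c V).card :=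
    Finset.card_lt_card ⟨hss _, fun h => hb1 (h hb)⟩
  have hc2 : (ss α β c (V ∩ O₂)).card < (ss α β c V).card :=
    Finset.card_lt_card ⟨hss _, fun h => ha2 (h ha)⟩
  have hp1 : 0 < (ss α β c (V ∩ O₁)).card := Finset.card_pos.2 ⟨a, ha1⟩
  have hp2 : 0 < (ss α β c (V ∩ O₂)).card := Finset.card_pos.2 ⟨b, hb2⟩
  obtain ⟨b1, hn1, hB1⟩ := ih ((ss α β c (V ∩ O₁)).card - 1) (by omega) (V ∩ O₁) hV1 (hVo.inter hO1) (by omega)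
  obtain ⟨b2, hn2, hB2⟩ := ih ((ss α β c (V ∩ O₂)).card - 1) (by omega) (V ∩ O₂) hV2 (hVo.inter hO2) (by omega)
  have hcov : ∀ t : ℂ, t ∈ O₁ ∨ t ∈ O₂ := by
    intro t
    simp only [O₁, O₂, Set.mem_ofPred_eq]
    by_contra hcon
    push Not at hcon
    linarith [hcon.1, hcon.2]
  have hdis : ∀ t ∈ MM α β c, t ∈ V ∩ O₁ → t ∉ V ∩ O₂ := by
    intro t ht h1 h2
    have := hx (ℓ t) (le_of_lt h2.2) (le_of_lt h1.2)
    exact this.2.2 t (mem_ss.2 ⟨ht, h1.1⟩) rfl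
  have hnn : nn α β c V = nn α β c (V ∩ O₁) + nn α β c (V ∩ O₂) := by
    refine nn_add (fun t _ => ⟨fun h => ?_, fun h => ?_⟩) hdis
    · rcases hcov t with h' | h'
      exacts [Or.inl ⟨h, h'⟩, Or.inr ⟨h, h'⟩]
    · rcases h with h | h <;> exact h.1
  have hD : Betti (Sx α β c ((V ∩ O₁) ∩ (V ∩ O₂))) 1 1 0 := by
    refine base_zero hP (hV1.inter hV2) ?_ ?_
    · have hd : 0 < ℓ b - ℓ a := by linarith
      let m : ℝ := (x - ℓ a) / (ℓ b - ℓ a)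
      have hm0 : 0 ≤ m := div_nonneg (by linarith [hx0.1]) hd.le
      have hm1 : m ≤ 1 := by
        rw [div_le_one hd]; linarith [hx0.2.1]
      have hmem := hV haV hbV (a := 1 - m) (b := m) (by linarith) hm0 (by ring)
      have hval : ℓ ((1 - m) • a + m • b) = x := by
        rw [map_add, map_smul, map_smul, smul_eq_mul, smul_eq_mul]
        simp only [m]
        field_simp
        ring
      refine ⟨_, ⟨hmem, ?_⟩, ⟨hmem, ?_⟩⟩
      · simp only [O₁, Set.mem_ofPred_eq, hval]; linarith
      · simp only [O₂, Set.mem_ofPred_eq, hval]; linarith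
    · apply Finset.eq_empty_of_forall_notMem
      intro t ht
      rw [mem_ss] at ht
      exact hdis t ht.1 ht.2.1 ht.2.2
  refine ⟨b1 + b2 + 1, by omega, ?_⟩
  refine (openCover_sets (W := Sx α β c V) (U := Sx α β c (V ∩ O₁)) (V := Sx α β c (V ∩ O₂)) (D := Sx α β c ((V ∩ O₁) ∩ (V ∩ O₂)))
    (Prod.fst ⁻¹' O₁) (Prod.fst ⁻¹' O₂) (hO1.preimage continuous_fst) (hO2.preimage continuous_fst) (Sx_inter _) (Sx_inter _)
    (fun w _ => hcov w.1) ?_).glue hD hB1 hB2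
  ext w
  simp only [Sx, Set.mem_ofPred_eq, Set.mem_inter_iff]
  tauto

lemma nn_full (hV : ∀ a, a ∈ V) : nn α β c V = (MM α β c).card := by
  classical
  unfold nn
  exact Multiset.countP_eq_card.2 (fun a _ => hV a)

theorem betti_Sx_univ (hdeg : (PP α β c).natDegree = 4) (hs : ∀ a, (PP α β c).eval a = 0 → (PP α β c).derivative.eval a ≠ 0) :
    Betti (Sx α β c Set.univ) 1 0 5 := by
  have hP : PP α β c ≠ 0 := by
    intro h; rw [h] at hdeg; simp at hdeg
  have h0 : (0:ℂ) ∈ ss α β c Set.univ := mem_ss.2 ⟨(mem_MM hP).2 (Or.inl rfl), trivial⟩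
  have hpos : 0 < (ss α β c Set.univ).card := Finset.card_pos.2 ⟨0, h0⟩
  obtain ⟨b, hb, hB⟩ := main_ind hP hs ((ss α β c Set.univ).card - 1) Set.univ convex_univ isOpen_univ (by omega)
  have hn : nn α β c Set.univ = 6 := by
    rw [nn_full (fun a => Set.mem_univ a)]
    rw [MM, Multiset.card_cons, Multiset.card_cons]
    rw [IsAlgClosed.card_roots_eq_natDegree, hdeg]
  obtain rfl : b = 5 := by omega
  exact hB

end CubicHom

open MvPolynomial CategoryTheory
/-! ### From smoothness to simple roots -/

namespace CubicHom
open Topology Module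

/-- the polynomial `c` in the variable `t = 2 - x` -/
noncomputable def cc (p₀ p₁ : ℂ) : Polynomial ℂ :=
  -(2 - Polynomial.X) ^ 2 + Polynomial.C p₁ * (2 - Polynomial.X) + Polynomial.C (p₀ + 4)

lemma cc_eval (p₀ p₁ t : ℂ) : (cc p₀ p₁).eval t = -(2 - t) ^ 2 + p₁ * (2 - t) + (p₀ + 4) := by
  simp [cc]

lemma cc_deriv (p₀ p₁ t : ℂ) : (cc p₀ p₁).derivative.eval t = 2 * (2 - t) - p₁ := by
  simp [cc, Polynomial.derivative_pow]
  ring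

lemma PP_deriv (α β : ℂ) (c : Polynomial ℂ) (t : ℂ) : (PP α β c).derivative.eval t =
    16 * c.eval t * (4 - t) + β ^ 2 + t * (16 * c.derivative.eval t * (4 - t) - 16 * c.eval t) - α ^ 2 := by
  simp [PP, Polynomial.derivative_pow]
  ring

lemma PP_natDegree (α β p₀ p₁ : ℂ) : (PP α β (cc p₀ p₁)).natDegree = 4 := by
  have : PP α β (cc p₀ p₁) = Polynomial.C 16 * Polynomial.X ^ 4 + Polynomial.C (16 * (p₁ - 8)) * Polynomial.X ^ 3
      + Polynomial.C (-16 * (2 * p₁ + p₀) + 64 * (4 - p₁)) * Polynomial.X ^ 2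
      + Polynomial.C (64 * (2 * p₁ + p₀) + β ^ 2 - α ^ 2) * Polynomial.X + Polynomial.C (4 * α ^ 2) := by
    apply Polynomial.funext
    intro r
    rw [PP_eval, cc_eval]
    simp
    ring
  rw [this]
  compute_degree!

lemma simple_of_smooth (p₀ p₁ p₂ p₃ : ℂ)
    (h : ∀ t s d : ℂ, ¬ (2 * t * s - 2 * (p₂ + p₃) = 0 ∧ 2 * (4 - t) * d - 2 * (p₂ - p₃) = 0 ∧
      s ^ 2 - d ^ 2 - 4 * (cc p₀ p₁).derivative.eval t = 0 ∧
      t * s ^ 2 + (4 - t) * d ^ 2 = 2 * (p₂ + p₃) * s + 2 * (p₂ - p₃) * d + 4 * (cc p₀ p₁).eval t)) :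
    ∀ a, (PP (2 * (p₂ + p₃)) (2 * (p₂ - p₃)) (cc p₀ p₁)).eval a = 0 →
      (PP (2 * (p₂ + p₃)) (2 * (p₂ - p₃)) (cc p₀ p₁)).derivative.eval a ≠ 0 := by
  intro a h1 h2
  rw [PP_eval] at h1
  rw [PP_deriv] at h2
  generalize 2 * (p₂ + p₃) = α at *
  generalize 2 * (p₂ - p₃) = β at *
  generalize cc p₀ p₁ = c at *
  by_cases h0 : a = 0
  · subst h0
    have hα : α = 0 := by
      have : α ^ 2 = 0 := by linear_combination h1 / 4
      simpa using this
    subst hα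
    obtain ⟨s, hs⟩ := IsAlgClosed.exists_pow_nat_eq ((β / 8) ^ 2 + 4 * c.derivative.eval 0) (n := 2) (by norm_num)
    refine h 0 s (β / 8) ⟨by ring, by ring, by rw [hs]; ring, ?_⟩
    linear_combination -h2 / 16
  by_cases h4 : a = 4
  · subst h4
    have hβ : β = 0 := by
      have : β ^ 2 = 0 := by linear_combination h1 / 4
      simpa using this
    subst hβ
    obtain ⟨d, hd⟩ := IsAlgClosed.exists_pow_nat_eq ((α / 8) ^ 2 - 4 * c.derivative.eval 4) (n := 2) (by norm_num)
    refine h 4 (α / 8) d ⟨by ring, by ring, by rw [hd]; ring, ?_⟩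
    linear_combination h2 / 16
  have h4' : 4 - a ≠ 0 := sub_ne_zero.2 (Ne.symm h4)
  have hc : c.eval a = -(a * β ^ 2 + α ^ 2 * (4 - a)) / (16 * a * (4 - a)) := by
    field_simp
    linear_combination h1
  have hc' : c.derivative.eval a = ((α / (2 * a)) ^ 2 - (β / (2 * (4 - a))) ^ 2) / 4 := by
    rw [hc] at h2
    field_simp at h2 ⊢
    have h3 : a * (4 - a) ≠ 0 := mul_ne_zero h0 h4'
    linear_combination h2
  refine h a (α / (2 * a)) (β / (2 * (4 - a))) ⟨by field_simp; ring, by field_simp; ring, by rw [hc']; ring, ?_⟩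
  rw [hc]
  field_simp
  ring

end CubicHom

open MvPolynomial CategoryTheory
/-! ### The final theorem -/

namespace CubicHom
open Topology Module

lemma dual_equiv {V W : Type} [AddCommGroup V] [Module ℂ V] [AddCommGroup W] [Module ℂ W] [Module.Finite ℂ V] [Module.Finite ℂ W]
    (h : finrank ℂ V = finrank ℂ W) : Nonempty (Module.Dual ℂ V ≃ₗ[ℂ] W) :=
  ⟨LinearEquiv.ofFinrankEq _ _ (Subspace.dual_finrank_eq.trans h)⟩

lemma dual_sub {V : Type} [AddCommGroup V] [Module ℂ V] [Module.Finite ℂ V]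
    (h : finrank ℂ V = 0) : Subsingleton (Module.Dual ℂ V) :=
  Module.finrank_zero_iff.1 (Subspace.dual_finrank_eq.trans h)

lemma betti_surface (p₀ p₁ p₂ p₃ : ℂ)
    (R : MvPolynomial (Fin 3) ℂ)
    (hRdef : R = X 0 * X 1 * X 2 - X 0 ^ 2 - X 1 ^ 2 - X 2 ^ 2
      + C p₁ * X 0 + C p₂ * X 1 + C p₃ * X 2 + C p₀ + 4)
    (hsmooth : ∀ x : Fin 3 → ℂ, eval x R = 0 → ∃ i, eval x (pderiv i R) ≠ 0) :
    Betti {x : Fin 3 → ℂ // eval x R = 0} 1 0 5 := by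
  have hev : ∀ x : Fin 3 → ℂ, eval x R = x 0 * x 1 * x 2 - x 0 ^ 2 - x 1 ^ 2 - x 2 ^ 2
      + p₁ * x 0 + p₂ * x 1 + p₃ * x 2 + p₀ + 4 := by
    intro x; rw [hRdef]; simp
  have h4 : (4 : MvPolynomial (Fin 3) ℂ) = C 4 := (map_ofNat C 4).symm
  have hd0 : ∀ x : Fin 3 → ℂ, eval x (pderiv 0 R) = x 1 * x 2 - 2 * x 0 + p₁ := by
    intro x; rw [hRdef, h4]; simp [pderiv_X, Derivation.leibniz, Derivation.leibniz_pow]; ring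
  have hd1 : ∀ x : Fin 3 → ℂ, eval x (pderiv 1 R) = x 0 * x 2 - 2 * x 1 + p₂ := by
    intro x; rw [hRdef, h4]; simp [pderiv_X, Derivation.leibniz, Derivation.leibniz_pow]; ring
  have hd2 : ∀ x : Fin 3 → ℂ, eval x (pderiv 2 R) = x 0 * x 1 - 2 * x 2 + p₃ := by
    intro x; rw [hRdef, h4]; simp [pderiv_X, Derivation.leibniz, Derivation.leibniz_pow]
  have hB := betti_Sx_univ (α := 2 * (p₂ + p₃)) (β := 2 * (p₂ - p₃)) (c := cc p₀ p₁)
    (PP_natDegree _ _ _ _) (simple_of_smooth p₀ p₁ p₂ p₃ (by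
      rintro t s d ⟨h1, h2, h3, h5⟩
      rw [cc_deriv] at h3
      rw [cc_eval] at h5
      obtain ⟨i, hi⟩ := hsmooth ![2 - t, (s + d) / 2, (s - d) / 2] (by
        rw [hev]; simp
        linear_combination -h5 / 4)
      apply hi
      fin_cases i
      · simp only [Fin.zero_eta]
        rw [hd0]; simp
        linear_combination h3 / 4
      · simp only [Fin.mk_one]
        rw [hd1]; simp
        linear_combination -h1 / 4 - h2 / 4
      · simp only [Fin.reduceFinMk]
        rw [hd2]; simp
        linear_combination -h1 / 4 + h2 / 4))
  refine Betti.of_homeo hB ?_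
  refine homeoOn (S' := {x : Fin 3 → ℂ | eval x R = 0})
    (fun w => ![2 - w.1, (w.2.1 + w.2.2) / 2, (w.2.1 - w.2.2) / 2])
    (fun x => (2 - x 0, x 1 + x 2, x 1 - x 2)) ?_ ?_ ?_ ?_ ?_ ?_
  · rintro ⟨t, s, d⟩ ⟨_, h⟩
    change eval _ R = 0
    rw [cc_eval] at h
    rw [hev]; simp at h ⊢
    linear_combination -h / 4
  · intro x hx
    change eval _ R = 0 at hx
    rw [hev] at hx
    refine ⟨trivial, ?_⟩
    rw [cc_eval]
    linear_combination -4 * hx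
  · rintro ⟨t, s, d⟩ _
    simp
    constructor <;> ring
  · intro x _
    ext i
    fin_cases i <;> simp
  · apply Continuous.continuousOn
    apply continuous_pi
    intro i
    fin_cases i <;> simp <;> fun_prop
  · apply Continuous.continuousOn
    fun_prop

end CubicHom

/-- If the affine cubic surface
`C = {X₁X₂X₃ - X₁² - X₂² - X₃² + p₁X₁ + p₂X₂ + p₃X₃ + p₀ + 4 = 0} ⊂ ℂ³` is smooth,
then its singular cohomology with complex coefficients satisfies `H⁰(C) = ℂ`,
`H¹(C) = 0`, `H²(C) = ℂ⁵`, and `Hⁱ(C) = 0` for `i > 2`. -/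
theorem cohomology_of_smooth_affine_cubic (p₀ p₁ p₂ p₃ : ℂ)
    (R : MvPolynomial (Fin 3) ℂ)
    (hRdef : R = X 0 * X 1 * X 2 - X 0 ^ 2 - X 1 ^ 2 - X 2 ^ 2
      + C p₁ * X 0 + C p₂ * X 1 + C p₃ * X 2 + C p₀ + 4)
    (hsmooth : ∀ x : Fin 3 → ℂ, eval x R = 0 → ∃ i, eval x (pderiv i R) ≠ 0)
    (Csurf : TopCat.{0})
    (hC : Csurf = TopCat.of {x : Fin 3 → ℂ // eval x R = 0}) :
    Nonempty (SingularCohomologyC Csurf 0 ≃ₗ[ℂ] ℂ) ∧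
    Subsingleton (SingularCohomologyC Csurf 1) ∧
    Nonempty (SingularCohomologyC Csurf 2 ≃ₗ[ℂ] (Fin 5 → ℂ)) ∧
    (∀ i : ℕ, 2 < i → Subsingleton (SingularCohomologyC Csurf i)) := by
  subst hC
  have hB := CubicHom.betti_surface p₀ p₁ p₂ p₃ R hRdef hsmooth
  have hf := hB.fin
  refine ⟨?_, CubicHom.dual_sub (V := CubicHom.HH {x : Fin 3 → ℂ // eval x R = 0} 1) hB.b1, ?_,
    fun i hi => CubicHom.dual_sub (V := CubicHom.HH {x : Fin 3 → ℂ // eval x R = 0} i) (hB.b3 i hi)⟩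
  · exact CubicHom.dual_equiv (V := CubicHom.HH {x : Fin 3 → ℂ // eval x R = 0} 0) (W := ℂ) (hB.b0.trans (by simp))
  · exact CubicHom.dual_equiv (V := CubicHom.HH {x : Fin 3 → ℂ // eval x R = 0} 2) (W := Fin 5 → ℂ) (hB.b2.trans (by simp))
end

section
/- If C is a smooth affine cubic surface as above (with H^1(C, C) = 0), then every algebraic regular nowhere-vanishing function on C is constant. -/
open MvPolynomial

namespace CubicAux
open Polynomial

theorem disc_aux (u v : Polynomial ℂ) (h : u ^ 2 + u * v * Polynomial.X + v ^ 2 = 0) :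
    u = 0 ∧ v = 0 := by
  by_cases hv : v = 0
  · subst hv
    simpa using h
  exfalso
  set w := 2 * u + v * Polynomial.X with hw
  have h2 : (Polynomial.C (2 : ℂ)) = 2 := rfl
  have e : w ^ 2 = v ^ 2 * ((Polynomial.X - Polynomial.C 2) * (Polynomial.X - Polynomial.C (-2))) := by
    rw [hw, Polynomial.C_neg, h2]
    linear_combination 4 * h
  have hA : (Polynomial.X - Polynomial.C (2 : ℂ)) ≠ 0 := Polynomial.X_sub_C_ne_zero _
  have hB : (Polynomial.X - Polynomial.C (-2 : ℂ)) ≠ 0 := Polynomial.X_sub_C_ne_zero _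
  have hne : v ^ 2 * ((Polynomial.X - Polynomial.C (2 : ℂ)) * (Polynomial.X - Polynomial.C (-2))) ≠ 0 :=
    mul_ne_zero (pow_ne_zero _ hv) (mul_ne_zero hA hB)
  have hw0 : w ≠ 0 := by
    intro h0
    rw [h0] at e
    apply hne
    rw [← e]; simp
  have hr := congrArg (Polynomial.rootMultiplicity (2 : ℂ)) e
  rw [Polynomial.rootMultiplicity_mul hne, Polynomial.rootMultiplicity_mul (mul_ne_zero hA hB),
    Polynomial.rootMultiplicity_X_sub_C_self, Polynomial.rootMultiplicity_X_sub_C,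
    pow_two, pow_two,
    Polynomial.rootMultiplicity_mul (mul_ne_zero hw0 hw0),
    Polynomial.rootMultiplicity_mul (mul_ne_zero hv hv)] at hr
  rw [if_neg (by norm_num)] at hr
  omega

theorem norm_aux (a b q s : Polynomial (Polynomial ℂ))
    (hs : s.natDegree ≤ 1) (hs1 : s.coeff 1 = Polynomial.X)
    (hq : q.natDegree ≤ 2) (hq2 : q.coeff 2 = 1)
    (hN : (a * a + (a * b) * s + (b * b) * q).natDegree = 0) :
    b = 0 ∧ a.natDegree = 0 := by
  by_cases hb : b = 0
  · subst hb
    refine ⟨rfl, ?_⟩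
    have h1 : (a * a).natDegree = 0 := by simpa using hN
    by_cases ha : a = 0
    · simp [ha]
    rw [Polynomial.natDegree_mul ha ha] at h1
    omega
  exfalso
  obtain ⟨m, ham, hbm, hor⟩ : ∃ m, a.natDegree ≤ m + 1 ∧ b.natDegree ≤ m ∧
      (a.natDegree = m + 1 ∨ b.natDegree = m) := by
    refine ⟨max (a.natDegree - 1) b.natDegree, ?_, ?_, ?_⟩ <;> omega
  have hc : (a * a + (a * b) * s + (b * b) * q).coeff (m + 1 + (m + 1)) = 0 :=
    Polynomial.coeff_eq_zero_of_natDegree_lt (by omega)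
  have hab : (a * b).natDegree ≤ (m + 1) + m := Polynomial.natDegree_mul_le_of_le ham hbm
  have hbb : (b * b).natDegree ≤ m + m := Polynomial.natDegree_mul_le_of_le hbm hbm
  have c1 := Polynomial.coeff_mul_add_eq_of_natDegree_le ham ham
  have c2 := Polynomial.coeff_mul_add_eq_of_natDegree_le hab hs
  have c3 := Polynomial.coeff_mul_add_eq_of_natDegree_le hbb hq
  rw [Polynomial.coeff_mul_add_eq_of_natDegree_le ham hbm, hs1] at c2
  rw [Polynomial.coeff_mul_add_eq_of_natDegree_le hbm hbm, hq2] at c3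
  rw [show m + 1 + m + 1 = m + 1 + (m + 1) by ring] at c2
  rw [show m + m + 2 = m + 1 + (m + 1) by ring] at c3
  rw [Polynomial.coeff_add, Polynomial.coeff_add, c1, c2, c3] at hc
  obtain ⟨hu, hv⟩ := disc_aux (a.coeff (m + 1)) (b.coeff m) (by linear_combination hc)
  rcases hor with h | h
  · rw [← h] at hu
    have : a = 0 := Polynomial.leadingCoeff_eq_zero.mp hu
    rw [this] at h; simp at h
  · rw [← h] at hv
    exact hb (Polynomial.leadingCoeff_eq_zero.mp hv)

theorem const_aux (p : Polynomial ℂ) (h : ∀ x, p.eval x ≠ 0) : p.natDegree = 0 := by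
  by_contra hd
  obtain ⟨x, hx⟩ := IsAlgClosed.exists_root p
    (fun h0 => hd (Polynomial.natDegree_eq_of_degree_eq_some h0))
  exact h x hx

theorem nonvan_aux (N : Polynomial (Polynomial ℂ)) (h : ∀ x y, N.evalEval y x ≠ 0) :
    N.natDegree = 0 := by
  by_contra hd
  have hN : N ≠ 0 := by rintro rfl; simp at hd
  have hl : N.leadingCoeff ≠ 0 := Polynomial.leadingCoeff_ne_zero.mpr hN
  obtain ⟨y, hy⟩ : ∃ y, N.leadingCoeff.eval y ≠ 0 := by
    by_contra! hc
    exact hl (Polynomial.funext (by simpa using hc))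
  have hdeg := Polynomial.natDegree_map_of_leadingCoeff_ne_zero (Polynomial.evalRingHom y)
    (p := N) (by simpa using hy)
  apply hd
  rw [← hdeg]
  apply const_aux
  intro x
  have := h x y
  rwa [← Polynomial.map_evalRingHom_eval] at this

end CubicAux

/-- On a smooth affine cubic surface `C = {R = 0}` (which has
`H¹(C, ℂ) = 0`), every regular nowhere-vanishing function — i.e. every polynomial
function that does not vanish at any point of `C` — is constant on `C`. -/
theorem nonvanishing_function_constant (p₀ p₁ p₂ p₃ : ℂ)
    (R : MvPolynomial (Fin 3) ℂ)
    (hRdef : R = X 0 * X 1 * X 2 - X 0 ^ 2 - X 1 ^ 2 - X 2 ^ 2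
      + C p₁ * X 0 + C p₂ * X 1 + C p₃ * X 2 + C p₀ + 4)
    (hsmooth : ∀ x : Fin 3 → ℂ, eval x R = 0 → ∃ i, eval x (pderiv i R) ≠ 0)
    (f : MvPolynomial (Fin 3) ℂ)
    (hf : ∀ x : Fin 3 → ℂ, eval x R = 0 → eval x f ≠ 0) :
    ∃ c : ℂ, ∀ x : Fin 3 → ℂ, eval x R = 0 → eval x f = c := by
  have hR : ∀ x : Fin 3 → ℂ, eval x R = x 0 * x 1 * x 2 - x 0 ^ 2 - x 1 ^ 2 - x 2 ^ 2
      + p₁ * x 0 + p₂ * x 1 + p₃ * x 2 + p₀ + 4 := by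
    intro x
    have h4 : (4 : MvPolynomial (Fin 3) ℂ) = C 4 := by exact (map_ofNat C 4).symm
    rw [hRdef, h4]
    simp only [map_add, map_sub, map_mul, map_pow, eval_X, eval_C]
  set s : Polynomial (Polynomial ℂ) :=
    Polynomial.C Polynomial.X * Polynomial.X + Polynomial.C (Polynomial.C p₃) with hs
  set q : Polynomial (Polynomial ℂ) :=
    Polynomial.C 1 * Polynomial.X ^ 2 + Polynomial.C (Polynomial.C (-p₁)) * Polynomial.X
      + Polynomial.C (Polynomial.X ^ 2 + Polynomial.C (-p₂) * Polynomial.X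
      + Polynomial.C (-p₀ - 4)) with hq
  have es : ∀ x y, s.evalEval y x = x * y + p₃ := by
    intro x y
    simp [hs, Polynomial.evalEval]
  have eq : ∀ x y, q.evalEval y x = x ^ 2 + y ^ 2 - p₁ * x - p₂ * y - p₀ - 4 := by
    intro x y
    simp [hq, Polynomial.evalEval]; ring
  have key : ∃ a b : Polynomial (Polynomial ℂ), ∀ x : Fin 3 → ℂ, eval x R = 0 →
      eval x f = a.evalEval (x 1) (x 0) + b.evalEval (x 1) (x 0) * x 2 := by
    clear hf
    induction f using MvPolynomial.induction_on with
    | C r =>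
      refine ⟨Polynomial.C (Polynomial.C r), 0, fun x _ => ?_⟩
      simp [Polynomial.evalEval]
    | add f g hf hg =>
      obtain ⟨a, b, h⟩ := hf
      obtain ⟨a', b', h'⟩ := hg
      refine ⟨a + a', b + b', fun x hx => ?_⟩
      rw [map_add, h x hx, h' x hx, Polynomial.evalEval_add, Polynomial.evalEval_add]
      ring
    | mul_X f i hf =>
      obtain ⟨a, b, h⟩ := hf
      fin_cases i
      · refine ⟨a * Polynomial.X, b * Polynomial.X, fun x hx => ?_⟩
        rw [map_mul, h x hx]
        simp [Polynomial.evalEval]; ring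
      · refine ⟨a * Polynomial.C Polynomial.X, b * Polynomial.C Polynomial.X, fun x hx => ?_⟩
        rw [map_mul, h x hx]
        simp [Polynomial.evalEval]; ring
      · refine ⟨- (b * q), a + b * s, fun x hx => ?_⟩
        rw [map_mul, h x hx, Polynomial.evalEval_add, Polynomial.evalEval_neg,
          Polynomial.evalEval_mul, Polynomial.evalEval_mul, es, eq]
        rw [hR] at hx
        simp only [Fin.reduceFinMk, eval_X]
        linear_combination (-b.evalEval (x 1) (x 0)) * hx
  obtain ⟨a, b, hab⟩ := key
  -- the two points over (x, y)
  have roots : ∀ x y : ℂ, ∃ z w : ℂ, z + w = x * y + p₃ ∧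
      z * w = x ^ 2 + y ^ 2 - p₁ * x - p₂ * y - p₀ - 4 := by
    intro x y
    obtain ⟨d, hd⟩ := IsAlgClosed.exists_pow_nat_eq
      ((x * y + p₃) ^ 2 - 4 * (x ^ 2 + y ^ 2 - p₁ * x - p₂ * y - p₀ - 4)) (n := 2) (by norm_num)
    refine ⟨(x * y + p₃ + d) / 2, (x * y + p₃ - d) / 2, by ring, ?_⟩
    linear_combination (-1 / 4) * hd
  have onS : ∀ x y z w : ℂ, z + w = x * y + p₃ →
      z * w = x ^ 2 + y ^ 2 - p₁ * x - p₂ * y - p₀ - 4 → eval ![x, y, z] R = 0 := by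
    intro x y z w h1 h2
    rw [hR]
    simp
    linear_combination (-z) * h1 + h2
  have hN : (a * a + (a * b) * s + (b * b) * q).natDegree = 0 := by
    apply CubicAux.nonvan_aux
    intro x y
    obtain ⟨z, w, h1, h2⟩ := roots x y
    have z1 := onS x y z w h1 h2
    have z2 := onS x y w z (by rw [add_comm, h1]) (by rw [mul_comm, h2])
    have f1 := hf _ z1
    have f2 := hf _ z2
    rw [hab _ z1] at f1
    rw [hab _ z2] at f2
    simp at f1 f2
    have := mul_ne_zero f1 f2
    simp only [Polynomial.evalEval_add, Polynomial.evalEval_mul, es, eq]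
    intro h0
    apply this
    linear_combination h0 + a.evalEval y x * b.evalEval y x * h1 + b.evalEval y x ^ 2 * h2
  obtain ⟨hb, ha⟩ := CubicAux.norm_aux a b q s
    (by rw [hs]; exact Polynomial.natDegree_linear_le)
    (by simp [hs, Polynomial.coeff_C])
    (by rw [hq]; exact Polynomial.natDegree_quadratic_le)
    (by rw [hq]; simp only [Polynomial.coeff_add, Polynomial.coeff_C_mul, Polynomial.coeff_X_pow, Polynomial.coeff_X, Polynomial.coeff_C]; simp) hN
  obtain ⟨g, rfl⟩ := Polynomial.natDegree_eq_zero.mp ha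
  subst hb
  have hg : g.natDegree = 0 := by
    apply CubicAux.const_aux
    intro y
    obtain ⟨z, w, h1, h2⟩ := roots 0 y
    have z1 := onS 0 y z w h1 h2
    have f1 := hf _ z1
    rw [hab _ z1] at f1
    simpa [Polynomial.evalEval] using f1
  obtain ⟨c, rfl⟩ := Polynomial.natDegree_eq_zero.mp hg
  refine ⟨c, fun x hx => ?_⟩
  rw [hab x hx]
  simp [Polynomial.evalEval]
end
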